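/- Under the steady assumptions (H1)–(H3), assume additionally: (inver_dege) for every δ>0 there exists ν_δ>0 such that A_θ(x) ≥ ν_δ I (in the sense of symmetric matrices) for all θ∈Θ and all x with dist(x,Σ) > δ; each H_θ(x,·) is convex on ℝ^N for every x ∈ 𝕋^N; and (cvx_neuf) for every x∈Σ, every 0<λ<1 and all p≠q in ℝ^N, inf_{θ∈Θ}{λH_θ(x,p)+(1−λ)H_θ(x,q)−H_θ(x,λp+(1−λ)q)} > 0. Then the viscosity solution u of the Cauchy problem (CP) satisfies u(x,t)+ct → u_∞(x) uniformly on 𝕋^N as t→+∞, where c is the ergodic constant and u_∞ is a Lipschitz viscosity solution of the ergodic problem. -/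

import Mathlib

open Filter
open scoped RealInnerProductSpace Matrix

noncomputable section

namespace LargeTimeBehavior

/-- Euclidean space ℝ^N; ℤ^N-periodic functions on it represent functions on the torus 𝕋^N. -/
abbrev E (N : ℕ) := EuclideanSpace ℝ (Fin N)

variable {N : ℕ} {Θ : Type*}

/-- `f` is ℤ^N-periodic. -/
def ZPeriodic {α : Type*} (f : E N → α) : Prop :=
  ∀ (x : E N) (k : Fin N → ℤ), f (x + (WithLp.equiv 2 (Fin N → ℝ)).symm fun i => (k i : ℝ)) = f x

/-- Hessian matrix of a real function on ℝ^N. -/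
def hessMatrix (φ : E N → ℝ) (x : E N) : Matrix (Fin N) (Fin N) ℝ :=
  Matrix.of fun i j =>
    fderiv ℝ (fun y => fderiv ℝ φ y (EuclideanSpace.single j 1)) x (EuclideanSpace.single i 1)

/-- The totally degenerate set Σ = {x : A_θ(x) = 0 for all θ}. -/
def degenSet (A : Θ → E N → Matrix (Fin N) (Fin N) ℝ) : Set (E N) :=
  {x | ∀ θ, A θ x = 0}

/-- Value of the operator −trace(A_θ(x)D²φ) + H_θ(x,Dφ) on a C² test function φ at x. -/
def opVal (A : Θ → E N → Matrix (Fin N) (Fin N) ℝ) (H : Θ → E N → E N → ℝ)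
    (θ : Θ) (x : E N) (φ : E N → ℝ) : ℝ :=
  -Matrix.trace (A θ x * hessMatrix φ x) + H θ x (gradient φ x)

/-- Viscosity subsolution of ∂u/∂t + sup_θ{−tr(A_θD²u)+H_θ(x,Du)} = 0 on ℝ^N×(0,∞). -/
def IsSubSolCP (A : Θ → E N → Matrix (Fin N) (Fin N) ℝ) (H : Θ → E N → E N → ℝ)
    (u : E N → ℝ → ℝ) : Prop :=
  ∀ φ : E N → ℝ → ℝ, ContDiff ℝ 2 (fun q : E N × ℝ => φ q.1 q.2) →
    ∀ (x₀ : E N) (t₀ : ℝ), 0 < t₀ →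
      IsLocalMax (fun q : E N × ℝ => u q.1 q.2 - φ q.1 q.2) (x₀, t₀) →
      deriv (φ x₀) t₀ + (⨆ θ, opVal A H θ x₀ fun y => φ y t₀) ≤ 0

/-- Viscosity supersolution of the Cauchy problem. -/
def IsSuperSolCP (A : Θ → E N → Matrix (Fin N) (Fin N) ℝ) (H : Θ → E N → E N → ℝ)
    (u : E N → ℝ → ℝ) : Prop :=
  ∀ φ : E N → ℝ → ℝ, ContDiff ℝ 2 (fun q : E N × ℝ => φ q.1 q.2) →
    ∀ (x₀ : E N) (t₀ : ℝ), 0 < t₀ →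
      IsLocalMin (fun q : E N × ℝ => u q.1 q.2 - φ q.1 q.2) (x₀, t₀) →
      0 ≤ deriv (φ x₀) t₀ + (⨆ θ, opVal A H θ x₀ fun y => φ y t₀)

/-- Viscosity solution of the Cauchy problem. -/
def IsSolCP (A : Θ → E N → Matrix (Fin N) (Fin N) ℝ) (H : Θ → E N → E N → ℝ)
    (u : E N → ℝ → ℝ) : Prop :=
  IsSubSolCP A H u ∧ IsSuperSolCP A H u

/-- Viscosity subsolution of the ergodic problem sup_θ{−tr(A_θD²v)+H_θ(x,Dv)} = c. -/
def IsSubSolErg (A : Θ → E N → Matrix (Fin N) (Fin N) ℝ) (H : Θ → E N → E N → ℝ)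
    (c : ℝ) (v : E N → ℝ) : Prop :=
  ∀ φ : E N → ℝ, ContDiff ℝ 2 φ → ∀ x₀ : E N,
    IsLocalMax (fun x => v x - φ x) x₀ → (⨆ θ, opVal A H θ x₀ φ) ≤ c

/-- Viscosity supersolution of the ergodic problem. -/
def IsSuperSolErg (A : Θ → E N → Matrix (Fin N) (Fin N) ℝ) (H : Θ → E N → E N → ℝ)
    (c : ℝ) (v : E N → ℝ) : Prop :=
  ∀ φ : E N → ℝ, ContDiff ℝ 2 φ → ∀ x₀ : E N,
    IsLocalMin (fun x => v x - φ x) x₀ → c ≤ (⨆ θ, opVal A H θ x₀ φ)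

/-- Viscosity solution of the ergodic problem. -/
def IsSolErg (A : Θ → E N → Matrix (Fin N) (Fin N) ℝ) (H : Θ → E N → E N → ℝ)
    (c : ℝ) (v : E N → ℝ) : Prop :=
  IsSubSolErg A H c v ∧ IsSuperSolErg A H c v

/-- Viscosity subsolution of the discounted equation λw + sup_θ{−tr(A_θD²w)+H_θ(x,Dw)} = 0. -/
def IsSubSolDisc (A : Θ → E N → Matrix (Fin N) (Fin N) ℝ) (H : Θ → E N → E N → ℝ)
    (lam : ℝ) (w : E N → ℝ) : Prop :=
  ∀ φ : E N → ℝ, ContDiff ℝ 2 φ → ∀ x₀ : E N,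
    IsLocalMax (fun x => w x - φ x) x₀ → lam * w x₀ + (⨆ θ, opVal A H θ x₀ φ) ≤ 0

/-- Viscosity supersolution of the discounted equation. -/
def IsSuperSolDisc (A : Θ → E N → Matrix (Fin N) (Fin N) ℝ) (H : Θ → E N → E N → ℝ)
    (lam : ℝ) (w : E N → ℝ) : Prop :=
  ∀ φ : E N → ℝ, ContDiff ℝ 2 φ → ∀ x₀ : E N,
    IsLocalMin (fun x => w x - φ x) x₀ → 0 ≤ lam * w x₀ + (⨆ θ, opVal A H θ x₀ φ)

/-- Viscosity solution of the discounted equation. -/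
def IsSolDisc (A : Θ → E N → Matrix (Fin N) (Fin N) ℝ) (H : Θ → E N → E N → ℝ)
    (lam : ℝ) (w : E N → ℝ) : Prop :=
  IsSubSolDisc A H lam w ∧ IsSuperSolDisc A H lam w

/-- P_{ημ}[u](x,t) = sup_{s ≥ t} { u(x,t) − v(x) − μ(u(x,s) − v(x)) − μη(s−t) }. -/
def Pfun (u : E N → ℝ → ℝ) (v : E N → ℝ) (η μ : ℝ) (x : E N) (t : ℝ) : ℝ :=
  sSup ((fun s => u x t - v x - μ * (u x s - v x) - μ * η * (s - t)) '' Set.Ici t)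

/-- M_{ημ}[u](t) = sup_x P_{ημ}[u](x,t). -/
def Mfun (u : E N → ℝ → ℝ) (v : E N → ℝ) (η μ : ℝ) (t : ℝ) : ℝ :=
  sSup (Set.range fun x : E N => Pfun u v η μ x t)

/-- Viscosity subsolution of
  min{ U , ∂U/∂t + inf_θ{−tr(A_θ(x)D²U)} − C₀|DU| } ≤ 0 on ℝ^N×(0,∞). -/
def IsSubSolMinIneq (A : Θ → E N → Matrix (Fin N) (Fin N) ℝ) (C₀ : ℝ)
    (U : E N → ℝ → ℝ) : Prop :=
  ∀ φ : E N → ℝ → ℝ, ContDiff ℝ 2 (fun q : E N × ℝ => φ q.1 q.2) →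
    ∀ (x₀ : E N) (t₀ : ℝ), 0 < t₀ →
      IsLocalMax (fun q : E N × ℝ => U q.1 q.2 - φ q.1 q.2) (x₀, t₀) →
      U x₀ t₀ ≤ 0 ∨
        deriv (φ x₀) t₀ + (⨅ θ, -Matrix.trace (A θ x₀ * hessMatrix (fun y => φ y t₀) x₀))
          - C₀ * ‖gradient (fun y => φ y t₀) x₀‖ ≤ 0

/-- The unit cube [0,1]^N. -/
def cube (N : ℕ) : Set (E N) := {x | ∀ i, x i ∈ Set.Icc (0:ℝ) 1}

/-- Assumption (sur-sol-stricte) with constant C. -/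
def SurSolStricte (A : Θ → E N → Matrix (Fin N) (Fin N) ℝ) (C : ℝ) : Prop :=
  ∀ δ > (0:ℝ), ∃ ψ : E N → ℝ, ContDiff ℝ 2 ψ ∧
    ∃ Ω : Set (E N), IsOpen Ω ∧ Bornology.IsBounded Ω ∧ cube N ⊆ Ω ∧
      (∀ x ∈ Ω, ψ x ≤ 0) ∧ (∀ x ∉ Ω, 0 ≤ ψ x) ∧
      ∀ x ∈ Ω, (∀ y ∈ degenSet A, δ < dist x y) →
        0 < (⨅ θ, -Matrix.trace (A θ x * hessMatrix ψ x)) - C * ‖gradient ψ x‖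

/-- Assumption (inver_dege): uniform ellipticity at distance > δ from Σ. -/
def InverDege (A : Θ → E N → Matrix (Fin N) (Fin N) ℝ) : Prop :=
  ∀ δ > (0:ℝ), ∃ ν > (0:ℝ), ∀ (θ : Θ) (x : E N),
    (∀ y ∈ degenSet A, δ < dist x y) →
    (A θ x - ν • (1 : Matrix (Fin N) (Fin N) ℝ)).PosSemidef

/-- Frobenius norm of a matrix. -/
def mnorm (M : Matrix (Fin N) (Fin N) ℝ) : ℝ := Real.sqrt (∑ i, ∑ j, (M i j)^2)

open Topology
set_option linter.all false

section jets
variable {V : Type*} [NormedAddCommGroup V] [InnerProductSpace ℝ V]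

def UJet (f : V → ℝ) (X p : V) (B : V →L[ℝ] V) : Prop :=
  ∀ α > (0:ℝ), ∀ᶠ Y in 𝓝 X, f Y ≤ f X + ⟪p, Y - X⟫ + (1/2) * ⟪B (Y - X), Y - X⟫ + α * ‖Y - X‖^2

lemma UJet.congr {f g : V → ℝ} {X p : V} {B : V →L[ℝ] V} (h : UJet f X p B)
    (e : f =ᶠ[𝓝 X] g) : UJet g X p B := by
  intro α hα
  filter_upwards [h α hα, e] with Y h1 h2
  rw [← h2, ← e.eq_of_nhds]; exact h1

lemma UJet.transfer {f h : V → ℝ} {X p s : V} {κ : ℝ} {B : V →L[ℝ] V} (hj : UJet h X p B)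
    (h1 : ∀ Y, f (Y + s) + κ ≤ h Y) (h2 : f (X + s) + κ = h X) : UJet f (X + s) p B := by
  intro α hα
  have ht : Tendsto (fun Y : V => Y - s) (𝓝 (X + s)) (𝓝 X) := by
    have : Continuous (fun Y : V => Y - s) := by fun_prop
    simpa using this.tendsto (X + s)
  filter_upwards [ht.eventually (hj α hα)] with Y hY
  have e : Y - s - X = Y - (X + s) := by abel
  rw [e] at hY
  have := h1 (Y - s)
  rw [sub_add_cancel] at this
  linarith

lemma UJet.smul {f : V → ℝ} {X p : V} {B : V →L[ℝ] V} (h : UJet f X p B) {c : ℝ} (hc : 0 < c) :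
    UJet (fun Y => c * f Y) X (c • p) (c • B) := by
  intro α hα
  filter_upwards [h (α / c) (by positivity)] with Y hY
  simp only [inner_smul_left, smul_apply, RCLike.conj_to_real]
  have := mul_le_mul_of_nonneg_left hY hc.le
  have e : c * (α / c) = α := by field_simp
  calc c * f Y ≤ _ := this
    _ = _ := by rw [mul_add, ← mul_assoc c (α/c), e]; ring

lemma poly_first {a K : ℝ} (h : ∀ᶠ s in 𝓝 (0:ℝ), a * s - K * s ^ 2 ≤ 0) : a = 0 := by
  obtain ⟨r, hr, hr'⟩ := Metric.eventually_nhds_iff.1 h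
  by_contra ha
  set m := min (r/2) (|a| / (2 * (|K| + 1))) with hm
  have ha' : 0 < |a| := abs_pos.2 ha
  have hm0 : 0 < m := by positivity
  have h1 : m < r := lt_of_le_of_lt (min_le_left _ _) (by linarith)
  have h2 : m * (2 * (|K| + 1)) ≤ |a| := by
    have : m ≤ (|a| / (2 * (|K| + 1))) := min_le_right _ _
    rwa [le_div_iff₀ (by positivity)] at this
  have h3 : K ≤ |K| := le_abs_self K
  rcases lt_or_gt_of_ne ha with h | h
  · have := @hr' (-m) (by simp [abs_of_pos hm0, h1])
    rw [abs_of_neg h] at h2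
    nlinarith
  · have := @hr' m (by simp [abs_of_pos hm0, h1])
    rw [abs_of_pos h] at h2
    nlinarith

lemma poly_second {b K : ℝ} (h : ∀ α > (0:ℝ), ∀ᶠ s in 𝓝 (0:ℝ), b * s ^ 2 - α * K * s ^ 2 ≤ 0) :
    b ≤ 0 := by
  by_contra hb
  push Not at hb
  obtain ⟨r, hr, hr'⟩ := Metric.eventually_nhds_iff.1 (h (b / (2 * (|K| + 1))) (by positivity))
  have := @hr' (r/2) (by simp [abs_of_pos hr]; linarith)
  have h3 : K ≤ |K| := le_abs_self K
  have h4 : b / (2 * (|K| + 1)) * K ≤ b / 2 := by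
    rw [div_mul_eq_mul_div, div_le_iff₀ (by positivity)]
    nlinarith [abs_nonneg K]
  nlinarith [sq_pos_of_pos (half_pos hr)]

lemma line_tendsto (X d : V) : Tendsto (fun s : ℝ => X + s • d) (𝓝 0) (𝓝 X) := by
  have : Continuous (fun s : ℝ => X + s • d) := by fun_prop
  simpa using this.tendsto 0

/-- along a line -/
lemma UJet.line {f : V → ℝ} {X p : V} {B : V →L[ℝ] V} (h : UJet f X p B) (d : V) :
    ∀ α > (0:ℝ), ∀ᶠ s in 𝓝 (0:ℝ), f (X + s • d) ≤ f X + s * ⟪p, d⟫ + s^2/2 * ⟪B d, d⟫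
      + α * ‖d‖^2 * s^2 := by
  intro α hα
  filter_upwards [(line_tendsto X d).eventually (h α hα)] with s hs
  have e : X + s • d - X = s • d := by abel
  rw [e] at hs
  simp only [map_smul, inner_smul_left, inner_smul_right, norm_smul, RCLike.conj_to_real,
    Real.norm_eq_abs, mul_pow, sq_abs] at hs
  linarith

lemma UJet.inner_le {f : V → ℝ} {X p : V} {B : V →L[ℝ] V} (h : UJet f X p B) {e : V} {L : ℝ}
    (hL : ∀ s : ℝ, |f (X + s • e) - f X| ≤ L * |s|) : |⟪p, e⟫| ≤ L := by
  have key : ∀ e : V, (∀ s : ℝ, |f (X + s • e) - f X| ≤ L * |s|) → ⟪p, e⟫ ≥ - L := by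
    intro e hL
    by_contra hcon
    push Not at hcon
    obtain ⟨r, hr, hr'⟩ := Metric.eventually_nhds_iff.1 (h.line e 1 one_pos)
    set K := |⟪B e, e⟫| + ‖e‖^2 + 1
    have hK : 0 < K := by positivity
    set a := -L - ⟪p, e⟫ with ha
    have ha0 : 0 < a := by linarith
    set m := min (r/2) (a / (2 * K)) with hm
    have hm0 : 0 < m := by positivity
    have h1 : m < r := lt_of_le_of_lt (min_le_left _ _) (by linarith)
    have h2 : m * (2 * K) ≤ a := by
      have : m ≤ (a / (2 * K)) := min_le_right _ _
      rwa [le_div_iff₀ (by positivity)] at this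
    have h3 := @hr' m (by simp [abs_of_pos hm0, h1])
    have h4 := (abs_le.1 (hL m)).1
    rw [abs_of_pos hm0] at h4
    have h5 : ⟪B e, e⟫ ≤ |⟪B e, e⟫| := le_abs_self _
    have h6 : m^2/2 * ⟪B e, e⟫ + 1 * ‖e‖^2 * m^2 ≤ K * m^2 := by
      have : 0 ≤ m^2 := by positivity
      nlinarith [abs_nonneg ⟪B e, e⟫]
    nlinarith
  rw [abs_le]
  constructor
  · exact key e hL
  · have := key (-e) (fun s => by
      have := hL (-s); simpa using this)
    rw [inner_neg_right] at this
    linarith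

lemma expand2 {h : V → ℝ} {g : V → V} {X : V} {B : V →L[ℝ] V}
    (hh : ∀ᶠ Y in 𝓝 X, HasFDerivAt h (innerSL ℝ (g Y)) Y) (hg : HasFDerivAt g B X) :
    ∀ α > (0:ℝ), ∀ᶠ Y in 𝓝 X,
      |h Y - h X - ⟪g X, Y - X⟫ - (1/2) * ⟪B (Y - X), Y - X⟫| ≤ α * ‖Y - X‖^2 := by
  intro α hα
  have h1 := hg.isLittleO.def hα
  obtain ⟨r, hr, hr'⟩ := Metric.eventually_nhds_iff_ball.1 (hh.and h1)
  filter_upwards [Metric.ball_mem_nhds X hr] with Y hY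
  set d := Y - X with hd
  have hdr : ‖d‖ < r := by simpa [dist_eq_norm] using hY
  have hin : ∀ s ∈ Set.Icc (0:ℝ) 1, X + s • d ∈ Metric.ball X r := by
    intro s hs
    simp only [Metric.mem_ball, dist_eq_norm, add_sub_cancel_left, norm_smul, Real.norm_eq_abs,
      abs_of_nonneg hs.1]
    nlinarith [norm_nonneg d, hs.1, hs.2]
  have hder : ∀ s ∈ Set.Icc (0:ℝ) 1, HasDerivWithinAt
      (fun s : ℝ => h (X + s • d) - s * ⟪g X, d⟫ - s^2 / 2 * ⟪B d, d⟫)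
      (⟪g (X + s • d), d⟫ - ⟪g X, d⟫ - s * ⟪B d, d⟫) (Set.Icc 0 1) s := by
    intro s hs
    have hl : HasDerivAt (fun s : ℝ => X + s • d) d s := by
      simpa using ((hasDerivAt_id s).smul_const d).const_add X
    have h2 := (hr' _ (hin s hs)).1.comp_hasDerivAt s hl
    have h3 := (hasDerivAt_id s).mul_const ⟪g X, d⟫
    have h4 := (((hasDerivAt_id s).pow 2).div_const 2).mul_const ⟪B d, d⟫
    have h5 := ((h2.sub h3).sub h4).hasDerivWithinAt (s := Set.Icc 0 1)
    refine h5.congr_deriv ?_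
    simp
  have hb : ∀ s ∈ Set.Ico (0:ℝ) 1, ‖⟪g (X + s • d), d⟫ - ⟪g X, d⟫ - s * ⟪B d, d⟫‖ ≤ α * ‖d‖^2 := by
    intro s hs
    have h2 := (hr' _ (hin s ⟨hs.1, hs.2.le⟩)).2
    simp only [add_sub_cancel_left, map_smul] at h2
    have e : ⟪g (X + s • d), d⟫ - ⟪g X, d⟫ - s * ⟪B d, d⟫ = ⟪g (X + s • d) - g X - s • B d, d⟫ := by
      simp [inner_sub_left, inner_smul_left]
    rw [e]
    refine (norm_inner_le_norm _ _).trans ?_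
    rw [norm_smul, Real.norm_eq_abs, abs_of_nonneg hs.1] at h2
    have h6 := mul_nonneg hα.le (sq_nonneg ‖d‖)
    have h7 := mul_le_mul_of_nonneg_right h2 (norm_nonneg d)
    nlinarith [hs.2]
  have := norm_image_sub_le_of_norm_deriv_le_segment_01' hder hb
  simp only [one_smul, zero_smul, add_zero, one_mul, Real.norm_eq_abs] at this
  have e2 : X + d = Y := by simp [hd]
  rw [e2] at this
  convert this using 2
  ring

lemma para_lip {h : V → ℝ} {g : V → V} {k : ℝ} (hk : 0 ≤ k)
    (hh : ∀ X Y, |h Y - h X - ⟪g X, Y - X⟫| ≤ k * ‖Y - X‖^2) : 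
    LipschitzWith (6 * k).toNNReal g := by
  refine LipschitzWith.of_dist_le_mul fun X Y => ?_
  rw [Real.coe_toNNReal _ (by positivity), dist_eq_norm, dist_eq_norm]
  set d := Y - X with hd
  have hXd : ‖X - Y‖ = ‖d‖ := by rw [hd, norm_sub_rev]
  rw [hXd]
  by_cases hg0 : ‖g X - g Y‖ = 0
  · rw [hg0]; positivity
  have hgp : 0 < ‖g X - g Y‖ := lt_of_le_of_ne (norm_nonneg _) (Ne.symm hg0)
  by_cases hd0 : ‖d‖ = 0
  · exfalso
    have : X = Y := by
      have := norm_eq_zero.1 hd0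
      rw [hd, sub_eq_zero] at this; exact this.symm
    simp [this] at hg0
  have hdp : 0 < ‖d‖ := lt_of_le_of_ne (norm_nonneg _) (Ne.symm hd0)
  set e := (‖d‖ / ‖g X - g Y‖) • (g X - g Y) with he
  have hen : ‖e‖ = ‖d‖ := by
    rw [he, norm_smul, Real.norm_eq_abs, abs_of_pos (by positivity)]; field_simp
  have h1 := (abs_le.1 (hh Y (Y + e))).2
  have h2 := (abs_le.1 (hh X (Y + e))).1
  have h3 := (abs_le.1 (hh X Y)).2
  have e1 : Y + e - Y = e := by abel
  have e2 : Y + e - X = d + e := by rw [hd]; abel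
  rw [e1] at h1
  rw [e2, inner_add_right] at h2
  have h4 : ⟪g X - g Y, e⟫ = ‖d‖ * ‖g X - g Y‖ := by
    rw [he, inner_smul_right, real_inner_self_eq_norm_sq]; field_simp
  rw [inner_sub_left] at h4
  have h5 : ‖d + e‖ ≤ 2 * ‖d‖ := by
    have := norm_add_le d e; rw [hen] at this; linarith
  have h6 : ‖d + e‖^2 ≤ 4 * ‖d‖^2 := by nlinarith [norm_nonneg (d + e)]
  rw [hen] at h1
  rw [← hd] at h3
  have h7 : ‖d‖ * ‖g X - g Y‖ ≤ ‖d‖ * (6 * k * ‖d‖) := by nlinarith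
  exact le_of_mul_le_mul_left h7 hdp

lemma para_hasFDerivAt {h : V → ℝ} {g : V → V} {k : ℝ} 
    (hh : ∀ X Y, |h Y - h X - ⟪g X, Y - X⟫| ≤ k * ‖Y - X‖^2) (X : V) :
    HasFDerivAt h (innerSL ℝ (g X)) X := by
  rw [hasFDerivAt_iff_isLittleO]
  refine Asymptotics.IsBigO.trans_isLittleO (g := fun Y => ‖Y - X‖^2) ?_ ?_
  · refine Asymptotics.IsBigO.of_bound k (Eventually.of_forall fun Y => ?_)
    simpa using hh X Y
  · have : (fun Y => Y - X) =o[𝓝 X] (fun _ => (1:ℝ)) := by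
      rw [Asymptotics.isLittleO_one_iff]
      have : Continuous (fun Y : V => Y - X) := by fun_prop
      simpa using this.tendsto X
    have h2 := (Asymptotics.isBigO_refl (fun Y => Y - X) (𝓝 X)).norm_left.norm_right.mul_isLittleO this.norm_left
    simpa [sq] using h2.norm_right

end jets

section reg
variable {V : Type*} [NormedAddCommGroup V] [InnerProductSpace ℝ V]

lemma attain [FiniteDimensional ℝ V] {F : V → ℝ} (hF : Continuous F) {M a : ℝ} (ha : 0 < a) (y : V)
    (hb : ∀ z, F z ≤ M - a * ‖z - y‖^2) : ∃ z, ∀ w, F w ≤ F z := by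
  refine hF.exists_forall_ge ?_
  refine tendsto_atBot_mono hb ?_
  have h1 : Tendsto (fun z : V => ‖z - y‖) (cocompact V) atTop := by
    have := tendsto_dist_right_cocompact_atTop (α := V) y
    simpa [dist_eq_norm] using this
  have h2 : Tendsto (fun z : V => a * ‖z - y‖^2) (cocompact V) atTop :=
    Tendsto.const_mul_atTop ha ((tendsto_pow_atTop two_ne_zero).comp h1)
  simpa [sub_eq_add_neg] using tendsto_atBot_add_const_left _ M (tendsto_neg_atTop_atBot.comp h2)

/-- weighted inequality -/
lemma wt_ineq {ε δ : ℝ} (hε : 0 < ε) (hδ : 0 < δ) (a b : V) :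
    ‖a + b‖^2 / (ε + δ) ≤ ‖a‖^2 / ε + ‖b‖^2 / δ := by
  rw [div_add_div _ _ hε.ne' hδ.ne', div_le_div_iff₀ (by positivity) (by positivity)]
  have h : 0 ≤ ‖δ • a - ε • b‖^2 := by positivity
  rw [norm_sub_sq_real, norm_smul, norm_smul, inner_smul_left, inner_smul_right,
    Real.norm_of_nonneg hε.le, Real.norm_of_nonneg hδ.le] at h
  rw [norm_add_sq_real]
  simp at h
  nlinarith

lemma reg [FiniteDimensional ℝ V] {f : V → ℝ} (hf : Continuous f) {M : ℝ} (hM : ∀ x, |f x| ≤ M) {ε δ : ℝ} (hε : 0 < ε)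
    (hδ : 0 < δ) : ∃ (h : V → ℝ) (g : V → V) (k : ℝ), 0 ≤ k ∧
    (∀ X, h X ≤ M) ∧
    (∀ X, ∃ Y, h X ≤ f Y ∧ ‖Y - X‖^2 ≤ 4 * M * (ε + δ)) ∧
    (∀ X Y, |h Y - h X - ⟪g X, Y - X⟫| ≤ k * ‖Y - X‖^2) ∧
    (∀ X Y, f Y - ‖Y - X‖^2 / (2 * ε) ≤ h X) ∧
    (∀ X k', k' < 1 / δ → (∀ Y, h Y ≤ h X + ⟪g X, Y - X⟫ + k' / 2 * ‖Y - X‖^2) →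
      ∃ x0, h X = f x0 - ‖x0 - X‖^2 / (2 * ε) ∧ x0 - X = ε • g X) := by
  have hM0 : 0 ≤ M := (abs_nonneg _).trans (hM 0)
  have hs : 0 < ε + δ := by positivity
  have ex1 : ∀ y, ∃ z, ∀ w, f w - ‖w - y‖^2 / (2 * (ε + δ)) ≤ f z - ‖z - y‖^2 / (2 * (ε + δ)) := by
    intro y
    refine attain (M := M) (a := 1 / (2 * (ε + δ))) (by fun_prop) (by positivity) y fun z => ?_
    have := (abs_le.1 (hM z)).2
    have e : ‖z - y‖ ^ 2 / (2 * (ε + δ)) = 1 / (2 * (ε + δ)) * ‖z - y‖ ^ 2 := by ring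
    rw [e]; linarith
  choose zo hzo using ex1
  set U : V → ℝ := fun y => f (zo y) - ‖zo y - y‖^2 / (2 * (ε + δ)) with hU
  have hzo' : ∀ y w, f w - ‖w - y‖^2 / (2 * (ε + δ)) ≤ U y := fun y w => hzo y w
  have hUf : ∀ y, f y ≤ U y := fun y => by simpa using hzo' y y
  have hUM : ∀ y, U y ≤ M := fun y => by
    have := (abs_le.1 (hM (zo y))).2
    have h2 : 0 ≤ ‖zo y - y‖^2 / (2 * (ε + δ)) := by positivity
    simp only [hU]; linarith
  have hUm : ∀ y, -M ≤ U y := fun y => (abs_le.1 (hM y)).1.trans (hUf y)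
  have hzd : ∀ y, ‖zo y - y‖^2 ≤ 4 * M * (ε + δ) := fun y => by
    have h1 := (abs_le.1 (hM (zo y))).2
    have h3 := hUm y
    simp only [hU] at h3
    have h4 : ‖zo y - y‖^2 / (2 * (ε + δ)) ≤ 2 * M := by linarith
    rw [div_le_iff₀ (by positivity)] at h4
    linarith
  set D := Real.sqrt (4 * M * (ε + δ)) with hD
  have hzD : ∀ y, ‖zo y - y‖ ≤ D := fun y => Real.le_sqrt_of_sq_le (hzd y)
  have hUdiff : ∀ y y', U y - U y' ≤ (2 * D * ‖y - y'‖ + ‖y - y'‖^2) / (2 * (ε + δ)) := by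
    intro y y'
    have h1 := hzo' y' (zo y)
    have e : zo y - y' = (zo y - y) + (y - y') := by abel
    have h2 : ‖zo y - y'‖^2 ≤ ‖zo y - y‖^2 + (2 * D * ‖y - y'‖ + ‖y - y'‖^2) := by
      rw [e, norm_add_sq_real]
      have := real_inner_le_norm (zo y - y) (y - y')
      nlinarith [hzD y, norm_nonneg (y - y')]
    have h3 : ‖zo y - y'‖^2 / (2 * (ε + δ)) ≤ ‖zo y - y‖^2 / (2 * (ε + δ))
        + (2 * D * ‖y - y'‖ + ‖y - y'‖^2) / (2 * (ε + δ)) := by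
      rw [← add_div]; gcongr
    simp only [hU] at h1 ⊢
    linarith
  have hUc : Continuous U := by
    rw [continuous_iff_continuousAt]
    intro y
    rw [ContinuousAt, tendsto_iff_dist_tendsto_zero]
    have hc : Continuous (fun y' => (2 * D * ‖y - y'‖ + ‖y - y'‖^2) / (2 * (ε + δ))) := by fun_prop
    have ht := hc.tendsto y
    simp only [sub_self, norm_zero, mul_zero, ne_eq, OfNat.ofNat_ne_zero, not_false_eq_true,
      zero_pow, add_zero, zero_div] at ht
    refine squeeze_zero (fun _ => dist_nonneg) (fun y' => ?_) ht
    rw [Real.dist_eq, abs_le]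
    have h1 := hUdiff y y'
    have h2 := hUdiff y' y
    rw [norm_sub_rev y' y] at h2
    constructor <;> linarith
  have ex2 : ∀ x, ∃ y, ∀ w, U y + ‖x - y‖^2 / (2 * δ) ≤ U w + ‖x - w‖^2 / (2 * δ) := by
    intro x
    obtain ⟨y, hy⟩ := attain (F := fun y => -(U y + ‖x - y‖^2 / (2 * δ))) (by fun_prop) (M := M)
      (a := 1 / (2 * δ)) (by positivity) x (fun z => by
        have := hUm z
        have e : 1 / (2 * δ) * ‖z - x‖ ^ 2 = ‖x - z‖^2 / (2 * δ) := by rw [norm_sub_rev]; ring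
        rw [e]; linarith)
    exact ⟨y, fun w => by linarith [hy w]⟩
  choose yo hyo using ex2
  set h : V → ℝ := fun x => U (yo x) + ‖x - yo x‖^2 / (2 * δ) with hh
  have hyo' : ∀ x w, h x ≤ U w + ‖x - w‖^2 / (2 * δ) := fun x w => hyo x w
  have hhU : ∀ x, h x ≤ U x := fun x => by simpa using hyo' x x
  set g : V → V := fun x => (1 / δ) • (x - yo x) with hg
  have hlow : ∀ X Y, f Y - ‖Y - X‖^2 / (2 * ε) ≤ h X := by
    intro X Y
    have h1 := hzo' (yo X) Y
    have h2 := wt_ineq hε hδ (Y - X) (X - yo X)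
    have e : Y - X + (X - yo X) = Y - yo X := by abel
    rw [e] at h2
    have e1 : ‖Y - yo X‖ ^ 2 / (2 * (ε + δ)) = ‖Y - yo X‖ ^ 2 / (ε + δ) / 2 := by field_simp
    have e2 : ‖Y - X‖ ^ 2 / (2 * ε) = ‖Y - X‖ ^ 2 / ε / 2 := by field_simp
    have e3 : ‖X - yo X‖ ^ 2 / (2 * δ) = ‖X - yo X‖ ^ 2 / δ / 2 := by field_simp
    simp only [hh]
    rw [e1] at h1
    rw [e2, e3]; linarith
  have hup0 : ∀ X Y, U (yo X) + ‖Y - yo X‖^2 / (2 * δ) = h X + ⟪g X, Y - X⟫ + ‖Y - X‖^2 / (2 * δ) := by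
    intro X Y
    have e : Y - yo X = (Y - X) + (X - yo X) := by abel
    simp only [hh, hg]
    rw [e, norm_add_sq_real, inner_smul_left, real_inner_comm (X - yo X)]
    simp
    field_simp
    ring
  have hup : ∀ X Y, h Y ≤ h X + ⟪g X, Y - X⟫ + ‖Y - X‖^2 / (2 * δ) := fun X Y => by
    rw [← hup0]; exact hyo' Y (yo X)
  have par : ∀ a b : V, ‖(1/2:ℝ) • (a + b)‖^2 = (1/2) * ‖a‖^2 + (1/2) * ‖b‖^2 - (1/4) * ‖a - b‖^2 := by
    intro a b
    rw [norm_smul, mul_pow, norm_add_sq_real, norm_sub_sq_real]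
    norm_num
    ring
  have hmid : ∀ a b, h ((1/2:ℝ) • (a + b)) ≤ (1/2) * h a + (1/2) * h b + ‖a - b‖^2 / (8 * ε) := by
    intro a b
    set y := (1/2:ℝ) • (yo a + yo b) with hy
    have h1 := hyo' ((1/2:ℝ) • (a + b)) y
    have h2 := hzo' (yo a) (zo y)
    have h3 := hzo' (yo b) (zo y)
    have e1 : zo y - y = (1/2:ℝ) • ((zo y - yo a) + (zo y - yo b)) := by
      rw [hy]; module
    have e2 : (1/2:ℝ) • (a + b) - y = (1/2:ℝ) • ((a - yo a) + (b - yo b)) := by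
      rw [hy]; module
    have h4 : U y = f (zo y) - ‖zo y - y‖^2 / (2 * (ε + δ)) := rfl
    rw [e1, par] at h4
    rw [e2, par] at h1
    have e3 : zo y - yo a - (zo y - yo b) = yo b - yo a := by abel
    rw [e3] at h4
    have h5 := wt_ineq hε hδ (b - a) (a - yo a - (b - yo b))
    have e4 : b - a + (a - yo a - (b - yo b)) = yo b - yo a := by abel
    rw [e4, norm_sub_rev b a] at h5
    simp only [hh] at h1 ⊢
    have x1 : ((1/2) * ‖zo y - yo a‖^2 + (1/2) * ‖zo y - yo b‖^2 - (1/4) * ‖yo b - yo a‖^2) / (2 * (ε + δ))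
       = (1/2) * (‖zo y - yo a‖^2 / (2 * (ε + δ))) + (1/2) * (‖zo y - yo b‖^2 / (2 * (ε + δ)))
         - (1/8) * (‖yo b - yo a‖^2 / (ε + δ)) := by field_simp; ring
    have x2 : ((1/2) * ‖a - yo a‖^2 + (1/2) * ‖b - yo b‖^2 - (1/4) * ‖a - yo a - (b - yo b)‖^2) / (2 * δ)
       = (1/2) * (‖a - yo a‖^2 / (2 * δ)) + (1/2) * (‖b - yo b‖^2 / (2 * δ))
         - (1/8) * (‖a - yo a - (b - yo b)‖^2 / δ) := by field_simp; ring
    have x3 : ‖a - b‖^2 / (8 * ε) = (1/8) * (‖a - b‖^2 / ε) := by field_simp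
    rw [x1] at h4
    rw [x2] at h1
    rw [x3]
    linarith
  refine ⟨h, g, 1 / (2 * δ) + 1 / ε, by positivity, fun X => (hhU X).trans (hUM X),
    fun X => ⟨zo X, ?_, hzd X⟩, fun X Y => ?_, hlow, fun X k' hk' hX => ?_⟩
  · have h2 : 0 ≤ ‖zo X - X‖^2 / (2 * (ε + δ)) := by positivity
    have := hhU X
    simp only [hU] at this; linarith
  · rw [abs_le]
    have h1 := hup X Y
    have h2 := hup X (X - (Y - X))
    have h3 := hmid Y (X - (Y - X))
    have e1 : (1/2:ℝ) • (Y + (X - (Y - X))) = X := by module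
    have e2 : Y - (X - (Y - X)) = (2:ℝ) • (Y - X) := by module
    have e3 : X - (Y - X) - X = -(Y - X) := by abel
    rw [e1, e2, norm_smul] at h3
    rw [e3, inner_neg_right, norm_neg] at h2
    have x1 : (‖(2:ℝ)‖ * ‖Y - X‖)^2 / (8 * ε) = (1/2) * (1 / ε * ‖Y - X‖^2) := by
      norm_num; field_simp; norm_num; ring
    have x2 : ‖Y - X‖^2 / (2 * δ) = 1 / (2 * δ) * ‖Y - X‖^2 := by ring
    rw [x1] at h3
    rw [x2] at h1 h2
    have : 0 ≤ 1 / ε * ‖Y - X‖^2 := by positivity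
    rw [add_mul]
    constructor <;> linarith
  · set y := yo X with hy
    set x0 := zo y with hx0
    set z := y + (δ / (ε + δ)) • (x0 - y) with hz
    have e1 : x0 - z = (ε / (ε + δ)) • (x0 - y) := by
      have : ε / (ε + δ) = 1 - δ / (ε + δ) := by field_simp; ring
      rw [hz, this]; module
    have e2 : z - y = (δ / (ε + δ)) • (x0 - y) := by rw [hz]; abel
    have h1 := hlow z x0
    have h2 := hup0 X z
    have h3 := hX z
    have h4 : U y = f x0 - ‖x0 - y‖^2 / (2 * (ε + δ)) := rfl
    have h5 : ‖x0 - y‖^2 / (2 * (ε + δ)) = ‖x0 - z‖^2 / (2 * ε) + ‖z - y‖^2 / (2 * δ) := by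
      rw [e1, e2, norm_smul, norm_smul, Real.norm_of_nonneg (by positivity), Real.norm_of_nonneg (by positivity)]
      field_simp
    have h6 : ‖z - X‖^2 / (2 * δ) = (1 / δ) / 2 * ‖z - X‖^2 := by field_simp
    have h7 : ((1 / δ) - k') / 2 * ‖z - X‖^2 ≤ 0 := by
      have : U (yo X) = U y := rfl
      rw [← hy] at h2
      linarith
    have h8 : ‖z - X‖^2 = 0 := by
      by_contra hne
      have : 0 < ‖z - X‖^2 := lt_of_le_of_ne (by positivity) (Ne.symm hne)
      nlinarith
    have hzX : z = X := by
      rw [sq_eq_zero_iff, norm_eq_zero, sub_eq_zero] at h8; exact h8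
    refine ⟨x0, ?_, ?_⟩
    · have h9 : h X = U y + ‖X - y‖^2 / (2 * δ) := rfl
      rw [hzX] at h5
      rw [h9, h4]; linarith
    · simp only [hg]
      rw [← hy, ← hzX, e1, e2, smul_smul, smul_smul]
      congr 1
      field_simp
end reg

section jensen
open MeasureTheory
variable {W : Type*} [NormedAddCommGroup W] [NormedSpace ℝ W] [FiniteDimensional ℝ W]

lemma jensen {G T : W → W} {a b : NNReal} (hG : LipschitzWith a G) (hT : LipschitzWith b T) {r : ℝ}
    (hr : 0 < r) : ∃ P, ‖P‖ < r ∧ ∀ Z, T Z = P → DifferentiableAt ℝ G Z := by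
  borelize W
  set μ : Measure W := μH[(Module.finrank ℝ W : ℝ)]
  have h1 : μ {Z | ¬ DifferentiableAt ℝ G Z} = 0 := hG.ae_differentiableAt (μ := μ)
  have h2 : μ (T '' {Z | ¬ DifferentiableAt ℝ G Z}) = 0 := by
    have := hT.hausdorffMeasure_image_le (d := (Module.finrank ℝ W : ℝ)) (by positivity) {Z | ¬ DifferentiableAt ℝ G Z}
    change μ _ ≤ _ * μ _ at this
    rw [h1, mul_zero] at this
    exact le_antisymm this (zero_le)
  have h3 : 0 < μ (Metric.ball (0:W) r) := Metric.measure_ball_pos μ 0 hr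
  by_contra hcon
  push Not at hcon
  have : Metric.ball (0:W) r ⊆ T '' {Z | ¬ DifferentiableAt ℝ G Z} := by
    intro P hP
    obtain ⟨Z, hZ, hZ'⟩ := hcon P (by simpa using hP)
    exact ⟨Z, hZ', hZ⟩
  exact absurd (measure_mono_null this h2) h3.ne'
end jensen

section sums
variable {V : Type*} [NormedAddCommGroup V] [InnerProductSpace ℝ V]

lemma quad_exp (a b d e : V) (s : ℝ) : ‖(a + s • d) - (b + s • e)‖^2
    = ‖a - b‖^2 + 2 * s * ⟪a - b, d - e⟫ + s^2 * ‖d - e‖^2 := by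
  have : (a + s • d) - (b + s • e) = (a - b) + s • (d - e) := by module
  rw [this, norm_add_sq_real, inner_smul_right, norm_smul, mul_pow, Real.norm_eq_abs, sq_abs]
  ring

lemma S_exp (S : V →L[ℝ] V) (hS : ∀ a b, ⟪S a, b⟫ = ⟪S b, a⟫) (a X0 d : V) (s : ℝ) :
    ⟪S (a + s • d - X0), a + s • d - X0⟫ = ⟪S (a - X0), a - X0⟫ + 2 * s * ⟪S (a - X0), d⟫
      + s^2 * ⟪S d, d⟫ := by
  have : a + s • d - X0 = (a - X0) + s • d := by module
  rw [this, map_add, map_smul, inner_add_left, inner_add_right, inner_add_right, inner_smul_left,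
    inner_smul_right, inner_smul_left, inner_smul_right, hS d (a - X0)]
  simp; ring

lemma inner_S_le (S : V →L[ℝ] V) (d : V) : |⟪S d, d⟫| ≤ ‖S‖ * ‖d‖^2 := by
  have h1 := abs_real_inner_le_norm (S d) d
  have h2 := S.le_opNorm d
  nlinarith [norm_nonneg d]

lemma touch_global {h : V → ℝ} {ξ g : V} {k0 G0 M r : ℝ} (hr : 0 < r) (hM : ∀ Y, h Y ≤ M) (hm : -M ≤ h ξ)
    (hg : ‖g‖ ≤ G0) (hk0 : 0 ≤ k0) (loc : ∀ Y, ‖Y - ξ‖ ≤ r/2 → h Y ≤ h ξ + ⟪g, Y - ξ⟫ + k0/2 * ‖Y - ξ‖^2) (Y : V) :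
    h Y ≤ h ξ + ⟪g, Y - ξ⟫ + (k0 + 16 * M / r^2 + 4 * G0 / r)/2 * ‖Y - ξ‖^2 := by
  have hM0 : 0 ≤ M := by linarith [hM ξ]
  have hG0 : 0 ≤ G0 := (norm_nonneg _).trans hg
  by_cases hY : ‖Y - ξ‖ ≤ r/2
  · have h1 : k0 / 2 ≤ (k0 + 16 * M / r^2 + 4 * G0 / r)/2 := by
      have : 0 ≤ 16 * M / r^2 := by positivity
      have : 0 ≤ 4 * G0 / r := by positivity
      linarith
    have := mul_le_mul_of_nonneg_right h1 (sq_nonneg ‖Y - ξ‖)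
    linarith [loc Y hY]
  · push Not at hY
    have h1 := hM Y
    have h2 := (abs_le.1 (abs_real_inner_le_norm g (Y - ξ))).1
    set ρ := ‖Y - ξ‖
    have h3 : ‖g‖ * ρ ≤ G0 * ρ := by gcongr
    have h4 : (k0 + 16 * M / r^2 + 4 * G0 / r)/2 * ρ^2 = k0/2 * ρ^2 + 8 * M * (ρ / r)^2 + 2 * G0 * ρ * (ρ / r) := by
      field_simp; ring
    have h5 : 1/2 ≤ ρ / r := by rw [div_le_div_iff₀ (by norm_num) hr]; linarith
    have h6 : 8 * M * (1/2)^2 ≤ 8 * M * (ρ / r)^2 := by gcongr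
    have h7 : 2 * G0 * ρ * (1/2) ≤ 2 * G0 * ρ * (ρ / r) := by gcongr
    have h8 : 0 ≤ k0/2 * ρ^2 := by positivity
    rw [h4]; linarith

variable [FiniteDimensional ℝ V]

lemma unifc {F : V → ℝ} (hF : Continuous F) (X0 : V) {ω : ℝ} (hω : 0 < ω) : ∃ η > 0, ∀ a b,
    ‖a - X0‖ ≤ 2 → ‖b - X0‖ ≤ 2 → ‖a - b‖ < η → |F a - F b| < ω := by
  have hu := (isCompact_closedBall X0 2).uniformContinuousOn_of_continuous hF.continuousOn
  obtain ⟨η, h1, h2⟩ := Metric.uniformContinuousOn_iff.1 hu ω hω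
  refine ⟨η, h1, fun a b ha hb hab => ?_⟩
  have := h2 a (by simpa [dist_eq_norm] using ha) b (by simpa [dist_eq_norm] using hb) (by simpa [dist_eq_norm] using hab)
  simpa [Real.dist_eq] using this

set_option maxHeartbeats 1600000 in
lemma sums3_core {F1 F2 F3 : V → ℝ} (c1 : Continuous F1) (c2 : Continuous F2) (c3 : Continuous F3)
    {M : ℝ} (b1 : ∀ x, |F1 x| ≤ M) (b2 : ∀ x, |F2 x| ≤ M) (b3 : ∀ x, |F3 x| ≤ M)
    {X0 p : V} {S : V →L[ℝ] V} (hS : ∀ a b, ⟪S a, b⟫ = ⟪S b, a⟫) {r α ζ : ℝ} (hr : 0 < r) (hr1 : r ≤ 1)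
    (hα : 0 < α) (hζ : 0 < ζ)
    (hW : ∀ Y, ‖Y - X0‖ ≤ r → F1 Y + F2 Y + F3 Y ≤ F1 X0 + F2 X0 + F3 X0 + ⟪p, Y - X0⟫ 
      + (1/2) * ⟪S (Y - X0), Y - X0⟫ - α * ‖Y - X0‖^2) :
    ∃ β > 0, β < ζ ∧ ∃ (ξ1 ξ2 ξ3 x1 x2 x3 p1 p2 p3 : V) (B1 B2 B3 : V →L[ℝ] V),
      UJet F1 x1 p1 B1 ∧ UJet F2 x2 p2 B2 ∧ UJet F3 x3 p3 B3 ∧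
      x1 - ξ1 = β • p1 ∧ x2 - ξ2 = β • p2 ∧ x3 - ξ3 = β • p3 ∧
      (‖ξ1 - X0‖ < r ∧ ‖ξ2 - X0‖ < r ∧ ‖ξ3 - X0‖ < r) ∧ 
      (‖x1 - X0‖ < r ∧ ‖x2 - X0‖ < r ∧ ‖x3 - X0‖ < r) ∧
      ‖p2 - β⁻¹ • (ξ2 - ξ1)‖ < ζ ∧ ‖p3 - β⁻¹ • (ξ3 - ξ1)‖ < ζ ∧
      ‖p1 + p2 + p3 - p - S (ξ1 - X0)‖ < ζ ∧
      ∀ d1 d2 d3, ⟪B1 d1, d1⟫ + ⟪B2 d2, d2⟫ + ⟪B3 d3, d3⟫ ≤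
        β⁻¹ * (‖d1 - d2‖^2 + ‖d1 - d3‖^2) + ⟪S d1, d1⟫ := by
  have hM0 : 0 ≤ M := (abs_nonneg _).trans (b1 X0)
  have hω0 : 0 < α * r^2 / 64 := by positivity
  obtain ⟨η1, hη1, u1⟩ := unifc c1 X0 hω0
  obtain ⟨η2, hη2, u2⟩ := unifc c2 X0 hω0
  obtain ⟨η3, hη3, u3⟩ := unifc c3 X0 hω0
  set Q0 := ‖p‖ + ‖S‖ with hQ0
  have hQ00 : 0 ≤ Q0 := by positivity
  set K := 6 * M + Q0 + 3 with hK
  have hK0 : 0 < K := by positivity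
  set w0 := min (min (min η1 η2) η3) r / 4 with hw0
  have hw00 : 0 < w0 := by positivity
  have hwr : w0 ≤ r / 4 := by rw [hw0]; gcongr; exact min_le_right _ _
  have hwη1 : w0 ≤ η1 / 4 := by
    rw [hw0]; gcongr; exact ((min_le_left _ _).trans (min_le_left _ _)).trans (min_le_left _ _)
  have hwη2 : w0 ≤ η2 / 4 := by
    rw [hw0]; gcongr; exact ((min_le_left _ _).trans (min_le_left _ _)).trans (min_le_right _ _)
  have hwη3 : w0 ≤ η3 / 4 := by
    rw [hw0]; gcongr; exact (min_le_left _ _).trans (min_le_right _ _)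
  set β := min (ζ / 2) (w0^2 / (2 * K)) with hβ
  have hβ0 : 0 < β := by positivity
  have hβζ : β < ζ := lt_of_le_of_lt (min_le_left _ _) (by linarith)
  have hβK : 2 * β * K ≤ w0^2 := by
    have : β ≤ w0^2 / (2 * K) := min_le_right _ _
    rw [le_div_iff₀ (by positivity)] at this; linarith
  set τ := min (min (ζ / 3) (α * r / 192)) 1 with hτ
  have hτ0 : 0 < τ := by positivity
  have hτζ : τ ≤ ζ / 3 := (min_le_left _ _).trans (min_le_left _ _)
  have hτα : τ ≤ α * r / 192 := (min_le_left _ _).trans (min_le_right _ _)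
  have hτ1 : τ ≤ 1 := min_le_right _ _
  set k0 := 2 / β + ‖S‖ with hk0
  have hk00 : 0 ≤ k0 := by positivity
  set G0 := 4 / β + ‖p‖ + ‖S‖ + 1 with hG0
  have hG00 : 0 ≤ G0 := by positivity
  set k' := k0 + 16 * M / r^2 + 4 * G0 / r with hk'
  have hk'0 : 0 < k' := by
    have : 0 < 4 * G0 / r := by positivity
    positivity
  set δ := min β (1 / (2 * k')) with hδ
  have hδ0 : 0 < δ := by positivity
  have hδβ : δ ≤ β := min_le_left _ _
  have hk'δ : k' < 1 / δ := by
    have : δ ≤ 1 / (2 * k') := min_le_right _ _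
    rw [lt_div_iff₀ hδ0]
    rw [le_div_iff₀ (by positivity)] at this
    linarith only [this]
  obtain ⟨h1, g1, k1, hk1, hM1, hY1, hp1, hl1, ht1⟩ := reg c1 b1 hβ0 hδ0
  obtain ⟨h2, g2, k2, hk2, hM2, hY2, hp2, hl2, ht2⟩ := reg c2 b2 hβ0 hδ0
  obtain ⟨h3, g3, k3, hk3, hM3, hY3, hp3, hl3, ht3⟩ := reg c3 b3 hβ0 hδ0
  have hc1 : Continuous h1 := continuous_iff_continuousAt.2 fun X => (para_hasFDerivAt hp1 X).continuousAt
  have hc2 : Continuous h2 := continuous_iff_continuousAt.2 fun X => (para_hasFDerivAt hp2 X).continuousAt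
  have hc3 : Continuous h3 := continuous_iff_continuousAt.2 fun X => (para_hasFDerivAt hp3 X).continuousAt
  have gl1 := para_lip hk1 hp1
  have gl2 := para_lip hk2 hp2
  have gl3 := para_lip hk3 hp3
  have fh1 : ∀ X, F1 X ≤ h1 X := fun X => by simpa using hl1 X X
  have fh2 : ∀ X, F2 X ≤ h2 X := fun X => by simpa using hl2 X X
  have fh3 : ∀ X, F3 X ≤ h3 X := fun X => by simpa using hl3 X X
  -- Jensen
  let G : V × V × V → V × V × V := fun Z => (g1 Z.1, g2 Z.2.1, g3 Z.2.2)
  have hGl : ∃ a, LipschitzWith a G := 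
    ⟨_, (gl1.comp LipschitzWith.prod_fst).prodMk ((gl2.comp (LipschitzWith.prod_fst.comp LipschitzWith.prod_snd)).prodMk
      (gl3.comp (LipschitzWith.prod_snd.comp LipschitzWith.prod_snd)))⟩
  obtain ⟨a, hGl⟩ := hGl
  let f1 : V × V × V →L[ℝ] V := ContinuousLinearMap.fst ℝ V (V × V)
  let f2 : V × V × V →L[ℝ] V := (ContinuousLinearMap.fst ℝ V V).comp (ContinuousLinearMap.snd ℝ V (V × V))
  let f3 : V × V × V →L[ℝ] V := (ContinuousLinearMap.snd ℝ V V).comp (ContinuousLinearMap.snd ℝ V (V × V))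
  let Λ : V × V × V →L[ℝ] V × V × V := 
    (-(β⁻¹ • (f1 - f2)) - (β⁻¹ • (f1 - f3)) - S.comp f1).prod ((β⁻¹ • (f1 - f2)).prod (β⁻¹ • (f1 - f3)))
  have hTl : ∃ b, LipschitzWith b (fun Z => G Z + (Λ Z + (S X0 - p, 0, 0))) :=
    ⟨_, hGl.add (Λ.lipschitz.add (LipschitzWith.const _))⟩
  obtain ⟨b, hTl⟩ := hTl
  obtain ⟨⟨P1, P2, P3⟩, hP, hPd⟩ := jensen hGl hTl hτ0
  have hP1 : ‖P1‖ < τ := (norm_fst_le (P1, P2, P3)).trans_lt hP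
  have hP2 : ‖P2‖ < τ := ((norm_fst_le (P2, P3)).trans (norm_snd_le (P1, P2, P3))).trans_lt hP
  have hP3 : ‖P3‖ < τ := ((norm_snd_le (P2, P3)).trans (norm_snd_le (P1, P2, P3))).trans_lt hP
  -- maximize
  let Φ : V × V × V → ℝ := fun Z => h1 Z.1 + h2 Z.2.1 + h3 Z.2.2 
    - (1/2) * β⁻¹ * (‖Z.1 - Z.2.1‖^2 + ‖Z.1 - Z.2.2‖^2) - (⟪p, Z.1 - X0⟫ + (1/2) * ⟪S (Z.1 - X0), Z.1 - X0⟫)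
    - (⟪P1, Z.1 - X0⟫ + ⟪P2, Z.2.1 - X0⟫ + ⟪P3, Z.2.2 - X0⟫)
  have hΦc : Continuous Φ := by fun_prop
  have hcomp : IsCompact (Metric.closedBall X0 r ×ˢ (Metric.closedBall X0 r ×ˢ Metric.closedBall X0 r)) :=
    (isCompact_closedBall X0 r).prod ((isCompact_closedBall X0 r).prod (isCompact_closedBall X0 r))
  have hX0r : X0 ∈ Metric.closedBall X0 r := Metric.mem_closedBall_self hr.le
  obtain ⟨⟨ξ1, ξ2, ξ3⟩, hmem, hmax⟩ := hcomp.exists_isMaxOn ⟨(X0, X0, X0), hX0r, hX0r, hX0r⟩ hΦc.continuousOn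
  simp only [Set.mem_prod, Metric.mem_closedBall, dist_eq_norm] at hmem
  obtain ⟨m1, m2, m3⟩ := hmem
  have hmax' : ∀ a b c, ‖a - X0‖ ≤ r → ‖b - X0‖ ≤ r → ‖c - X0‖ ≤ r → Φ (a, b, c) ≤ Φ (ξ1, ξ2, ξ3) := by
    intro a b c ha hb hc
    exact hmax (show (a, b, c) ∈ _ by
      simp only [Set.mem_prod, Metric.mem_closedBall, dist_eq_norm]; exact ⟨ha, hb, hc⟩)
  have hq0 : ∀ P : V, ‖P‖ < τ → ∀ ξ, ‖ξ - X0‖ ≤ r → |⟪P, ξ - X0⟫| ≤ τ * r := fun P hP ξ hξ =>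
    (abs_real_inner_le_norm _ _).trans (mul_le_mul hP.le hξ (norm_nonneg _) hτ0.le)
  have z1 := abs_le.1 (hq0 P1 hP1 ξ1 m1)
  have z2 := abs_le.1 (hq0 P2 hP2 ξ2 m2)
  have z3 := abs_le.1 (hq0 P3 hP3 ξ3 m3)
  have hτr : τ * r ≤ 1 := mul_le_one₀ hτ1 hr.le hr1
  have hcen := hmax' X0 X0 X0 (by simp [hr.le]) (by simp [hr.le]) (by simp [hr.le])
  simp only [Φ, sub_self, norm_zero, inner_zero_right, map_zero] at hcen
  have hqb : |⟪p, ξ1 - X0⟫ + (1/2) * ⟪S (ξ1 - X0), ξ1 - X0⟫| ≤ Q0 := by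
    have y1 := abs_real_inner_le_norm p (ξ1 - X0)
    have y2 := inner_S_le S (ξ1 - X0)
    have y3 : ‖ξ1 - X0‖ ≤ 1 := m1.trans hr1
    have y4 : ‖p‖ * ‖ξ1 - X0‖ ≤ ‖p‖ := mul_le_of_le_one_right (norm_nonneg _) y3
    have y5 : ‖S‖ * ‖ξ1 - X0‖^2 ≤ ‖S‖ := 
      mul_le_of_le_one_right (norm_nonneg _) (pow_le_one₀ (norm_nonneg _) y3)
    rw [abs_le] at *
    have := norm_nonneg S
    constructor <;> rw [hQ0] <;> linarith [y1.1, y1.2, y2.1, y2.2]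
  have hqb' := abs_le.1 hqb
  have hpen : ‖ξ1 - ξ2‖^2 + ‖ξ1 - ξ3‖^2 ≤ w0^2 := by
    have y1 := (abs_le.1 (b1 X0)).1
    have y2 := (abs_le.1 (b2 X0)).1
    have y3 := (abs_le.1 (b3 X0)).1
    have : (1/2) * β⁻¹ * (‖ξ1 - ξ2‖^2 + ‖ξ1 - ξ3‖^2) ≤ K := by
      linarith only [fh1 X0, fh2 X0, fh3 X0, hM1 ξ1, hM2 ξ2, hM3 ξ3, y1, y2, y3, hcen, hqb'.1, z1.1, z2.1, z3.1, hτr, hK]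
    have e : ‖ξ1 - ξ2‖^2 + ‖ξ1 - ξ3‖^2 = 2 * β * ((1/2) * β⁻¹ * (‖ξ1 - ξ2‖^2 + ‖ξ1 - ξ3‖^2)) := by
      field_simp
    rw [e]
    calc _ ≤ 2 * β * K := by gcongr
      _ ≤ _ := hβK
  have n12 : ‖ξ1 - ξ2‖ ≤ w0 := abs_le_of_sq_le_sq' (by linarith only [hpen, sq_nonneg ‖ξ1 - ξ3‖]) hw00.le |>.2
  have n13 : ‖ξ1 - ξ3‖ ≤ w0 := abs_le_of_sq_le_sq' (by linarith only [hpen, sq_nonneg ‖ξ1 - ξ2‖]) hw00.le |>.2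
  have hMδ : 4 * M * (β + δ) ≤ w0^2 := by
    have : M * δ ≤ M * β := by gcongr
    have h8 : 0 ≤ β * M := by positivity
    have h9 : 0 ≤ β * Q0 := by positivity
    have h10 : 2 * β * K = 12 * (β * M) + 2 * (β * Q0) + 6 * β := by rw [hK]; ring
    linarith only [this, h8, h9, h10, hβK, hβ0]
  obtain ⟨y1, hy1, hy1'⟩ := hY1 ξ1
  obtain ⟨y2, hy2, hy2'⟩ := hY2 ξ2
  obtain ⟨y3, hy3, hy3'⟩ := hY3 ξ3
  have ny1 : ‖y1 - ξ1‖ ≤ w0 := abs_le_of_sq_le_sq' (hy1'.trans hMδ) hw00.le |>.2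
  have ny2 : ‖y2 - ξ2‖ ≤ w0 := abs_le_of_sq_le_sq' (hy2'.trans hMδ) hw00.le |>.2
  have ny3 : ‖y3 - ξ3‖ ≤ w0 := abs_le_of_sq_le_sq' (hy3'.trans hMδ) hw00.le |>.2
  have tri : ∀ a b c : V, ‖a - c‖ ≤ ‖a - b‖ + ‖b - c‖ := fun a b c => norm_sub_le_norm_sub_add_norm_sub a b c
  have n21 : ‖ξ2 - ξ1‖ ≤ w0 := by rw [norm_sub_rev]; exact n12
  have n31 : ‖ξ3 - ξ1‖ ≤ w0 := by rw [norm_sub_rev]; exact n13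
  have uu1 := (abs_lt.1 (u1 y1 ξ1 (by linarith only [tri y1 ξ1 X0, ny1, m1, hwr, hr1]) (by linarith only [m1, hr1]) (by linarith only [ny1, hwη1, hη1]))).2
  have uu2 := (abs_lt.1 (u2 y2 ξ1 (by linarith only [tri y2 ξ2 X0, ny2, m2, hwr, hr1]) (by linarith only [m1, hr1]) (by linarith only [tri y2 ξ2 ξ1, ny2, n21, hwη2, hη2]))).2
  have uu3 := (abs_lt.1 (u3 y3 ξ1 (by linarith only [tri y3 ξ3 X0, ny3, m3, hwr, hr1]) (by linarith only [m1, hr1]) (by linarith only [tri y3 ξ3 ξ1, ny3, n31, hwη3, hη3]))).2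
  have hintr : ‖ξ1 - X0‖ ≤ r / 4 := by
    have hw := hW ξ1 m1
    have e : 0 ≤ (1/2) * β⁻¹ * (‖ξ1 - ξ2‖^2 + ‖ξ1 - ξ3‖^2) := by positivity
    have hτr2 : 3 * (τ * r) ≤ α * r^2 / 64 := by
      have := mul_le_mul_of_nonneg_right hτα hr.le
      linarith only [this]
    have e2 : α * (r/4)^2 = 4 * (α * r^2 / 64) := by ring
    have : α * ‖ξ1 - X0‖^2 ≤ α * (r/4)^2 := by
      rw [e2]
      linarith only [fh1 X0, fh2 X0, fh3 X0, hw, e, hτr2, hcen, hy1, hy2, hy3, uu1, uu2, uu3, z1.1, z2.1, z3.1]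
    have := le_of_mul_le_mul_left this hα
    exact abs_le_of_sq_le_sq' this (by positivity) |>.2
  have r2 : ‖ξ2 - X0‖ ≤ r / 2 := by linarith only [tri ξ2 ξ1 X0, n21, hintr, hwr]
  have r3 : ‖ξ3 - X0‖ ≤ r / 2 := by linarith only [tri ξ3 ξ1 X0, n31, hintr, hwr]
  -- star inequality
  let ℓ : V → V → V → ℝ := fun d1 d2 d3 => β⁻¹ * (⟪ξ1 - ξ2, d1 - d2⟫ + ⟪ξ1 - ξ3, d1 - d3⟫)
    + ⟪p + S (ξ1 - X0), d1⟫ + ⟪P1, d1⟫ + ⟪P2, d2⟫ + ⟪P3, d3⟫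
  let m : V → V → V → ℝ := fun d1 d2 d3 => β⁻¹ * (‖d1 - d2‖^2 + ‖d1 - d3‖^2) + ⟪S d1, d1⟫
  have star : ∀ (d1 d2 d3 : V) (s : ℝ), ‖ξ1 + s • d1 - X0‖ ≤ r → ‖ξ2 + s • d2 - X0‖ ≤ r → ‖ξ3 + s • d3 - X0‖ ≤ r →
      h1 (ξ1 + s • d1) - h1 ξ1 + (h2 (ξ2 + s • d2) - h2 ξ2) + (h3 (ξ3 + s • d3) - h3 ξ3)
        ≤ s * ℓ d1 d2 d3 + s^2/2 * m d1 d2 d3 := by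
    intro d1 d2 d3 s e1 e2 e3
    have := hmax' _ _ _ e1 e2 e3
    simp only [Φ, quad_exp, S_exp S hS] at this
    have ip : ∀ q x d : V, ⟪q, x + s • d - X0⟫ = ⟪q, x - X0⟫ + s * ⟪q, d⟫ := fun q x d => by
      rw [show x + s • d - X0 = (x - X0) + s • d by module, inner_add_right, inner_smul_right]
    rw [ip, ip, ip, ip] at this
    simp only [ℓ, m, inner_add_left]
    linarith only [this]
  have near : ∀ (ξ d : V), ‖ξ - X0‖ ≤ r / 2 → ∀ᶠ s in 𝓝 (0:ℝ), ‖ξ + s • d - X0‖ ≤ r := by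
    intro ξ d hξ
    have := (line_tendsto ξ d).eventually (Metric.ball_mem_nhds ξ (half_pos hr))
    filter_upwards [this] with s hs
    rw [dist_eq_norm] at hs
    linarith only [tri (ξ + s • d) ξ X0, hs, hξ]
  have r1 : ‖ξ1 - X0‖ ≤ r / 2 := by linarith only [hintr, hr]
  have pline : ∀ (h : V → ℝ) (g : V → V) (k : ℝ), (∀ X Y, |h Y - h X - ⟪g X, Y - X⟫| ≤ k * ‖Y - X‖^2) →
      ∀ ξ d (s : ℝ), s * ⟪g ξ, d⟫ - k * ‖d‖^2 * s^2 ≤ h (ξ + s • d) - h ξ := by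
    intro h g k hp ξ d s
    have := (abs_le.1 (hp ξ (ξ + s • d))).1
    rw [add_sub_cancel_left, inner_smul_right, norm_smul, mul_pow, Real.norm_eq_abs, sq_abs] at this
    linarith only [this]
  have first : ∀ d1 d2 d3, ⟪g1 ξ1, d1⟫ + ⟪g2 ξ2, d2⟫ + ⟪g3 ξ3, d3⟫ = ℓ d1 d2 d3 := by
    intro d1 d2 d3
    have := poly_first (a := ⟪g1 ξ1, d1⟫ + ⟪g2 ξ2, d2⟫ + ⟪g3 ξ3, d3⟫ - ℓ d1 d2 d3)
      (K := k1 * ‖d1‖^2 + k2 * ‖d2‖^2 + k3 * ‖d3‖^2 + m d1 d2 d3 / 2) (by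
        filter_upwards [near ξ1 d1 r1, near ξ2 d2 r2, near ξ3 d3 r3] with s e1 e2 e3
        have := star d1 d2 d3 s e1 e2 e3
        linarith only [this, pline h1 g1 k1 hp1 ξ1 d1 s, pline h2 g2 k2 hp2 ξ2 d2 s, pline h3 g3 k3 hp3 ξ3 d3 s])
    linarith only [this]
  have E1 : g1 ξ1 = β⁻¹ • (ξ1 - ξ2) + β⁻¹ • (ξ1 - ξ3) + (p + S (ξ1 - X0)) + P1 := by
    refine ext_inner_right ℝ fun d => ?_
    have := first d 0 0
    simp only [ℓ, inner_zero_right, sub_zero, add_zero] at this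
    rw [this]; simp only [inner_add_left, inner_smul_left]; simp; ring
  have E2 : g2 ξ2 = β⁻¹ • (ξ2 - ξ1) + P2 := by
    refine ext_inner_right ℝ fun d => ?_
    have := first 0 d 0
    simp only [ℓ, inner_zero_right, zero_sub, sub_zero, add_zero, zero_add, inner_neg_right] at this
    rw [this, ← neg_sub ξ1 ξ2]; simp only [inner_add_left, inner_smul_left, inner_neg_left]; simp
  have E3 : g3 ξ3 = β⁻¹ • (ξ3 - ξ1) + P3 := by
    refine ext_inner_right ℝ fun d => ?_
    have := first 0 0 d
    simp only [ℓ, inner_zero_right, zero_sub, sub_zero, add_zero, zero_add, inner_neg_right] at this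
    rw [this, ← neg_sub ξ1 ξ3]; simp only [inner_add_left, inner_smul_left, inner_neg_left]; simp
  have hdiff := hPd (ξ1, ξ2, ξ3) (by
    simp only [G, Λ, f1, f2, f3, E1, E2, E3]
    refine Prod.ext ?_ (Prod.ext ?_ ?_)
    · simp; module
    · simp; module
    · simp; module)
  have D1 : DifferentiableAt ℝ g1 ξ1 := by
    have e : g1 = fun Y => (G (Y, ξ2, ξ3)).1 := rfl
    rw [e]
    have : DifferentiableAt ℝ (fun Y => G (Y, ξ2, ξ3)) ξ1 := hdiff.comp ξ1 (f := fun Y : V => (Y, ξ2, ξ3)) (by fun_prop)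
    exact this.fst
  have D2 : DifferentiableAt ℝ g2 ξ2 := by
    have e : g2 = fun Y => (G (ξ1, Y, ξ3)).2.1 := rfl
    rw [e]
    have : DifferentiableAt ℝ (fun Y => G (ξ1, Y, ξ3)) ξ2 := hdiff.comp ξ2 (f := fun Y : V => (ξ1, Y, ξ3)) (by fun_prop)
    exact this.snd.fst
  have D3 : DifferentiableAt ℝ g3 ξ3 := by
    have e : g3 = fun Y => (G (ξ1, ξ2, Y)).2.2 := rfl
    rw [e]
    have : DifferentiableAt ℝ (fun Y => G (ξ1, ξ2, Y)) ξ3 := hdiff.comp ξ3 (f := fun Y : V => (ξ1, ξ2, Y)) (by fun_prop)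
    exact this.snd.snd
  have X1 := expand2 (Eventually.of_forall (para_hasFDerivAt hp1)) D1.hasFDerivAt
  have X2 := expand2 (Eventually.of_forall (para_hasFDerivAt hp2)) D2.hasFDerivAt
  have X3 := expand2 (Eventually.of_forall (para_hasFDerivAt hp3)) D3.hasFDerivAt
  have J : ∀ (h : V → ℝ) (ξ g : V) (B : V →L[ℝ] V), (∀ α > (0:ℝ), ∀ᶠ Y in 𝓝 ξ,
      |h Y - h ξ - ⟪g, Y - ξ⟫ - (1/2) * ⟪B (Y - ξ), Y - ξ⟫| ≤ α * ‖Y - ξ‖^2) → UJet h ξ g B := by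
    intro h ξ g B hX α hα
    filter_upwards [hX α hα] with Y hY
    linarith only [(abs_le.1 hY).2]
  have JL : ∀ (h : V → ℝ) (ξ g : V) (B : V →L[ℝ] V), (∀ α > (0:ℝ), ∀ᶠ Y in 𝓝 ξ,
      |h Y - h ξ - ⟪g, Y - ξ⟫ - (1/2) * ⟪B (Y - ξ), Y - ξ⟫| ≤ α * ‖Y - ξ‖^2) → ∀ d, ∀ α > (0:ℝ),
      ∀ᶠ s in 𝓝 (0:ℝ), s * ⟪g, d⟫ + s^2/2 * ⟪B d, d⟫ - α * ‖d‖^2 * s^2 ≤ h (ξ + s • d) - h ξ := by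
    intro h ξ g B hX d α hα
    filter_upwards [(line_tendsto ξ d).eventually (hX α hα)] with s hs
    have := (abs_le.1 hs).1
    rw [add_sub_cancel_left, inner_smul_right, norm_smul, mul_pow, Real.norm_eq_abs, sq_abs, map_smul,
      inner_smul_left, inner_smul_right] at this
    simp at this
    linarith only [this]
  have gn1 : ‖g1 ξ1‖ ≤ G0 := by
    rw [E1]
    have y1 : ‖β⁻¹ • (ξ1 - ξ2)‖ ≤ 1 / β := by
      rw [norm_smul, Real.norm_of_nonneg (by positivity), one_div]
      exact mul_le_of_le_one_right (by positivity) (by linarith only [n12, hwr, hr1])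
    have y2 : ‖β⁻¹ • (ξ1 - ξ3)‖ ≤ 1 / β := by
      rw [norm_smul, Real.norm_of_nonneg (by positivity), one_div]
      exact mul_le_of_le_one_right (by positivity) (by linarith only [n13, hwr, hr1])
    have y3 : ‖S (ξ1 - X0)‖ ≤ ‖S‖ := (S.le_opNorm _).trans (mul_le_of_le_one_right (norm_nonneg _) (by linarith only [m1, hr1]))
    have y4 : 4 / β = 4 * (1 / β) := by ring
    have y5 : 0 < 1 / β := by positivity
    calc _ ≤ ‖β⁻¹ • (ξ1 - ξ2)‖ + ‖β⁻¹ • (ξ1 - ξ3)‖ + (‖p‖ + ‖S (ξ1 - X0)‖) + ‖P1‖ := by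
          refine (norm_add_le _ _).trans (add_le_add ((norm_add_le _ _).trans (add_le_add (norm_add_le _ _) (norm_add_le _ _))) le_rfl)
      _ ≤ _ := by rw [hG0]; linarith only [y1, y2, y3, y4, y5, hP1, hτ1]
  have gn : ∀ (ξ P : V), ‖ξ - ξ1‖ ≤ w0 → ‖P‖ < τ → ‖β⁻¹ • (ξ - ξ1) + P‖ ≤ G0 := by
    intro ξ P hξ hP
    have y1 : ‖β⁻¹ • (ξ - ξ1)‖ ≤ 1 / β := by
      rw [norm_smul, Real.norm_of_nonneg (by positivity), one_div]
      exact mul_le_of_le_one_right (by positivity) (by linarith only [hξ, hwr, hr1])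
    have y4 : 4 / β = 4 * (1 / β) := by ring
    have y5 : 0 < 1 / β := by positivity
    refine (norm_add_le _ _).trans ?_
    rw [hG0]; linarith only [norm_nonneg p, norm_nonneg S, y1, y4, y5, hP, hτ1]
  have inr : ∀ ξ Y : V, ‖ξ - X0‖ ≤ r/2 → ‖Y - ξ‖ ≤ r/2 → ‖ξ + (1:ℝ) • (Y - ξ) - X0‖ ≤ r := by
    intro ξ Y a b
    rw [one_smul, add_sub_cancel]
    linarith only [tri Y ξ X0, a, b]
  have t1 := touch_global (h := h1) (ξ := ξ1) (g := g1 ξ1) (k0 := k0) hr hM1 (by linarith only [(abs_le.1 (b1 ξ1)).1, fh1 ξ1]) gn1 hk00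
    (fun Y hY => by
      have := star (Y - ξ1) 0 0 1 (inr _ _ r1 hY) (by simpa using m2) (by simpa using m3)
      rw [← first] at this
      simp only [one_smul, add_sub_cancel, smul_zero, add_zero, sub_self, inner_zero_right, m, sub_zero] at this
      have e := (abs_le.1 (inner_S_le S (Y - ξ1))).2
      rw [hk0, show 2 / β = 2 * β⁻¹ by ring]; linarith only [this, e])
  have t2 := touch_global (h := h2) (ξ := ξ2) (g := g2 ξ2) (k0 := k0) (G0 := G0) hr hM2 (by linarith only [(abs_le.1 (b2 ξ2)).1, fh2 ξ2]) (by rw [E2]; exact gn _ _ n21 hP2) hk00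
    (fun Y hY => by
      have := star 0 (Y - ξ2) 0 1 (by simpa using m1) (inr _ _ r2 hY) (by simpa using m3)
      rw [← first] at this
      simp only [one_smul, add_sub_cancel, smul_zero, add_zero, sub_self, inner_zero_right, m, sub_zero, zero_sub, norm_neg, norm_zero, zero_add] at this
      have e : 0 ≤ ‖S‖ * ‖Y - ξ2‖^2 := by positivity
      have e' : 0 ≤ β⁻¹ * ‖Y - ξ2‖^2 := by positivity
      rw [hk0, show 2 / β = 2 * β⁻¹ by ring]; linarith only [this, e, e'])
  have t3 := touch_global (h := h3) (ξ := ξ3) (g := g3 ξ3) (k0 := k0) (G0 := G0) hr hM3 (by linarith only [(abs_le.1 (b3 ξ3)).1, fh3 ξ3]) (by rw [E3]; exact gn _ _ n31 hP3) hk00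
    (fun Y hY => by
      have := star 0 0 (Y - ξ3) 1 (by simpa using m1) (by simpa using m2) (inr _ _ r3 hY)
      rw [← first] at this
      simp only [one_smul, add_sub_cancel, smul_zero, add_zero, sub_self, inner_zero_right, m, sub_zero, zero_sub, norm_neg, norm_zero, zero_add] at this
      have e : 0 ≤ ‖S‖ * ‖Y - ξ3‖^2 := by positivity
      have e' : 0 ≤ β⁻¹ * ‖Y - ξ3‖^2 := by positivity
      rw [hk0, show 2 / β = 2 * β⁻¹ by ring]; linarith only [this, e, e'])
  have fin : ∀ (F h : V → ℝ) (ξ g : V) (B : V →L[ℝ] V), UJet h ξ g B → (∀ x, |F x| ≤ M) →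
      (∀ X Y, F Y - ‖Y - X‖^2 / (2 * β) ≤ h X) → ‖ξ - X0‖ ≤ r/2 →
      (∃ x0, h ξ = F x0 - ‖x0 - ξ‖^2 / (2 * β) ∧ x0 - ξ = β • g) → 
      ∃ x0, UJet F x0 g B ∧ x0 - ξ = β • g ∧ ‖x0 - X0‖ < r := by
    rintro F h ξ g B hj hF hl hξ ⟨x0, e1, e2⟩
    refine ⟨x0, ?_, e2, ?_⟩
    · have := UJet.transfer (f := F) (s := x0 - ξ) (κ := -(‖x0 - ξ‖^2 / (2 * β))) hj (fun Y => by
        have := hl Y (Y + (x0 - ξ)); rw [add_sub_cancel_left] at this; linarith only [this]) (by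
        rw [add_sub_cancel]; linarith only [e1])
      rwa [add_sub_cancel] at this
    · have y1 := hl ξ ξ
      have y2 := (abs_le.1 (hF ξ)).1
      have y3 := (abs_le.1 (hF x0)).2
      rw [sub_self, norm_zero] at y1
      have y4 : ‖x0 - ξ‖^2 / (2 * β) ≤ 2 * M := by norm_num at y1; linarith only [y1, y2, y3, e1]
      rw [div_le_iff₀ (by positivity)] at y4
      have y5 : ‖x0 - ξ‖^2 ≤ w0^2 := by
        have h7 : 0 ≤ M * δ := by positivity
        linarith only [y4, hMδ, h7]
      have := abs_le_of_sq_le_sq' y5 hw00.le |>.2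
      linarith only [tri x0 ξ X0, this, hξ, hwr, hr]
  obtain ⟨x1, jx1, ex1, nx1⟩ := fin F1 h1 ξ1 _ _ (J _ _ _ _ X1) b1 hl1 r1 (ht1 ξ1 k' hk'δ t1)
  obtain ⟨x2, jx2, ex2, nx2⟩ := fin F2 h2 ξ2 _ _ (J _ _ _ _ X2) b2 hl2 r2 (ht2 ξ2 k' hk'δ t2)
  obtain ⟨x3, jx3, ex3, nx3⟩ := fin F3 h3 ξ3 _ _ (J _ _ _ _ X3) b3 hl3 r3 (ht3 ξ3 k' hk'δ t3)
  refine ⟨β, hβ0, hβζ, ξ1, ξ2, ξ3, x1, x2, x3, g1 ξ1, g2 ξ2, g3 ξ3, _, _, _, jx1, jx2, jx3, ex1, ex2, ex3,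
    ⟨by linarith only [r1, hr], by linarith only [r2, hr], by linarith only [r3, hr]⟩, ⟨nx1, nx2, nx3⟩, ?_, ?_, ?_, ?_⟩
  · rw [E2, add_sub_cancel_left]; linarith only [hP2, hτζ, hζ]
  · rw [E3, add_sub_cancel_left]; linarith only [hP3, hτζ, hζ]
  · have : g1 ξ1 + g2 ξ2 + g3 ξ3 - p - S (ξ1 - X0) = P1 + P2 + P3 := by
      rw [E1, E2, E3]; module
    rw [this]
    linarith only [norm_add_le (P1 + P2) P3, norm_add_le P1 P2, hP1, hP2, hP3, hτζ]
  · intro d1 d2 d3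
    have := poly_second (b := (⟪(fderiv ℝ g1 ξ1) d1, d1⟫ + ⟪(fderiv ℝ g2 ξ2) d2, d2⟫ + ⟪(fderiv ℝ g3 ξ3) d3, d3⟫ - m d1 d2 d3)/2)
      (K := ‖d1‖^2 + ‖d2‖^2 + ‖d3‖^2) (by
        intro α' hα'
        filter_upwards [near ξ1 d1 r1, near ξ2 d2 r2, near ξ3 d3 r3, JL _ _ _ _ X1 d1 α' hα', JL _ _ _ _ X2 d2 α' hα',
          JL _ _ _ _ X3 d3 α' hα'] with s e1 e2 e3 j1 j2 j3
        have := star d1 d2 d3 s e1 e2 e3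
        rw [← first] at this
        linarith only [this, j1, j2, j3])
    simp only [m] at this
    linarith only [this]

theorem sums3 {F1 F2 F3 : V → ℝ} (c1 : Continuous F1) (c2 : Continuous F2) (c3 : Continuous F3)
    {M : ℝ} (b1 : ∀ x, |F1 x| ≤ M) (b2 : ∀ x, |F2 x| ≤ M) (b3 : ∀ x, |F3 x| ≤ M)
    {X0 p : V} {B : V →L[ℝ] V} (hW : UJet (fun X => F1 X + F2 X + F3 X) X0 p B) {ζ : ℝ} (hζ : 0 < ζ) :
    ∃ β > 0, β < ζ ∧ ∃ (ξ1 ξ2 ξ3 x1 x2 x3 p1 p2 p3 : V) (B1 B2 B3 : V →L[ℝ] V),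
      UJet F1 x1 p1 B1 ∧ UJet F2 x2 p2 B2 ∧ UJet F3 x3 p3 B3 ∧
      x1 - ξ1 = β • p1 ∧ x2 - ξ2 = β • p2 ∧ x3 - ξ3 = β • p3 ∧
      (‖ξ1 - X0‖ < ζ ∧ ‖ξ2 - X0‖ < ζ ∧ ‖ξ3 - X0‖ < ζ) ∧ 
      (‖x1 - X0‖ < ζ ∧ ‖x2 - X0‖ < ζ ∧ ‖x3 - X0‖ < ζ) ∧
      ‖p2 - β⁻¹ • (ξ2 - ξ1)‖ < ζ ∧ ‖p3 - β⁻¹ • (ξ3 - ξ1)‖ < ζ ∧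
      ‖p1 + p2 + p3 - p‖ < ζ ∧
      ∀ d1 d2 d3, ⟪B1 d1, d1⟫ + ⟪B2 d2, d2⟫ + ⟪B3 d3, d3⟫ ≤
        β⁻¹ * (‖d1 - d2‖^2 + ‖d1 - d3‖^2) + ⟪B d1, d1⟫ + ζ * ‖d1‖^2 := by
  set α := ζ / 4 with hα
  have hα0 : 0 < α := by positivity
  let S : V →L[ℝ] V := (1/2:ℝ) • (B + ContinuousLinearMap.adjoint B) + (4 * α) • ContinuousLinearMap.id ℝ V
  have hS : ∀ a b, ⟪S a, b⟫ = ⟪S b, a⟫ := by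
    intro a b
    simp [S, inner_add_left, inner_smul_left, ContinuousLinearMap.adjoint_inner_left, real_inner_comm]
    ring
  have hSB : ∀ d, ⟪S d, d⟫ = ⟪B d, d⟫ + 4 * α * ‖d‖^2 := by
    intro d
    simp [S, inner_add_left, inner_smul_left, ContinuousLinearMap.adjoint_inner_left, real_inner_comm]
    ring
  obtain ⟨r0, hr0, hr0'⟩ := Metric.eventually_nhds_iff.1 (hW α hα0)
  set r := min (min (r0 / 2) 1) (min ζ (ζ / (2 * (‖S‖ + 1)))) with hr
  have hr_pos : 0 < r := by positivity
  have rr0 : r ≤ r0 / 2 := (min_le_left _ _).trans (min_le_left _ _)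
  have rr1 : r ≤ 1 := (min_le_left _ _).trans (min_le_right _ _)
  have rζ : r ≤ ζ := (min_le_right _ _).trans (min_le_left _ _)
  have rS : r * (2 * (‖S‖ + 1)) ≤ ζ := by
    have : r ≤ ζ / (2 * (‖S‖ + 1)) := (min_le_right _ _).trans (min_le_right _ _)
    rwa [le_div_iff₀ (by positivity)] at this
  obtain ⟨β, hβ, hβζ, ξ1, ξ2, ξ3, x1, x2, x3, p1, p2, p3, B1, B2, B3, j1, j2, j3, e1, e2, e3, ⟨n1, n2, n3⟩, ⟨m1, m2, m3⟩, q2, q3, q1, hB⟩ :=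
    sums3_core c1 c2 c3 b1 b2 b3 (X0 := X0) (p := p) hS hr_pos rr1 hα0 (half_pos hζ) (fun Y hY => by
      have := @hr0' Y (by rw [dist_eq_norm]; linarith)
      simp only at this
      rw [hSB]; linarith)
  refine ⟨β, hβ, by linarith, ξ1, ξ2, ξ3, x1, x2, x3, p1, p2, p3, B1, B2, B3, j1, j2, j3, e1, e2, e3, ⟨by linarith, by linarith, by linarith⟩, 
    ⟨by linarith, by linarith, by linarith⟩, by linarith, by linarith, ?_, fun d1 d2 d3 => ?_⟩
  · have h1 : ‖S (ξ1 - X0)‖ ≤ ‖S‖ * r := (S.le_opNorm _).trans (by gcongr)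
    have h2 : p1 + p2 + p3 - p = (p1 + p2 + p3 - p - S (ξ1 - X0)) + S (ξ1 - X0) := by abel
    rw [h2]
    refine (norm_add_le _ _).trans_lt ?_
    nlinarith
  · have := hB d1 d2 d3
    rw [hSB] at this
    have e : 4 * α = ζ := by rw [hα]; ring
    rw [e] at this
    linarith
end sums

abbrev VN (N : ℕ) := WithLp 2 (E N × ℝ)
def pt {N : ℕ} (x : E N) (t : ℝ) : VN N := WithLp.toLp 2 (x, t)
@[simp] lemma pt_fst {N : ℕ} (x : E N) (t : ℝ) : (pt x t).fst = x := rfl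
@[simp] lemma pt_snd {N : ℕ} (x : E N) (t : ℝ) : (pt x t).snd = t := rfl
lemma pt_eta {N : ℕ} (X : VN N) : pt X.fst X.snd = X := rfl
lemma pt_add {N : ℕ} (x y : E N) (s t : ℝ) : pt (x + y) (s + t) = pt x s + pt y t := rfl
lemma pt_sub {N : ℕ} (x y : E N) (s t : ℝ) : pt (x - y) (s - t) = pt x s - pt y t := rfl
lemma pt_smul {N : ℕ} (x : E N) (s t : ℝ) : pt (s • x) (s * t) = s • pt x t := rfl
lemma inner_pt {N : ℕ} (p : VN N) (x : E N) (t : ℝ) : ⟪p, pt x t⟫ = ⟪p.fst, x⟫ + p.snd * t := by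
  rw [WithLp.prod_inner_apply]; simp [pt, mul_comm]
lemma norm_pt_sq {N : ℕ} (x : E N) (t : ℝ) : ‖pt x t‖^2 = ‖x‖^2 + t^2 := by
  rw [WithLp.prod_norm_sq_eq_of_L2]; simp [pt]
lemma norm_fst_le {N : ℕ} (p : VN N) : ‖p.fst‖ ≤ ‖p‖ := by
  have := norm_pt_sq p.fst p.snd
  rw [pt_eta] at this
  refine abs_le_of_sq_le_sq' ?_ (norm_nonneg _) |>.2
  nlinarith [sq_nonneg p.snd]
lemma abs_snd_le {N : ℕ} (p : VN N) : |p.snd| ≤ ‖p‖ := by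
  have := norm_pt_sq p.fst p.snd
  rw [pt_eta] at this
  refine abs_le_of_sq_le_sq ?_ (norm_nonneg _)
  nlinarith [sq_nonneg ‖p.fst‖]
lemma norm_pt0 {N : ℕ} (x : E N) : ‖pt x 0‖ = ‖x‖ := by
  have := norm_pt_sq x 0
  rw [← abs_of_nonneg (norm_nonneg (pt x 0)), ← abs_of_nonneg (norm_nonneg x), ← sq_eq_sq_iff_abs_eq_abs]
  simpa using this
def io (N : ℕ) : E N →L[ℝ] VN N :=
  ((WithLp.prodContinuousLinearEquiv 2 ℝ (E N) ℝ).symm : (E N × ℝ) →L[ℝ] VN N) ∘L (ContinuousLinearMap.inl ℝ (E N) ℝ)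
lemma io_apply {N : ℕ} (x : E N) : io N x = pt x 0 := rfl
lemma continuous_pt {N : ℕ} : Continuous (fun q : E N × ℝ => pt q.1 q.2) := by
  unfold pt; fun_prop

def col {N : ℕ} (S : Matrix (Fin N) (Fin N) ℝ) (k : Fin N) : E N := WithLp.toLp 2 (fun i => S i k)
def tq {N : ℕ} (S : Matrix (Fin N) (Fin N) ℝ) (B : VN N →L[ℝ] VN N) : ℝ :=
  ∑ k, ⟪B (pt (col S k) 0), pt (col S k) 0⟫

lemma col_eq {N : ℕ} (S : Matrix (Fin N) (Fin N) ℝ) (k : Fin N) :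
    col S k = ∑ i, S i k • EuclideanSpace.single i (1:ℝ) := by
  ext j
  simp [col, Pi.single_apply]

structure Dat {N : ℕ} {Θ : Type*} (σ : Θ → E N → Matrix (Fin N) (Fin N) ℝ) (H : Θ → E N → E N → ℝ) (Λ : ℝ) : Prop where
  nn : 0 ≤ Λ
  bd : ∀ θ x, ∑ k, ‖col (σ θ x) k‖^2 ≤ Λ
  lip : ∀ θ x y, ∑ k, ‖col (σ θ x) k - col (σ θ y) k‖^2 ≤ Λ * ‖x - y‖^2
  h0 : ∀ θ x, |H θ x 0| ≤ Λ
  hlip : ∀ R > (0:ℝ), ∃ CR > (0:ℝ), ∀ (θ : Θ) (x y p q : E N),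
      ‖p‖ ≤ R → ‖q‖ ≤ R → |H θ x p - H θ y q| ≤ CR * (‖x - y‖ + ‖p - q‖)
  conv : ∀ (θ : Θ) (x : E N), ConvexOn ℝ Set.univ (H θ x)

def SubJ {N : ℕ} {Θ : Type*} (σ : Θ → E N → Matrix (Fin N) (Fin N) ℝ) (H : Θ → E N → E N → ℝ) (I : Set ℝ)
    (f : VN N → ℝ) : Prop :=
  ∀ X p B, X.snd ∈ I → UJet f X p B → ∀ θ, p.snd - tq (σ θ X.fst) B + H θ X.fst p.fst ≤ 0
def SupJ {N : ℕ} {Θ : Type*} (σ : Θ → E N → Matrix (Fin N) (Fin N) ℝ) (H : Θ → E N → E N → ℝ) (I : Set ℝ)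
    (f : VN N → ℝ) : Prop :=
  ∀ X p B, X.snd ∈ I → UJet (fun Y => - f Y) X p B → ∀ ρ > (0:ℝ), ∃ θ,
    0 ≤ -p.snd + tq (σ θ X.fst) B + H θ X.fst (-p.fst) + ρ

section
variable {N : ℕ} {Θ : Type*} {σ : Θ → E N → Matrix (Fin N) (Fin N) ℝ} {H : Θ → E N → E N → ℝ} {Λ : ℝ}

lemma tq_add (S : Matrix (Fin N) (Fin N) ℝ) (B B' : VN N →L[ℝ] VN N) : tq S (B + B') = tq S B + tq S B' := by
  simp only [tq, add_apply, inner_add_left, Finset.sum_add_distrib]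
lemma tq_smul (S : Matrix (Fin N) (Fin N) ℝ) (c : ℝ) (B : VN N →L[ℝ] VN N) : tq S (c • B) = c * tq S B := by
  simp only [tq, smul_apply, inner_smul_left, Finset.mul_sum]; simp

lemma Dat.tq_le (D : Dat σ H Λ) (θ : Θ) (x : E N) (B : VN N →L[ℝ] VN N) : |tq (σ θ x) B| ≤ ‖B‖ * Λ := by
  have h1 : ∀ k, |⟪B (pt (col (σ θ x) k) 0), pt (col (σ θ x) k) 0⟫| ≤ ‖B‖ * ‖col (σ θ x) k‖^2 := by
    intro k
    refine (abs_real_inner_le_norm _ _).trans ?_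
    have := B.le_opNorm (pt (col (σ θ x) k) 0)
    rw [norm_pt0] at *
    calc _ ≤ (‖B‖ * ‖col (σ θ x) k‖) * ‖col (σ θ x) k‖ := by gcongr
      _ = _ := by ring
  refine (Finset.abs_sum_le_sum_abs _ _).trans ((Finset.sum_le_sum fun k _ => h1 k).trans ?_)
  rw [← Finset.mul_sum]
  exact mul_le_mul_of_nonneg_left (D.bd θ x) (norm_nonneg _)

lemma Dat.tq_diff (D : Dat σ H Λ) (θ : Θ) (x y : E N) (B : VN N →L[ℝ] VN N) :
    |tq (σ θ x) B - tq (σ θ y) B| ≤ N * (‖B‖ * (2 * Λ) * ‖x - y‖) := by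
  have hc : ∀ x k, ‖col (σ θ x) k‖ ≤ √Λ := fun x k => by
    refine Real.le_sqrt_of_sq_le ?_
    exact (Finset.single_le_sum (f := fun k => ‖col (σ θ x) k‖^2) (fun i _ => by positivity) (Finset.mem_univ k)).trans (D.bd θ x)
  have hd : ∀ k, ‖col (σ θ x) k - col (σ θ y) k‖ ≤ √Λ * ‖x - y‖ := fun k => by
    refine abs_le_of_sq_le_sq' ?_ (by positivity) |>.2
    rw [mul_pow, Real.sq_sqrt D.nn]
    exact (Finset.single_le_sum (f := fun k => ‖col (σ θ x) k - col (σ θ y) k‖^2) (fun i _ => by positivity) (Finset.mem_univ k)).trans (D.lip θ x y)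
  have h1 : ∀ k, |⟪B (pt (col (σ θ x) k) 0), pt (col (σ θ x) k) 0⟫ - ⟪B (pt (col (σ θ y) k) 0), pt (col (σ θ y) k) 0⟫|
      ≤ ‖B‖ * (2 * Λ) * ‖x - y‖ := by
    intro k
    set a := pt (col (σ θ x) k) 0
    set b := pt (col (σ θ y) k) 0
    have ha : ‖a‖ ≤ √Λ := by rw [norm_pt0]; exact hc _ _
    have hb : ‖b‖ ≤ √Λ := by rw [norm_pt0]; exact hc _ _
    have hab : ‖a - b‖ ≤ √Λ * ‖x - y‖ := by rw [← pt_sub, sub_zero, norm_pt0]; exact hd k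
    have e : ⟪B a, a⟫ - ⟪B b, b⟫ = ⟪B (a - b), a⟫ + ⟪B b, a - b⟫ := by
      rw [map_sub, inner_sub_left, inner_sub_right]; ring
    rw [e]
    refine (abs_add_le _ _).trans ?_
    have h1 : |⟪B (a - b), a⟫| ≤ ‖B‖ * (√Λ * ‖x - y‖) * √Λ := by
      refine (abs_real_inner_le_norm _ _).trans ?_
      gcongr
      exact (B.le_opNorm _).trans (by gcongr)
    have h2 : |⟪B b, a - b⟫| ≤ ‖B‖ * √Λ * (√Λ * ‖x - y‖) := by
      refine (abs_real_inner_le_norm _ _).trans ?_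
      gcongr
      exact (B.le_opNorm _).trans (by gcongr)
    have h3 := Real.mul_self_sqrt D.nn
    have : ‖B‖ * (2 * Λ) * ‖x - y‖ = ‖B‖ * (√Λ * ‖x - y‖) * √Λ + ‖B‖ * √Λ * (√Λ * ‖x - y‖) := by
      linear_combination (-2) * ‖B‖ * ‖x - y‖ * h3
    rw [this]; exact add_le_add h1 h2
  unfold tq
  rw [← Finset.sum_sub_distrib]
  refine (Finset.abs_sum_le_sum_abs _ _).trans ((Finset.sum_le_sum fun k _ => h1 k).trans ?_)
  simp

lemma trace_hess (S : Matrix (Fin N) (Fin N) ℝ) {φ : E N → ℝ} {φ' : E N → (E N →L[ℝ] ℝ)} {x : E N}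
    {D2 : E N →L[ℝ] (E N →L[ℝ] ℝ)} (h1 : ∀ y, HasFDerivAt φ (φ' y) y) (h2 : HasFDerivAt φ' D2 x) :
    Matrix.trace (S * Sᵀ * hessMatrix φ x) = ∑ k, D2 (col S k) (col S k) := by
  have e : ∀ i j, hessMatrix φ x i j = D2 (EuclideanSpace.single i 1) (EuclideanSpace.single j 1) := by
    intro i j
    unfold hessMatrix
    rw [Matrix.of_apply]
    have : (fun y => fderiv ℝ φ y (EuclideanSpace.single j 1)) = fun y => φ' y (EuclideanSpace.single j 1) := by
      funext y; rw [(h1 y).fderiv]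
    rw [this, (h2.clm_apply (hasFDerivAt_const _ _)).fderiv]
    simp
  have e2 : ∀ k, D2 (col S k) (col S k) = ∑ i, ∑ j, S i k * S j k * hessMatrix φ x i j := by
    intro k
    rw [col_eq]
    simp only [map_sum, ContinuousLinearMap.sum_apply, map_smul, smul_apply, smul_eq_mul, e, Finset.mul_sum]
    rw [Finset.sum_comm]
    refine Finset.sum_congr rfl fun i _ => Finset.sum_congr rfl fun j _ => by ring
  have e3 : ∀ i, (S * Sᵀ * hessMatrix φ x).diag i = ∑ k, ∑ j, S i k * S j k * hessMatrix φ x j i := by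
    intro i
    simp only [Matrix.diag, Matrix.mul_apply, Matrix.transpose_apply, Finset.sum_mul]
    rw [Finset.sum_comm]
  rw [Matrix.trace, Finset.sum_congr rfl fun i _ => e3 i, Finset.sum_comm, Finset.sum_congr rfl fun k _ => e2 k]
  refine Finset.sum_congr rfl fun k _ => ?_
  rw [Finset.sum_comm]
  refine Finset.sum_congr rfl fun i _ => Finset.sum_congr rfl fun j _ => by ring
end

section
variable {N : ℕ} {Θ : Type*} {A σ : Θ → E N → Matrix (Fin N) (Fin N) ℝ} {H : Θ → E N → E N → ℝ} {Λ : ℝ}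

lemma opVal_of (hA : ∀ θ x, A θ x = σ θ x * (σ θ x)ᵀ) (θ : Θ) {x : E N} {φ : E N → ℝ} {g : E N → E N}
    {M : E N →L[ℝ] E N} (h1 : ∀ y, HasFDerivAt φ (innerSL ℝ (g y)) y) (h2 : HasFDerivAt g M x) :
    opVal A H θ x φ = - ∑ k, ⟪M (col (σ θ x) k), col (σ θ x) k⟫ + H θ x (g x) := by
  unfold opVal
  have hg : gradient φ x = g x := by
    refine HasGradientAt.gradient ?_
    rw [hasGradientAt_iff_hasFDerivAt]
    exact h1 x
  have h3 : HasFDerivAt (fun y => innerSL ℝ (g y)) ((innerSL ℝ).comp M) x :=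
    (ContinuousLinearMap.hasFDerivAt (innerSL ℝ)).comp x h2
  rw [hg, hA, trace_hess (σ θ x) h1 h3]
  rfl

lemma quad_grad (g x : E N) (k : ℝ) (M : E N →L[ℝ] E N) (hM : ∀ a b, ⟪M a, b⟫ = ⟪M b, a⟫) (y : E N) :
    HasFDerivAt (fun y => k + ⟪g, y - x⟫ + (1/2) * ⟪M (y - x), y - x⟫) (innerSL ℝ (g + M (y - x))) y := by
  have e : HasFDerivAt (fun y : E N => y - x) (ContinuousLinearMap.id ℝ (E N)) y := (hasFDerivAt_id y).sub_const x
  have e1 := (HasFDerivAt.inner ℝ (hasFDerivAt_const g y) e)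
  have e2 := (HasFDerivAt.inner ℝ (M.hasFDerivAt.comp y e) e)
  refine ((e1.const_add k).add (e2.const_mul (1/2))).congr_fderiv ?_
  ext d
  simp [inner_add_left]
  rw [hM d, map_sub, inner_sub_left]
  ring

def qp {N : ℕ} (X p : VN N) (B : VN N →L[ℝ] VN N) (α c : ℝ) (x : E N) (t : ℝ) : ℝ :=
  ⟪p, pt x t - X⟫ + (1/2) * ⟪B (pt x t - X), pt x t - X⟫ + α * ‖pt x t - X‖^2 - c * t

lemma qp_contDiff (X p : VN N) (B : VN N →L[ℝ] VN N) (α c : ℝ) :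
    ContDiff ℝ 2 (fun q : E N × ℝ => qp X p B α c q.1 q.2) := by
  have h : ContDiff ℝ 2 (fun q : E N × ℝ => pt q.1 q.2) :=
    (WithLp.prodContinuousLinearEquiv 2 ℝ (E N) ℝ).symm.contDiff
  have h' : ContDiff ℝ 2 (fun q : E N × ℝ => pt q.1 q.2 - X) := h.sub contDiff_const
  unfold qp
  refine (((contDiff_const.inner ℝ h').add (contDiff_const.mul ((B.contDiff.comp h').inner ℝ h'))).add
    (contDiff_const.mul (h'.norm_sq ℝ))).sub (contDiff_const.mul contDiff_snd)

lemma qp_deriv (X p : VN N) (B : VN N →L[ℝ] VN N) (α c : ℝ) :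
    deriv (qp X p B α c X.fst) X.snd = p.snd - c := by
  have e : qp X p B α c X.fst = fun t => p.snd * (t - X.snd) + ((1/2) * ⟪B (pt 0 1), pt 0 1⟫ + α) * (t - X.snd)^2 - c * t := by
    funext t
    have : pt X.fst t - X = pt 0 (t - X.snd) := by rw [← pt_eta X, ← pt_sub]; simp
    have e2 : pt (0 : E N) (t - X.snd) = (t - X.snd) • pt 0 1 := by rw [← pt_smul]; simp
    unfold qp
    rw [this, norm_pt_sq, inner_pt, e2, map_smul, inner_smul_left, inner_smul_right]
    simp
    ring
  rw [e]
  have h : HasDerivAt (fun t : ℝ => t - X.snd) 1 X.snd := (hasDerivAt_id _).sub_const _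
  have := ((h.const_mul p.snd).add ((h.pow 2).const_mul ((1/2) * ⟪B (pt 0 1), pt 0 1⟫ + α))).sub ((hasDerivAt_id X.snd).const_mul c)
  refine this.deriv.trans ?_
  rw [sub_self]; norm_num

lemma qp_opVal (hA : ∀ θ x, A θ x = σ θ x * (σ θ x)ᵀ) (X p : VN N) (B : VN N →L[ℝ] VN N) (α c : ℝ) (θ : Θ) :
    opVal A H θ X.fst (fun y => qp X p B α c y X.snd) =
      - tq (σ θ X.fst) B - 2 * α * ∑ k, ‖col (σ θ X.fst) k‖^2 + H θ X.fst p.fst := by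
  set T : E N →L[ℝ] E N := (io N).adjoint ∘L B ∘L (io N) with hT
  set M : E N →L[ℝ] E N := (1/2 : ℝ) • (T + T.adjoint) + (2 * α) • ContinuousLinearMap.id ℝ (E N) with hMdef
  have hT' : ∀ a b, ⟪T a, b⟫ = ⟪B (pt a 0), pt b 0⟫ := fun a b => by
    rw [hT]; simp only [ContinuousLinearMap.comp_apply]; rw [ContinuousLinearMap.adjoint_inner_left]; rfl
  have hM : ∀ a b, ⟪M a, b⟫ = (1/2) * (⟪T a, b⟫ + ⟪T b, a⟫) + 2 * α * ⟪a, b⟫ := fun a b => by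
    rw [hMdef]
    simp only [add_apply, smul_apply, inner_add_left, inner_smul_left, ContinuousLinearMap.adjoint_inner_left,
      ContinuousLinearMap.id_apply]
    rw [real_inner_comm (T b) a]; simp
  have e : (fun y => qp X p B α c y X.snd) =
      fun y => - c * X.snd + ⟪p.fst, y - X.fst⟫ + (1/2) * ⟪M (y - X.fst), y - X.fst⟫ := by
    funext y
    have : pt y X.snd - X = pt (y - X.fst) 0 := by
      conv_lhs => rw [← pt_eta X, pt_snd, ← pt_sub]
      simp
    unfold qp
    rw [this, hM, hT', norm_pt0, inner_pt, real_inner_self_eq_norm_sq]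
    ring
  rw [e, opVal_of hA θ (quad_grad p.fst X.fst (-c * X.snd) M (fun a b => by
    rw [hM, hM, real_inner_comm a b]; ring)) (g := fun y => p.fst + M (y - X.fst)) (M := M)]
  · simp only [hM, hT', sub_self, map_zero, add_zero, real_inner_self_eq_norm_sq, Finset.sum_add_distrib, tq,
      ← Finset.mul_sum]
    ring
  · exact (M.hasFDerivAt.comp X.fst ((hasFDerivAt_id X.fst).sub_const X.fst)).const_add p.fst

lemma Dat.H_le (D : Dat σ H Λ) (p : E N) : ∃ K, ∀ θ x, |H θ x p| ≤ K := by
  obtain ⟨CR, _, h⟩ := D.hlip (‖p‖ + 1) (by positivity)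
  refine ⟨Λ + CR * ‖p‖, fun θ x => ?_⟩
  have h1 := h θ x x p 0 (by linarith) (by rw [norm_zero]; positivity)
  rw [sub_self, norm_zero, zero_add, sub_zero] at h1
  have h2 := D.h0 θ x
  rw [abs_le] at *
  constructor <;> linarith [h1.1, h1.2, h2.1, h2.2]

lemma Dat.opVal_bdd (D : Dat σ H Λ) (hA : ∀ θ x, A θ x = σ θ x * (σ θ x)ᵀ) (X p : VN N) (B : VN N →L[ℝ] VN N) (α c : ℝ) :
    BddAbove (Set.range fun θ => opVal A H θ X.fst (fun y => qp X p B α c y X.snd)) := by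
  obtain ⟨K, hK⟩ := D.H_le p.fst
  refine ⟨‖B‖ * Λ + 2 * |α| * Λ + K, ?_⟩
  rintro _ ⟨θ, rfl⟩
  simp only
  rw [qp_opVal hA]
  have h1 := (abs_le.1 (D.tq_le θ X.fst B)).1
  have h2 := (abs_le.1 (hK θ X.fst)).2
  have h3 : -(α * ∑ k, ‖col (σ θ X.fst) k‖^2) ≤ |α| * Λ := by
    refine (neg_le_abs _).trans ?_
    rw [abs_mul, abs_of_nonneg (a := ∑ k, ‖col (σ θ X.fst) k‖^2) (by positivity)]
    exact mul_le_mul_of_nonneg_left (D.bd θ X.fst) (abs_nonneg _)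
  linarith

lemma le_of_forall_alpha {a b K : ℝ} (h : ∀ α > (0:ℝ), a ≤ b + α * K) : a ≤ b := by
  by_contra! hc
  have := h ((a - b) / (2 * (|K| + 1))) (by have : 0 < a - b := by linarith
                                            positivity)
  have h2 : (a - b) / (2 * (|K| + 1)) * K ≤ (a - b) / 2 := by
    rw [div_mul_eq_mul_div, div_le_div_iff₀ (by positivity) (by norm_num)]
    nlinarith [le_abs_self K, abs_nonneg K]
  linarith

lemma sub_jet (D : Dat σ H Λ) (hA : ∀ θ x, A θ x = σ θ x * (σ θ x)ᵀ) {u : E N → ℝ → ℝ} (hu : IsSubSolCP A H u) (c : ℝ) :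
    SubJ σ (fun θ x p => H θ x p - c) (Set.Ioi 0) (fun X => u X.fst X.snd + c * X.snd) := by
  intro X p B hX hj θ
  refine le_of_forall_alpha (K := 2 * Λ) fun α hα => ?_
  have hmax : IsLocalMax (fun q : E N × ℝ => u q.1 q.2 - qp X p B α c q.1 q.2) (X.fst, X.snd) := by
    have ht : Tendsto (fun q : E N × ℝ => pt q.1 q.2) (𝓝 (X.fst, X.snd)) (𝓝 X) := by
      have := (continuous_pt (N := N)).tendsto (X.fst, X.snd)
      exact this
    filter_upwards [ht.eventually (hj α hα)] with q hq
    simp only [pt_fst, pt_snd] at hq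
    unfold qp
    rw [pt_eta]; simp only [sub_self, map_zero, inner_zero_right, norm_zero]
    linarith only [hq]
  have h := hu (qp X p B α c) (qp_contDiff X p B α c) X.fst X.snd hX hmax
  rw [qp_deriv] at h
  have h2 := le_ciSup (D.opVal_bdd hA X p B α c) θ
  rw [qp_opVal hA] at h2
  have h3 := mul_le_mul_of_nonneg_left (D.bd θ X.fst) hα.le
  simp only
  linarith

lemma sup_jet [Nonempty Θ] (D : Dat σ H Λ) (hA : ∀ θ x, A θ x = σ θ x * (σ θ x)ᵀ) {u : E N → ℝ → ℝ} (hu : IsSuperSolCP A H u) (c : ℝ) :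
    SupJ σ (fun θ x p => H θ x p - c) (Set.Ioi 0) (fun X => u X.fst X.snd + c * X.snd) := by
  intro X p B hX hj ρ hρ
  set α : ℝ := ρ / (4 * (Λ + 1)) with hαdef
  have hΛ := D.nn
  have hα : 0 < α := by positivity
  have hmin : IsLocalMin (fun q : E N × ℝ => u q.1 q.2 - qp X (-p) (-B) (-α) c q.1 q.2) (X.fst, X.snd) := by
    have ht : Tendsto (fun q : E N × ℝ => pt q.1 q.2) (𝓝 (X.fst, X.snd)) (𝓝 X) := by
      have := (continuous_pt (N := N)).tendsto (X.fst, X.snd)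
      exact this
    filter_upwards [ht.eventually (hj α hα)] with q hq
    simp only [pt_fst, pt_snd] at hq
    unfold qp
    rw [pt_eta]; simp only [sub_self, map_zero, inner_zero_right, norm_zero, neg_apply, inner_neg_left]
    linarith only [hq]
  have h := hu (qp X (-p) (-B) (-α) c) (qp_contDiff X (-p) (-B) (-α) c) X.fst X.snd hX hmin
  rw [qp_deriv] at h
  obtain ⟨θ, hθ⟩ := exists_lt_of_lt_ciSup (show (⨆ θ, opVal A H θ X.fst (fun y => qp X (-p) (-B) (-α) c y X.snd)) - ρ/2 <
    (⨆ θ, opVal A H θ X.fst (fun y => qp X (-p) (-B) (-α) c y X.snd)) by linarith)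
  rw [qp_opVal hA] at hθ
  refine ⟨θ, ?_⟩
  have h3 := mul_le_mul_of_nonneg_left (D.bd θ X.fst) hα.le
  have h4 : tq (σ θ X.fst) (-B) = - tq (σ θ X.fst) B := by
    have := tq_smul (σ θ X.fst) (-1) B
    have e : (-1 : ℝ) • B = -B := by module
    rw [e, neg_one_mul] at this; exact this
  have h5 : α * Λ ≤ ρ / 4 := by
    have : α * (4 * (Λ + 1)) = ρ := by rw [hαdef]; field_simp
    linarith
  rw [h4] at hθ
  have e1 : (-p).fst = -p.fst := rfl
  have e2 : (-p).snd = -p.snd := rfl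
  rw [e1] at hθ; rw [e2] at h
  simp only
  linarith

lemma erg_sub {c : ℝ} {v : E N → ℝ} (h : IsSubSolErg A H c v) : IsSubSolCP A H (fun x t => v x - c * t) := by
  intro φ hφ x0 t0 ht0 hmax
  have h1 : deriv (φ x0) t0 = - c := by
    have hl : IsLocalMax (fun t => v x0 - c * t - φ x0 t) t0 :=
      (Continuous.tendsto (f := fun t : ℝ => (x0, t)) (by fun_prop) t0).eventually hmax
    have hd : DifferentiableAt ℝ (φ x0) t0 := by
      have : Differentiable ℝ (fun q : E N × ℝ => φ q.1 q.2) := hφ.differentiable (by norm_num)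
      exact this.differentiableAt.comp t0 (f := fun t : ℝ => (x0, t)) (by fun_prop)
    have hd2 : HasDerivAt (fun t => v x0 - c * t - φ x0 t) (0 - c * 1 - deriv (φ x0) t0) t0 :=
      ((hasDerivAt_const _ _).sub ((hasDerivAt_id _).const_mul c)).sub hd.hasDerivAt
    have := hl.hasDerivAt_eq_zero hd2
    linarith
  have h2 := h (fun y => φ y t0) (hφ.comp (f := fun y : E N => (y, t0)) (by fun_prop)) x0 (by
    have hl := (Continuous.tendsto (f := fun x : E N => (x, t0)) (by fun_prop) x0).eventually hmax
    filter_upwards [hl] with x hx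
    linarith only [hx])
  linarith

lemma erg_sup {c : ℝ} {v : E N → ℝ} (h : IsSuperSolErg A H c v) : IsSuperSolCP A H (fun x t => v x - c * t) := by
  intro φ hφ x0 t0 ht0 hmax
  have h1 : deriv (φ x0) t0 = - c := by
    have hl : IsLocalMin (fun t => v x0 - c * t - φ x0 t) t0 :=
      (Continuous.tendsto (f := fun t : ℝ => (x0, t)) (by fun_prop) t0).eventually hmax
    have hd : DifferentiableAt ℝ (φ x0) t0 := by
      have : Differentiable ℝ (fun q : E N × ℝ => φ q.1 q.2) := hφ.differentiable (by norm_num)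
      exact this.differentiableAt.comp t0 (f := fun t : ℝ => (x0, t)) (by fun_prop)
    have hd2 : HasDerivAt (fun t => v x0 - c * t - φ x0 t) (0 - c * 1 - deriv (φ x0) t0) t0 :=
      ((hasDerivAt_const _ _).sub ((hasDerivAt_id _).const_mul c)).sub hd.hasDerivAt
    have := hl.hasDerivAt_eq_zero hd2
    linarith
  have h2 := h (fun y => φ y t0) (hφ.comp (f := fun y : E N => (y, t0)) (by fun_prop)) x0 (by
    have hl := (Continuous.tendsto (f := fun x : E N => (x, t0)) (by fun_prop) x0).eventually hmax
    filter_upwards [hl] with x hx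
    linarith only [hx])
  linarith

lemma v_sub (D : Dat σ H Λ) (hA : ∀ θ x, A θ x = σ θ x * (σ θ x)ᵀ) {c : ℝ} {v : E N → ℝ} (h : IsSubSolErg A H c v) :
    SubJ σ (fun θ x p => H θ x p - c) (Set.Ioi 0) (fun X => v X.fst) := by
  have := sub_jet D hA (erg_sub h) c
  simpa using this

lemma v_sup [Nonempty Θ] (D : Dat σ H Λ) (hA : ∀ θ x, A θ x = σ θ x * (σ θ x)ᵀ) {c : ℝ} {v : E N → ℝ} (h : IsSuperSolErg A H c v) :
    SupJ σ (fun θ x p => H θ x p - c) (Set.Ioi 0) (fun X => v X.fst) := by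
  have := sup_jet D hA (erg_sup h) c
  simpa using this
end

section
variable {N : ℕ} {Θ : Type*} {A σ : Θ → E N → Matrix (Fin N) (Fin N) ℝ} {H : Θ → E N → E N → ℝ} {Λ : ℝ}

structure Nice (L : ℝ) (f : VN N → ℝ) : Prop where
  cont : Continuous f
  bdd : ∃ M, ∀ X, |f X| ≤ M
  lip : ∀ X (d : E N), |f (X + pt d 0) - f X| ≤ L * ‖d‖

lemma jet_fst_le {f : VN N → ℝ} {L : ℝ} (hL0 : 0 ≤ L) (hf : ∀ X (d : E N), |f (X + pt d 0) - f X| ≤ L * ‖d‖) {X p : VN N}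
    {B : VN N →L[ℝ] VN N} (h : UJet f X p B) : ‖p.fst‖ ≤ L := by
  have := h.inner_le (e := pt p.fst 0) (L := L * ‖p.fst‖) (fun s => by
    have := hf X (s • p.fst)
    rw [norm_smul, Real.norm_eq_abs] at this
    have e : pt (s • p.fst) 0 = s • pt p.fst 0 := by rw [← pt_smul, mul_zero]
    rw [e] at this
    linarith)
  rw [inner_pt, mul_zero, add_zero, real_inner_self_eq_norm_sq, abs_of_nonneg (by positivity)] at this
  by_contra! hc
  nlinarith [norm_nonneg p.fst]

lemma tq_sum {S1 S2 S3 : Matrix (Fin N) (Fin N) ℝ} {B B1 B2 B3 : VN N →L[ℝ] VN N} {β ζ : ℝ}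
    (h : ∀ d1 d2 d3, ⟪B1 d1, d1⟫ + ⟪B2 d2, d2⟫ + ⟪B3 d3, d3⟫ ≤
        β⁻¹ * (‖d1 - d2‖^2 + ‖d1 - d3‖^2) + ⟪B d1, d1⟫ + ζ * ‖d1‖^2) :
    tq S1 B1 + tq S2 B2 + tq S3 B3 ≤ β⁻¹ * (∑ k, ‖col S1 k - col S2 k‖^2 + ∑ k, ‖col S1 k - col S3 k‖^2)
      + tq S1 B + ζ * ∑ k, ‖col S1 k‖^2 := by
  unfold tq
  rw [← Finset.sum_add_distrib, ← Finset.sum_add_distrib, ← Finset.sum_add_distrib, Finset.mul_sum, Finset.mul_sum,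
    ← Finset.sum_add_distrib, ← Finset.sum_add_distrib]
  refine Finset.sum_le_sum fun k _ => ?_
  have := h (pt (col S1 k) 0) (pt (col S2 k) 0) (pt (col S3 k) 0)
  rw [← pt_sub, ← pt_sub, sub_self, norm_pt0, norm_pt0, norm_pt0] at this
  exact this

lemma Dat.H_conv (D : Dat σ H Λ) {L C1 μ : ℝ} (hC1 : ∀ (θ : Θ) (x y p q : E N), ‖p‖ ≤ L → ‖q‖ ≤ L →
    |H θ x p - H θ y q| ≤ C1 * (‖x - y‖ + ‖p - q‖)) (hμ : 1 < μ) (θ : Θ) {y1 y2 y3 q1 q2 q3 e : E N}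
    (n1 : ‖q1‖ ≤ L) (n2 : ‖q2‖ ≤ L) (n3 : ‖q3‖ ≤ L) (he : μ • q2 = q1 + (μ - 1) • q3 - e) :
    μ * H θ y2 q2 - H θ y1 q1 - (μ - 1) * H θ y3 q3 ≤ C1 * (‖e‖ + μ * ‖y2 - y1‖ + (μ - 1) * ‖y3 - y1‖) := by
  have hμ0 : 0 < μ := by linarith
  set m := (1/μ) • q1 + ((μ-1)/μ) • q3 with hm
  have hsum : 1/μ + (μ-1)/μ = 1 := by field_simp; ring
  have hp : 0 ≤ (μ-1)/μ := div_nonneg (by linarith) hμ0.le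
  have hmn : ‖m‖ ≤ L := by
    calc ‖m‖ ≤ (1/μ) * ‖q1‖ + ((μ-1)/μ) * ‖q3‖ := by
          refine (norm_add_le _ _).trans ?_
          rw [norm_smul, norm_smul, Real.norm_of_nonneg (by positivity), Real.norm_of_nonneg hp]
      _ ≤ (1/μ) * L + ((μ-1)/μ) * L := by gcongr
      _ = L := by rw [← add_mul, hsum, one_mul]
  have hc := (D.conv θ y1).2 (Set.mem_univ q1) (Set.mem_univ q3) (show 0 ≤ 1/μ by positivity) hp hsum
  simp only [smul_eq_mul] at hc
  have hc' : μ * H θ y1 m ≤ H θ y1 q1 + (μ-1) * H θ y1 q3 := by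
    calc _ ≤ μ * (1/μ * H θ y1 q1 + (μ-1)/μ * H θ y1 q3) := by gcongr
      _ = _ := by field_simp
  have hd : μ • (q2 - m) = - e := by
    rw [smul_sub, he, hm, smul_add, smul_smul, smul_smul, mul_div_cancel₀ _ hμ0.ne', mul_div_cancel₀ _ hμ0.ne']
    module
  have hd' : μ * ‖q2 - m‖ = ‖e‖ := by
    have := congrArg norm hd
    rwa [norm_smul, Real.norm_of_nonneg hμ0.le, norm_neg] at this
  have a1 := (abs_le.1 (hC1 θ y2 y1 q2 m n2 hmn)).2
  have a2 := (abs_le.1 (hC1 θ y3 y1 q3 q3 n3 n3)).1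
  rw [sub_self, norm_zero, add_zero] at a2
  have a1' := mul_le_mul_of_nonneg_left a1 hμ0.le
  have a2' := mul_le_mul_of_nonneg_left a2 (show 0 ≤ μ - 1 by linarith)
  have e3 : μ * (C1 * (‖y2 - y1‖ + ‖q2 - m‖)) = C1 * (μ * ‖y2 - y1‖) + C1 * ‖e‖ := by rw [← hd']; ring
  linarith

theorem T1b (D : Dat σ H Λ) {L C1 μ : ℝ} (hL : 0 ≤ L) (hC0 : 0 ≤ C1) (hC1 : ∀ (θ : Θ) (x y p q : E N), ‖p‖ ≤ L → ‖q‖ ≤ L →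
    |H θ x p - H θ y q| ≤ C1 * (‖x - y‖ + ‖p - q‖)) (hμ : 1 < μ) {I : Set ℝ} (hI : IsOpen I)
    {u1 u2 u3 : VN N → ℝ} (n1 : Nice L u1) (n2 : Nice L u2) (n3 : Nice L u3)
    (s1 : SubJ σ H I u1) (s2 : SupJ σ H I u2) (s3 : SubJ σ H I u3) {X0 p : VN N} {B : VN N →L[ℝ] VN N}
    (hX0 : X0.snd ∈ I) (hj : UJet (fun X => u1 X - μ * u2 X + (μ - 1) * u3 X) X0 p B) {ρ : ℝ} (hρ : 0 < ρ) :
    ∃ θ, p.snd ≤ tq (σ θ X0.fst) B + C1 * ‖p.fst‖ + ρ := by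
  have hμ0 : 0 < μ := by linarith
  have hμ1 : 0 < μ - 1 := by linarith
  have hΛ := D.nn
  obtain ⟨ε, hε, hεI⟩ := Metric.isOpen_iff.1 hI _ hX0
  set K := 2 * μ * L + L + 1 with hK
  have hK0 : 0 ≤ K := by positivity
  set KT := Λ * 2 * K^2 + Λ + N * (‖B‖ * (2 * Λ)) + C1 * (1 + μ * K + (μ - 1) * K) + 1 with hKT
  have hKT0 : 0 < KT := by
    have h1 : 0 ≤ C1 * (1 + μ * K + (μ - 1) * K) := by positivity
    have h2 : 0 ≤ Λ * 2 * K^2 + Λ + N * (‖B‖ * (2 * Λ)) := by positivity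
    linarith
  set ζ := min 1 (min ε (ρ / (2 * KT))) with hζdef
  have hζ : 0 < ζ := by positivity
  have hζ1 : ζ ≤ 1 := min_le_left _ _
  have hζε : ζ ≤ ε := (min_le_right _ _).trans (min_le_left _ _)
  have hζρ : KT * ζ ≤ ρ / 2 := by
    have : ζ ≤ ρ / (2 * KT) := (min_le_right _ _).trans (min_le_right _ _)
    calc KT * ζ ≤ KT * (ρ / (2 * KT)) := by gcongr
      _ = ρ / 2 := by field_simp
  obtain ⟨M1, b1⟩ := n1.bdd
  obtain ⟨M2, b2⟩ := n2.bdd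
  obtain ⟨M3, b3⟩ := n3.bdd
  have M1n : 0 ≤ M1 := (abs_nonneg _).trans (b1 0)
  have M2n : 0 ≤ M2 := (abs_nonneg _).trans (b2 0)
  have M3n : 0 ≤ M3 := (abs_nonneg _).trans (b3 0)
  have m2n : 0 ≤ μ * M2 := by positivity
  have m3n : 0 ≤ (μ - 1) * M3 := by positivity
  obtain ⟨β, hβ, hβζ, ξ1, ξ2, ξ3, x1, x2, x3, p1, p2, p3, B1, B2, B3, j1, j2, j3, e1, e2, e3, -, ⟨nx1, nx2, nx3⟩, q2, q3, qs, hmat⟩ :=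
    sums3 (F1 := u1) (F2 := fun X => μ * (- u2 X)) (F3 := fun X => (μ - 1) * u3 X) (M := M1 + μ * M2 + (μ - 1) * M3)
    n1.cont (by have := n2.cont; fun_prop) (by have := n3.cont; fun_prop)
    (fun x => (b1 x).trans (by linarith only [m2n, m3n]))
    (fun x => by
      rw [abs_mul, abs_neg, abs_of_pos hμ0]
      have := mul_le_mul_of_nonneg_left (b2 x) hμ0.le
      linarith only [M1n, m3n, this])
    (fun x => by
      rw [abs_mul, abs_of_pos hμ1]
      have := mul_le_mul_of_nonneg_left (b3 x) hμ1.le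
      linarith only [M1n, m2n, this])
    (X0 := X0) (p := p) (B := B) (by
      refine hj.congr (Eventually.of_forall fun Y => ?_)
      simp only; ring) hζ
  have mem : ∀ x : VN N, ‖x - X0‖ < ζ → x.snd ∈ I := by
    intro x hx
    refine hεI ?_
    rw [Metric.mem_ball, Real.dist_eq]
    have : |(x - X0).snd| ≤ ‖x - X0‖ := abs_snd_le _
    exact lt_of_le_of_lt this (lt_of_lt_of_le hx hζε)
  have j2' := j2.smul (c := μ⁻¹) (by positivity)
  have j3' := j3.smul (c := (μ - 1)⁻¹) (by positivity)
  have j2'' : UJet (fun Y => - u2 Y) x2 (μ⁻¹ • p2) (μ⁻¹ • B2) := j2'.congr (Eventually.of_forall fun Y => by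
    simp only; rw [← mul_assoc, inv_mul_cancel₀ hμ0.ne', one_mul])
  have j3'' : UJet u3 x3 ((μ-1)⁻¹ • p3) ((μ-1)⁻¹ • B3) := j3'.congr (Eventually.of_forall fun Y => by
    simp only; rw [← mul_assoc, inv_mul_cancel₀ hμ1.ne', one_mul])
  obtain ⟨θ, hθ2⟩ := s2 x2 _ _ (mem x2 nx2) j2'' (ρ / (2 * μ)) (by positivity)
  have hθ1 := s1 x1 _ _ (mem x1 nx1) j1 θ
  have hθ3 := s3 x3 _ _ (mem x3 nx3) j3'' θ
  have l1 := jet_fst_le hL n1.lip j1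
  have l2 := jet_fst_le (L := L) hL (fun X d => by
    rw [neg_sub_neg, abs_sub_comm]; exact n2.lip X d) j2''
  have l3 := jet_fst_le hL n3.lip j3''
  set w2 := μ⁻¹ • p2 with hw2
  set w3 := (μ-1)⁻¹ • p3 with hw3
  have p2e : p2 = μ • w2 := by rw [hw2, smul_smul, mul_inv_cancel₀ hμ0.ne', one_smul]
  have p3e : p3 = (μ - 1) • w3 := by rw [hw3, smul_smul, mul_inv_cancel₀ hμ1.ne', one_smul]
  have fsub : ∀ a b : VN N, (a - b).fst = a.fst - b.fst := fun _ _ => rfl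
  have fadd : ∀ a b : VN N, (a + b).fst = a.fst + b.fst := fun _ _ => rfl
  have fsm : ∀ (s : ℝ) (b : VN N), (s • b).fst = s • b.fst := fun _ _ => rfl
  have ssub : ∀ a b : VN N, (a - b).snd = a.snd - b.snd := fun _ _ => rfl
  have sadd : ∀ a b : VN N, (a + b).snd = a.snd + b.snd := fun _ _ => rfl
  have ssm : ∀ (s : ℝ) (b : VN N), (s • b).snd = s * b.snd := fun _ _ => rfl
  -- distance bounds
  have dist : ∀ (x ξ w : VN N) (m : ℝ), 0 ≤ m → m ≤ μ → ‖w.fst‖ ≤ L → x - ξ = β • (m • w) → ‖m • w - β⁻¹ • (ξ - ξ1)‖ < ζ →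
      ‖x.fst - x1.fst‖ ≤ β * K := by
    intro x ξ w m hm hmμ hw hx hq
    have h1 : x - x1 = β • ((2 * m) • w - p1 - (m • w - β⁻¹ • (ξ - ξ1))) := by
      have : x - x1 = (x - ξ) + (ξ - ξ1) - (x1 - ξ1) := by abel
      rw [this, hx, e1, smul_sub, smul_sub, smul_sub (M := ℝ), smul_smul β β⁻¹, mul_inv_cancel₀ hβ.ne', one_smul]
      module
    rw [← fsub, h1, fsm, norm_smul, Real.norm_of_nonneg hβ.le]
    refine mul_le_mul_of_nonneg_left ?_ hβ.le
    rw [fsub, fsub, fsm]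
    refine (norm_sub_le _ _).trans ?_
    have g1 := norm_sub_le ((2 * m) • w.fst) p1.fst
    rw [norm_smul, Real.norm_of_nonneg (by positivity)] at g1
    have g2 := norm_fst_le (m • w - β⁻¹ • (ξ - ξ1))
    have g3 : 2 * m * ‖w.fst‖ ≤ 2 * μ * L := by gcongr
    linarith only [g1, g2, g3, l1, hq, hζ1, hK]
  have d2 := dist x2 ξ2 w2 μ hμ0.le le_rfl l2 (by rw [← p2e]; exact e2) (by rw [← p2e]; exact q2)
  have d3 := dist x3 ξ3 w3 (μ - 1) hμ1.le (by linarith only []) l3 (by rw [← p3e]; exact e3) (by rw [← p3e]; exact q3)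
  have hT := tq_sum (S1 := σ θ x1.fst) (S2 := σ θ x2.fst) (S3 := σ θ x3.fst) hmat
  have c2 := D.lip θ x1.fst x2.fst
  have c3 := D.lip θ x1.fst x3.fst
  rw [norm_sub_rev x1.fst x2.fst] at c2
  rw [norm_sub_rev x1.fst x3.fst] at c3
  have cc : β⁻¹ * (∑ k, ‖col (σ θ x1.fst) k - col (σ θ x2.fst) k‖^2 + ∑ k, ‖col (σ θ x1.fst) k - col (σ θ x3.fst) k‖^2) ≤
      Λ * 2 * K^2 * ζ := by
    calc _ ≤ β⁻¹ * (Λ * (β * K)^2 + Λ * (β * K)^2) := by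
          gcongr
          · exact c2.trans (by gcongr)
          · exact c3.trans (by gcongr)
      _ = Λ * 2 * K^2 * β := by field_simp; ring
      _ ≤ _ := by gcongr
  have cb := D.bd θ x1.fst
  have cb' : ζ * ∑ k, ‖col (σ θ x1.fst) k‖^2 ≤ Λ * ζ := by
    rw [mul_comm Λ]; exact mul_le_mul_of_nonneg_left cb hζ.le
  have cd := (abs_le.1 (D.tq_diff θ x1.fst X0.fst B)).2
  have cd' : N * (‖B‖ * (2 * Λ) * ‖x1.fst - X0.fst‖) ≤ N * (‖B‖ * (2 * Λ)) * ζ := by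
    have : ‖x1.fst - X0.fst‖ ≤ ζ := (norm_fst_le (x1 - X0)).trans nx1.le
    rw [mul_assoc (N : ℝ)]
    gcongr
  have hH := D.H_conv hC1 hμ θ (y1 := x1.fst) (y2 := x2.fst) (y3 := x3.fst) (q1 := p1.fst) (q2 := -w2.fst) (q3 := w3.fst)
    (e := (p1 + p2 + p3).fst) l1 (by rw [norm_neg]; exact l2) l3 (by
      have a2 : p2.fst = μ • w2.fst := by rw [← fsm, ← p2e]
      have a3 : p3.fst = (μ - 1) • w3.fst := by rw [← fsm, ← p3e]
      rw [fadd, fadd, a2, a3, smul_neg]; abel)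
  have he : ‖(p1 + p2 + p3).fst‖ ≤ ‖p.fst‖ + ζ := by
    have g1 := norm_fst_le (p1 + p2 + p3 - p)
    have g2 := norm_sub_norm_le (p1 + p2 + p3).fst p.fst
    rw [fsub] at g1
    linarith only [g1, g2, qs]
  have hH' : C1 * (‖(p1 + p2 + p3).fst‖ + μ * ‖x2.fst - x1.fst‖ + (μ - 1) * ‖x3.fst - x1.fst‖) ≤
      C1 * ‖p.fst‖ + C1 * (1 + μ * K + (μ - 1) * K) * ζ := by
    have h1 : ‖x2.fst - x1.fst‖ ≤ ζ * K := d2.trans (by gcongr)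
    have h2 : ‖x3.fst - x1.fst‖ ≤ ζ * K := d3.trans (by gcongr)
    calc _ ≤ C1 * ((‖p.fst‖ + ζ) + μ * (ζ * K) + (μ - 1) * (ζ * K)) := by gcongr
      _ = _ := by ring
  have ht : p.snd ≤ p1.snd + μ * w2.snd + (μ - 1) * w3.snd + ζ := by
    have g1 := (abs_le.1 (abs_snd_le (p1 + p2 + p3 - p))).1
    rw [ssub, sadd, sadd] at g1
    have a2 : p2.snd = μ * w2.snd := by rw [← ssm, ← p2e]
    have a3 : p3.snd = (μ - 1) * w3.snd := by rw [← ssm, ← p3e]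
    linarith only [g1, qs, a2, a3]
  rw [tq_smul] at hθ2 hθ3
  have hθ2' := mul_le_mul_of_nonneg_left hθ2 hμ0.le
  have hθ3' := mul_le_mul_of_nonneg_left hθ3 hμ1.le
  have r1 : μ * (-w2.snd + μ⁻¹ * tq (σ θ x2.fst) B2 + H θ x2.fst (-w2.fst) + ρ / (2 * μ)) =
     - (μ * w2.snd) + tq (σ θ x2.fst) B2 + μ * H θ x2.fst (-w2.fst) + ρ / 2 := by field_simp
  have r3 : (μ - 1) * (w3.snd - (μ-1)⁻¹ * tq (σ θ x3.fst) B3 + H θ x3.fst w3.fst) =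
     (μ - 1) * w3.snd - tq (σ θ x3.fst) B3 + (μ - 1) * H θ x3.fst w3.fst := by field_simp
  rw [r1, mul_zero] at hθ2'
  rw [r3, mul_zero] at hθ3'
  refine ⟨θ, ?_⟩
  rw [hKT] at hζρ
  linarith only [ht, hθ1, hθ2', hθ3', hT, cc, cb', cd, cd', hH, hH', hζρ]
end

section
variable {N : ℕ} {Θ : Type*} {A σ : Θ → E N → Matrix (Fin N) (Fin N) ℝ} {H : Θ → E N → E N → ℝ} {Λ : ℝ}

lemma jet_of_C2 {V : Type*} [NormedAddCommGroup V] [InnerProductSpace ℝ V] [CompleteSpace V] {W φ : V → ℝ} (hφ : ContDiff ℝ 2 φ) {X : V}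
    (hm : IsLocalMax (fun Y => W Y - φ Y) X) : ∃ (p : V) (B : V →L[ℝ] V), UJet W X p B ∧
      ∀ (d : V) (ψ' : ℝ → ℝ) (c : ℝ), (∀ s, HasDerivAt (fun s : ℝ => φ (X + s • d)) (ψ' s) s) → HasDerivAt ψ' c 0 →
        ⟪p, d⟫ = ψ' 0 ∧ ⟪B d, d⟫ = c := by
  set g : V → V := fun Y => (InnerProductSpace.toDual ℝ V).symm (fderiv ℝ φ Y) with hg
  have hd : Differentiable ℝ φ := hφ.differentiable (by norm_num)
  have h1 : ∀ Y, HasFDerivAt φ (innerSL ℝ (g Y)) Y := by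
    intro Y
    have : innerSL ℝ (g Y) = fderiv ℝ φ Y := by
      ext d
      rw [innerSL_apply_apply, hg]
      exact InnerProductSpace.toDual_symm_apply
    rw [this]; exact hd.differentiableAt.hasFDerivAt
  have h2 : DifferentiableAt ℝ g X := by
    have e : ContDiff ℝ 1 (fderiv ℝ φ) := hφ.fderiv_right (by norm_num)
    have : DifferentiableAt ℝ (fderiv ℝ φ) X := (e.differentiable (by norm_num)).differentiableAt
    exact (InnerProductSpace.toDual ℝ V).symm.toContinuousLinearEquiv.toContinuousLinearMap.differentiableAt.comp X this
  refine ⟨g X, fderiv ℝ g X, ?_, ?_⟩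
  · intro α hα
    filter_upwards [expand2 (Eventually.of_forall h1) h2.hasFDerivAt α hα, hm] with Y e1 e2
    linarith only [(abs_le.1 e1).2, e2]
  · intro d ψ' c hψ hc
    have hl : ∀ s : ℝ, HasDerivAt (fun s : ℝ => X + s • d) d s := by
      intro s
      have := ((hasDerivAt_id s).smul_const d).const_add X
      simpa using this
    have e : ∀ s, ψ' s = ⟪g (X + s • d), d⟫ := by
      intro s
      have := (h1 (X + s • d)).comp_hasDerivAt s (hl s)
      exact (hψ s).unique this
    have e0 := e 0
    rw [zero_smul, add_zero] at e0
    refine ⟨e0.symm, ?_⟩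
    have h3 : HasDerivAt (fun s : ℝ => g (X + s • d)) (fderiv ℝ g X d) 0 := by
      have h2' : HasFDerivAt g (fderiv ℝ g X) (X + (0:ℝ) • d) := by rw [zero_smul, add_zero]; exact h2.hasFDerivAt
      exact h2'.comp_hasDerivAt 0 (hl 0)
    have h4 := HasDerivAt.inner ℝ h3 (hasDerivAt_const (0:ℝ) d)
    rw [funext e] at hc
    have := hc.unique h4
    simpa using this.symm

def DI {N : ℕ} {Θ : Type*} (σ : Θ → E N → Matrix (Fin N) (Fin N) ℝ) (C1 : ℝ) (I : Set ℝ) (W : VN N → ℝ) : Prop :=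
  ∀ X p B, X.snd ∈ I → UJet W X p B → ∀ ρ > (0:ℝ), ∃ θ, p.snd ≤ tq (σ θ X.fst) B + C1 * ‖p.fst‖ + ρ

lemma DI.max {C1 : ℝ} {I : Set ℝ} {W φ : VN N → ℝ} (h : DI σ C1 I W) (hφ : ContDiff ℝ 2 φ) {X : VN N}
    (hm : IsLocalMax (fun Y => W Y - φ Y) X) (hX : X.snd ∈ I) {a b : ℝ} {a' : ℝ → ℝ} {G : E N} {ψ : E N → ℝ → ℝ} {q : E N → ℝ}
    (ha : ∀ s, HasDerivAt (fun s : ℝ => φ (X + s • pt 0 1)) (a' s) s) (ha2 : HasDerivAt a' b 0) (haa : a' 0 = a)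
    (hG : ∀ e s, HasDerivAt (fun s : ℝ => φ (X + s • pt e 0)) (ψ e s) s) (hq : ∀ e, HasDerivAt (ψ e) (q e) 0)
    (hψ : ∀ e, ψ e 0 = ⟪G, e⟫) {ρ : ℝ} (hρ : 0 < ρ) : ∃ θ, a ≤ ∑ k, q (col (σ θ X.fst) k) + C1 * ‖G‖ + ρ := by
  obtain ⟨p, B, hj, hl⟩ := jet_of_C2 hφ hm
  obtain ⟨θ, hθ⟩ := h X p B hX hj ρ hρ
  have e1 := (hl _ _ _ ha ha2).1
  rw [inner_pt, inner_zero_right, zero_add, mul_one, haa] at e1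
  have e2 : p.fst = G := by
    refine ext_inner_right ℝ fun e => ?_
    have := (hl _ _ _ (hG e) (hq e)).1
    rwa [inner_pt, mul_zero, add_zero, hψ] at this
  refine ⟨θ, ?_⟩
  rw [e1, e2] at hθ
  refine hθ.trans (le_of_eq ?_)
  congr 2
  exact Finset.sum_congr rfl fun k _ => (hl _ _ _ (hG _) (hq _)).2

lemma VN_contDiff_fst {N : ℕ} : ContDiff ℝ 2 (fun X : VN N => X.fst) :=
  contDiff_fst.comp (WithLp.prodContinuousLinearEquiv 2 ℝ (E N) ℝ).contDiff
lemma VN_contDiff_snd {N : ℕ} : ContDiff ℝ 2 (fun X : VN N => X.snd) :=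
  contDiff_snd.comp (WithLp.prodContinuousLinearEquiv 2 ℝ (E N) ℝ).contDiff

lemma per_red (x x0 : E N) : ∃ (k : Fin N → ℤ) (y : E N), y = x + (WithLp.equiv 2 (Fin N → ℝ)).symm (fun i => (k i : ℝ)) ∧
    (∀ i, x0 i ≤ y i ∧ y i ≤ x0 i + 1) := by
  refine ⟨fun i => -⌊x i - x0 i⌋, _, rfl, fun i => ?_⟩
  have e : (x + (WithLp.equiv 2 (Fin N → ℝ)).symm (fun i => ((-⌊x i - x0 i⌋ : ℤ) : ℝ)) : E N) i = x i - ⌊x i - x0 i⌋ := by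
    simp [sub_eq_add_neg]
  rw [e]
  have h1 := Int.floor_le (x i - x0 i)
  have h2 := (Int.lt_floor_add_one (x i - x0 i)).le
  constructor <;> linarith

lemma box_norm {x y : E N} (h : ∀ i, x i ≤ y i ∧ y i ≤ x i + 1) : ‖y - x‖^2 ≤ N := by
  rw [EuclideanSpace.norm_sq_eq]
  calc _ ≤ ∑ i : Fin N, (1:ℝ) := Finset.sum_le_sum fun i _ => by
        rw [Real.norm_eq_abs, sq_abs]
        have := h i
        have e : (y - x) i = y i - x i := rfl
        rw [e]; nlinarith
    _ = N := by simp

def PerX (W : VN N → ℝ) : Prop := ∀ t, ZPeriodic fun x : E N => W (pt x t)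

lemma PerX.red {W : VN N → ℝ} (h : PerX W) (x x0 : E N) : ∃ y : E N, ‖y - x0‖^2 ≤ N ∧ ∀ t, W (pt y t) = W (pt x t) := by
  obtain ⟨k, y, hy, hb⟩ := per_red x x0
  exact ⟨y, box_norm hb, fun t => by rw [hy]; exact h t x k⟩

/-- maximum over strips -/
lemma PerX.exists_max {W : VN N → ℝ} (h : PerX W) (hc : Continuous W) {a b : ℝ} (hab : a ≤ b) :
    ∃ X : VN N, X.snd ∈ Set.Icc a b ∧ ∀ Y : VN N, Y.snd ∈ Set.Icc a b → W Y ≤ W X := by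
  have hcpt : IsCompact (Metric.closedBall (0 : E N) (√N) ×ˢ Set.Icc a b) := (isCompact_closedBall _ _).prod isCompact_Icc
  obtain ⟨q, hq, hmax⟩ := hcpt.exists_isMaxOn ⟨(0, a), by simp [hab]⟩
    (f := fun q : E N × ℝ => W (pt q.1 q.2)) (hc.comp continuous_pt).continuousOn
  refine ⟨pt q.1 q.2, hq.2, fun Y hY => ?_⟩
  obtain ⟨y, hy, hy2⟩ := h.red Y.fst 0
  rw [← pt_eta Y, ← hy2]
  refine hmax (show (y, Y.snd) ∈ _ from ⟨?_, hY⟩)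
  rw [mem_closedBall_iff_norm]
  exact Real.le_sqrt_of_sq_le hy

theorem DI.comp {C1 : ℝ} {T m : ℝ} {W : VN N → ℝ} (hD : DI σ C1 (Set.Ioo 0 T) W) (hc : Continuous W) (hp : PerX W)
    (h0 : ∀ x, W (pt x 0) ≤ m) {x : E N} {t : ℝ} (ht0 : 0 ≤ t) (ht : t < T) : W (pt x t) ≤ m := by
  by_contra! hcon
  have hT : 0 ≤ T := by linarith
  obtain ⟨XM, -, hM⟩ := hp.exists_max hc hT
  set d := (W (pt x t) - m) / 2 with hd
  have hd0 : 0 < d := by linarith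
  have htop : Tendsto (fun l : ℝ => d * Real.exp (l * (T - t))) atTop atTop :=
    (Real.tendsto_exp_atTop.comp (tendsto_id.atTop_mul_const (by linarith))).const_mul_atTop hd0
  obtain ⟨l, hl1, hl2⟩ := ((htop.eventually_gt_atTop (W XM - m)).and (eventually_gt_atTop (0:ℝ))).exists
  set φ : VN N → ℝ := fun X => d * Real.exp (l * (X.snd - t)) with hφ
  have hφC : ContDiff ℝ 2 φ := contDiff_const.mul ((contDiff_const.mul (VN_contDiff_snd.sub contDiff_const)).exp)
  have hWp : PerX (fun X => W X - φ X) := fun s y k => by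
    have := hp s y k
    simp only [hφ, pt_snd] at this ⊢
    rw [this]
  obtain ⟨X, hX, hmax⟩ := hWp.exists_max (hc.sub hφC.continuous) hT
  have hv : W (pt x t) - d ≤ W X - φ X := by
    have := hmax (pt x t) ⟨ht0, ht.le⟩
    simpa [hφ] using this
  have hφ0 : 0 < φ X := by positivity
  have hX0 : 0 < X.snd := by
    rcases hX.1.eq_or_lt with h | h
    · exfalso
      have := h0 X.fst
      rw [h, pt_eta] at this
      linarith
    · exact h
  have hXT : X.snd < T := by
    rcases hX.2.eq_or_lt with h | h
    · exfalso
      have h1 : φ X > W XM - m := by simp only [hφ, h]; exact hl1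
      have := hM X hX
      linarith
    · exact h
  have hloc : IsLocalMax (fun Y => W Y - φ Y) X := by
    have : ∀ᶠ Y : VN N in 𝓝 X, Y.snd ∈ Set.Ioo 0 T :=
      VN_contDiff_snd.continuous.continuousAt.eventually (Ioo_mem_nhds hX0 hXT)
    filter_upwards [this] with Y hY
    exact hmax Y ⟨hY.1.le, hY.2.le⟩
  have hder : ∀ s, HasDerivAt (fun s : ℝ => φ (X + s • pt 0 1)) (d * (Real.exp (l * (X.snd + s - t)) * l)) s := by
    intro s
    have e : (fun s : ℝ => φ (X + s • pt 0 1)) = fun s => d * Real.exp (l * (X.snd + s - t)) := by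
      funext s; simp [hφ]
    rw [e]
    have := (((((hasDerivAt_id s).const_add X.snd).sub_const t).const_mul l).exp).const_mul d
    simpa using this
  have hder2 : HasDerivAt (fun s => d * (Real.exp (l * (X.snd + s - t)) * l)) (d * (Real.exp (l * (X.snd + 0 - t)) * l * l)) 0 := by
    have := ((((((hasDerivAt_id (0:ℝ)).const_add X.snd).sub_const t).const_mul l).exp).mul_const l).const_mul d
    simpa using this
  have hsp : ∀ (e : E N) (s : ℝ), HasDerivAt (fun s : ℝ => φ (X + s • pt e 0)) 0 s := by
    intro e s
    have e : (fun s : ℝ => φ (X + s • pt e 0)) = fun s => φ X := by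
      funext s; simp [hφ]
    rw [e]; exact hasDerivAt_const _ _
  set a := d * (Real.exp (l * (X.snd + 0 - t)) * l) with ha
  have ha0 : 0 < a := by positivity
  obtain ⟨θ, hθ⟩ := hD.max hφC hloc ⟨hX0, hXT⟩ hder hder2 ha.symm (G := 0) (ψ := fun _ _ => 0) (q := fun _ => 0) hsp
    (fun e => hasDerivAt_const _ _) (fun e => by simp) (ρ := a / 2) (by positivity)
  simp at hθ
  linarith
end

section
variable {N : ℕ} {Θ : Type*} {A σ : Θ → E N → Matrix (Fin N) (Fin N) ℝ} {H : Θ → E N → E N → ℝ} {Λ : ℝ}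

lemma nsq_line (z e : E N) (s : ℝ) : ‖z + s • e‖^2 = ‖z‖^2 + s * (2 * ⟪z, e⟫) + s^2 * ‖e‖^2 := by
  rw [norm_add_sq_real, inner_smul_right, norm_smul, mul_pow, Real.norm_eq_abs, sq_abs]; ring

lemma nsq_deriv (z e : E N) (s : ℝ) : HasDerivAt (fun s : ℝ => ‖z + s • e‖^2) (2 * ⟪z, e⟫ + 2 * s * ‖e‖^2) s := by
  have e1 : (fun s : ℝ => ‖z + s • e‖^2) = fun s => ‖z‖^2 + s * (2 * ⟪z, e⟫) + s^2 * ‖e‖^2 := by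
    funext s; exact nsq_line z e s
  rw [e1]
  have := (((hasDerivAt_id s).mul_const (2 * ⟪z, e⟫)).const_add (‖z‖^2)).add (((hasDerivAt_id s).pow 2).mul_const (‖e‖^2))
  refine this.congr_deriv ?_
  simp

lemma expb_deriv (z e : E N) (ε l s : ℝ) : HasDerivAt (fun s : ℝ => -ε * Real.exp (-l * ‖z + s • e‖^2))
    (ε * l * ((2 * ⟪z, e⟫ + 2 * s * ‖e‖^2) * Real.exp (-l * ‖z + s • e‖^2))) s := by
  refine ((((nsq_deriv z e s).const_mul (-l)).exp).const_mul (-ε)).congr_deriv ?_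
  ring

lemma expb_deriv2 (z e : E N) (ε l : ℝ) : HasDerivAt (fun s : ℝ => ε * l * ((2 * ⟪z, e⟫ + 2 * s * ‖e‖^2) * Real.exp (-l * ‖z + s • e‖^2)))
    (2 * ε * l * Real.exp (-l * ‖z‖^2) * (‖e‖^2 - 2 * l * ⟪e, z⟫^2)) 0 := by
  have h1 : HasDerivAt (fun s : ℝ => 2 * ⟪z, e⟫ + 2 * s * ‖e‖^2) (2 * ‖e‖^2) 0 := by
    have := (((hasDerivAt_id (0:ℝ)).const_mul 2).mul_const (‖e‖^2)).const_add (2 * ⟪z, e⟫)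
    simpa using this
  refine ((h1.mul (((nsq_deriv z e 0).const_mul (-l)).exp)).const_mul (ε * l)).congr_deriv ?_
  simp only [zero_smul, add_zero, mul_zero, zero_mul, real_inner_comm z e]
  ring

set_option maxHeartbeats 4000000 in
theorem strip (D : Dat σ H Λ) {C1 : ℝ} (hC1 : 0 ≤ C1) {S : Set (E N)} {x0 : E N} (hx0 : x0 ∈ S) {δ ν : ℝ} (hδ : 0 < δ) (hν : 0 < ν)
    (hell : ∀ x, (∀ y ∈ S, δ < dist x y) → ∀ θ y, ν * ‖y‖^2 ≤ ∑ k, ⟪col (σ θ x) k, y⟫^2) {ε' : ℝ} (hε' : 0 < ε') :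
    ∃ ρ' > 0, ∃ T1 > 0, ∀ (W : VN N → ℝ) (m t0 : ℝ), DI σ C1 (Set.Ioi 0) W → Continuous W → PerX W → T1 < t0 →
      (∀ x t, |t - t0| ≤ T1 → W (pt x t) ≤ m + ρ') → (∃ x, m - ρ' ≤ W (pt x t0)) →
      ∃ x t, |t - t0| ≤ T1 ∧ (∃ y ∈ S, dist x y ≤ δ) ∧ m - ε' ≤ W (pt x t) := by
  have hΛ := D.nn
  set R : ℝ := √N + 1 with hR
  have hR0 : 0 < R := by positivity
  have hRN : (N:ℝ) < R^2 := by
    rw [hR, add_sq, Real.sq_sqrt (by positivity)]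
    have := Real.sqrt_nonneg (N:ℝ)
    linarith
  set ε := ε' / 2 with hεd
  have hε : 0 < ε := by positivity
  set l := (Λ + C1 * R + 1) / (2 * ν * δ^2) with hl
  have hl0 : 0 < l := by positivity
  have hlv : 2 * l * ν * δ^2 = Λ + C1 * R + 1 := by rw [hl]; field_simp
  set gap := ε * (Real.exp (-l * N) - Real.exp (-l * R^2)) with hgap
  have hgap0 : 0 < gap := by
    refine mul_pos hε (sub_pos.2 (Real.exp_lt_exp.2 ?_))
    nlinarith
  set ρ' := min ε (gap / 4) with hρ'
  have hρ0 : 0 < ρ' := by positivity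
  have hρε : ρ' ≤ ε := min_le_left _ _
  have hρg : ρ' ≤ gap / 4 := min_le_right _ _
  set T1 := 8 / (l * Real.exp (-l * R^2)) with hT1
  have hT10 : 0 < T1 := by positivity
  refine ⟨ρ', hρ0, T1, hT10, ?_⟩
  rintro W m t0 hDI hc hp ht0 hup ⟨xh, hxh⟩
  set K := 4 * ε / T1^2 with hK
  have hK0 : 0 < K := by positivity
  have hKT : K * T1^2 = 4 * ε := by rw [hK]; field_simp
  set φ : VN N → ℝ := fun X => -ε * Real.exp (-l * ‖X.fst - x0‖^2) + K * (X.snd - t0)^2 with hφ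
  have hφC : ContDiff ℝ 2 φ := by
    refine (contDiff_const.mul ((contDiff_const.mul ((VN_contDiff_fst.sub contDiff_const).norm_sq ℝ)).exp)).add
      (contDiff_const.mul ((VN_contDiff_snd.sub contDiff_const).pow 2))
  obtain ⟨y, hy, hy2⟩ := hp.red xh x0
  have hcpt : IsCompact (Metric.closedBall x0 R ×ˢ Set.Icc (t0 - T1) (t0 + T1)) := (isCompact_closedBall _ _).prod isCompact_Icc
  have hyR : ‖y - x0‖ ≤ R := (Real.le_sqrt_of_sq_le hy).trans (by rw [hR]; linarith)
  have hymem : (y, t0) ∈ Metric.closedBall x0 R ×ˢ Set.Icc (t0 - T1) (t0 + T1) :=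
    ⟨by rw [mem_closedBall_iff_norm]; exact hyR, ⟨by linarith, by linarith⟩⟩
  obtain ⟨q, hq, hmax⟩ := hcpt.exists_isMaxOn ⟨(y, t0), hymem⟩
    (f := fun q : E N × ℝ => W (pt q.1 q.2) - φ (pt q.1 q.2)) (((hc.sub hφC.continuous).comp continuous_pt).continuousOn)
  obtain ⟨x, t⟩ := q
  have hval : W (pt y t0) - φ (pt y t0) ≤ W (pt x t) - φ (pt x t) := hmax hymem
  have hx : ‖x - x0‖ ≤ R := by have := hq.1; rwa [mem_closedBall_iff_norm] at this
  have ht : |t - t0| ≤ T1 := by have := hq.2; rw [abs_le]; constructor <;> linarith [this.1, this.2]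
  have hWx := hup x t ht
  have hlow : m - ρ' + ε * Real.exp (-l * N) ≤ W (pt y t0) - φ (pt y t0) := by
    rw [hy2]
    have : Real.exp (-l * N) ≤ Real.exp (-l * ‖y - x0‖^2) := Real.exp_le_exp.2 (by
      have := mul_le_mul_of_nonneg_left hy hl0.le
      linarith only [this])
    have := mul_le_mul_of_nonneg_left this hε.le
    simp only [hφ, pt_fst, pt_snd, sub_self]
    linarith
  have hexp1 : Real.exp (-l * ‖x - x0‖^2) ≤ 1 := Real.exp_le_one_iff.2 (by
    have := mul_nonneg hl0.le (sq_nonneg ‖x - x0‖)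
    linarith only [this])
  have hexp1' : ε * Real.exp (-l * ‖x - x0‖^2) ≤ ε := mul_le_of_le_one_right hε.le hexp1
  have hphi : φ (pt x t) = -ε * Real.exp (-l * ‖x - x0‖^2) + K * (t - t0)^2 := rfl
  have hKt : 0 ≤ K * (t - t0)^2 := by positivity
  have hexN : 0 < ε * Real.exp (-l * N) := by positivity
  refine ⟨x, t, ht, ?_, by linarith⟩
  by_contra! hfar
  -- interior
  have hxR : ‖x - x0‖ < R := by
    rcases hx.eq_or_lt with h | h
    · exfalso
      rw [h] at hphi
      rw [hgap] at hρg
      linarith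
    · exact h
  have htT : |t - t0| < T1 := by
    rcases ht.eq_or_lt with h | h
    · exfalso
      have : (t - t0)^2 = T1^2 := by rw [← sq_abs, h]
      rw [this, hKT] at hphi
      linarith
    · exact h
  have hloc : IsLocalMax (fun Y => W Y - φ Y) (pt x t) := by
    have h1 : ∀ᶠ Y : VN N in 𝓝 (pt x t), Y.fst ∈ Metric.ball x0 R :=
      VN_contDiff_fst.continuous.continuousAt.eventually (Metric.isOpen_ball.mem_nhds (by rw [mem_ball_iff_norm]; exact hxR))
    have h2 : ∀ᶠ Y : VN N in 𝓝 (pt x t), Y.snd ∈ Set.Ioo (t0 - T1) (t0 + T1) :=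
      VN_contDiff_snd.continuous.continuousAt.eventually (Ioo_mem_nhds
        (by show t0 - T1 < t; linarith only [(abs_lt.1 htT).1]) (by show t < t0 + T1; linarith only [(abs_lt.1 htT).2]))
    filter_upwards [h1, h2] with Y hY1 hY2
    exact hmax (show (Y.fst, Y.snd) ∈ _ from ⟨Metric.ball_subset_closedBall hY1, Set.Ioo_subset_Icc_self hY2⟩)
  have hder : ∀ s, HasDerivAt (fun s : ℝ => φ (pt x t + s • pt 0 1)) (2 * K * (t + s - t0)) s := by
    intro s
    have e : (fun s : ℝ => φ (pt x t + s • pt 0 1)) = fun s => -ε * Real.exp (-l * ‖x - x0‖^2) + K * (t + s - t0)^2 := by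
      funext s
      simp only [hφ]
      rw [← pt_smul, ← pt_add]
      simp only [pt_fst, pt_snd, smul_zero, add_zero, mul_one]
    rw [e]
    refine ((((((hasDerivAt_id s).const_add t).sub_const t0).pow 2).const_mul K).const_add _).congr_deriv ?_
    simp; ring
  have hder2 : HasDerivAt (fun s => 2 * K * (t + s - t0)) (2 * K) 0 := by
    have := (((hasDerivAt_id (0:ℝ)).const_add t).sub_const t0).const_mul (2 * K)
    simpa using this
  set z := x - x0 with hz
  have hsp : ∀ (e : E N) (s : ℝ), HasDerivAt (fun s : ℝ => φ (pt x t + s • pt e 0))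
      (ε * l * ((2 * ⟪z, e⟫ + 2 * s * ‖e‖^2) * Real.exp (-l * ‖z + s • e‖^2))) s := by
    intro e s
    have e1 : (fun s : ℝ => φ (pt x t + s • pt e 0)) = fun s => -ε * Real.exp (-l * ‖z + s • e‖^2) + K * (t - t0)^2 := by
      funext s
      simp only [hφ, hz]
      rw [← pt_smul, ← pt_add]
      simp only [pt_fst, pt_snd, mul_zero, add_zero]
      rw [add_sub_right_comm]
    rw [e1]
    exact (expb_deriv z e ε l s).add_const _
  set Ex := Real.exp (-l * ‖z‖^2) with hEx
  have hEx0 : 0 < Ex := Real.exp_pos _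
  have hExR : Real.exp (-l * R^2) ≤ Ex := Real.exp_le_exp.2 (by
    have : ‖z‖^2 ≤ R^2 := by gcongr
    have := mul_le_mul_of_nonneg_left this hl0.le
    linarith only [this])
  set η := ε * l * Ex with hη
  have hη0 : 0 < η := by positivity
  obtain ⟨θ, hθ⟩ := hDI.max hφC hloc (show (pt x t).snd ∈ Set.Ioi 0 by
    rw [pt_snd, Set.mem_Ioi]; linarith [(abs_lt.1 htT).1]) hder hder2 rfl (G := (2 * η) • z) hsp
    (fun e => expb_deriv2 z e ε l) (fun e => by
      simp only [inner_smul_left, zero_smul, add_zero, hη, hEx]; simp; ring) (ρ := η / 2) (by positivity)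
  have hzδ : δ < ‖z‖ := by
    have := hfar x0 hx0
    rwa [dist_eq_norm] at this
  have hell' := hell x hfar θ z
  have hbd := D.bd θ x
  rw [norm_smul, Real.norm_of_nonneg (by positivity), pt_fst, ← Finset.mul_sum, Finset.sum_sub_distrib, ← Finset.mul_sum] at hθ
  have k1 : ν * δ^2 ≤ ν * ‖z‖^2 := by gcongr
  have k2 : (∑ k, ‖col (σ θ x) k‖^2 - 2 * l * ∑ k, ⟪col (σ θ x) k, z⟫^2) + C1 * ‖z‖ ≤ -1 := by
    have h1 : 2 * l * (ν * δ^2) ≤ 2 * l * ∑ k, ⟪col (σ θ x) k, z⟫^2 := by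
      refine mul_le_mul_of_nonneg_left (k1.trans hell') (by positivity)
    have h2 : C1 * ‖z‖ ≤ C1 * R := by gcongr
    linarith
  have k3 := mul_le_mul_of_nonneg_left k2 (show 0 ≤ 2 * η by positivity)
  have k4 : 2 * K * (t + 0 - t0) ≤ - 2 * η + η / 2 := by
    refine hθ.trans ?_
    rw [hη] at k3 ⊢
    linarith only [k3]
  have k5 : - (2 * K * T1) ≤ 2 * K * (t + 0 - t0) := by
    have := (abs_le.1 ht).1
    have := mul_le_mul_of_nonneg_left this (show 0 ≤ 2 * K by positivity)
    linarith only [this]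
  have k6 : 2 * K * T1 = ε * (l * Real.exp (-l * R^2)) := by
    rw [hK, hT1]; field_simp; norm_num
  have k7 : ε * (l * Real.exp (-l * R^2)) ≤ η := by
    rw [hη, mul_assoc]; gcongr
  linarith only [k4, k5, k6, k7, hη0]
end

section
variable {N : ℕ} {Θ : Type*} {A σ : Θ → E N → Matrix (Fin N) (Fin N) ℝ} {H : Θ → E N → E N → ℝ} {Λ : ℝ}

lemma hb_deriv (z e : E N) (h c s : ℝ) : HasDerivAt (fun s : ℝ => -c * (h - ‖z + s • e‖^2)^2)
    (2 * c * ((h - ‖z + s • e‖^2) * (2 * ⟪z, e⟫ + 2 * s * ‖e‖^2))) s := by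
  refine ((((nsq_deriv z e s).const_sub h).pow 2).const_mul (-c)).congr_deriv ?_
  simp; ring

lemma hb_deriv2 (z e : E N) (h c : ℝ) : HasDerivAt (fun s : ℝ => 2 * c * ((h - ‖z + s • e‖^2) * (2 * ⟪z, e⟫ + 2 * s * ‖e‖^2)))
    (2 * c * (2 * (h - ‖z‖^2) * ‖e‖^2 - 4 * ⟪e, z⟫^2)) 0 := by
  have h1 : HasDerivAt (fun s : ℝ => 2 * ⟪z, e⟫ + 2 * s * ‖e‖^2) (2 * ‖e‖^2) 0 := by
    have := (((hasDerivAt_id (0:ℝ)).const_mul 2).mul_const (‖e‖^2)).const_add (2 * ⟪z, e⟫)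
    simpa using this
  refine ((((nsq_deriv z e 0).const_sub h).mul h1).const_mul (2 * c)).congr_deriv ?_
  simp only [zero_smul, add_zero, mul_zero, zero_mul, real_inner_comm z e]
  ring

lemma growth_smooth (m ρ a K t0 r β l : ℝ) (x0 : E N) : ContDiff ℝ 2 (fun X : VN N => m + ρ + -(a * Real.exp (-K * (X.snd - t0))) * (r^2 + β * (X.snd - t0) - ‖X.fst - x0‖^2)^2
    + ρ * Real.exp (l * (X.snd - t0 - 1))) := by
  have hs : ContDiff ℝ 2 (fun X : VN N => X.snd - t0) := VN_contDiff_snd.sub contDiff_const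
  have hf : ContDiff ℝ 2 (fun X : VN N => ‖X.fst - x0‖^2) := (VN_contDiff_fst.sub contDiff_const).norm_sq ℝ
  have h1 : ContDiff ℝ 2 (fun X : VN N => Real.exp (-K * (X.snd - t0))) := (contDiff_const.mul hs).exp
  have h2 : ContDiff ℝ 2 (fun X : VN N => Real.exp (l * (X.snd - t0 - 1))) := (contDiff_const.mul (hs.sub contDiff_const)).exp
  have h3 : ContDiff ℝ 2 (fun X : VN N => r^2 + β * (X.snd - t0) - ‖X.fst - x0‖^2) := (contDiff_const.add (contDiff_const.mul hs)).sub hf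
  exact (contDiff_const.add ((contDiff_const.mul h1).neg.mul (h3.pow 2))).add (contDiff_const.mul h2)

lemma growth_d (m ρ a K t0 β l t h s : ℝ) : HasDerivAt (fun s => m + ρ + -(a * Real.exp (-K * (t + s - t0))) * (h + β * s)^2
      + ρ * Real.exp (l * (t + s - t0 - 1))) ((a * K * Real.exp (-K * (t + s - t0))) * (h + β * s)^2
      - 2 * a * β * Real.exp (-K * (t + s - t0)) * (h + β * s) + ρ * l * Real.exp (l * (t + s - t0 - 1))) s := by
  have d1 : HasDerivAt (fun s : ℝ => t + s - t0) 1 s := ((hasDerivAt_id s).const_add t).sub_const t0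
  have d2 : HasDerivAt (fun s : ℝ => h + β * s) (β * 1) s := ((hasDerivAt_id s).const_mul β).const_add h
  refine ((((((d1.const_mul (-K)).exp).const_mul a).neg.mul (d2.pow 2)).const_add (m + ρ)).add
    (((d1.sub_const 1).const_mul l).exp.const_mul ρ)).congr_deriv ?_
  simp; ring

set_option maxHeartbeats 4000000 in
theorem growth (D : Dat σ H Λ) {C1 : ℝ} (hC1 : 0 ≤ C1) {ν : ℝ} (hν : 0 < ν)
    (hell : ∀ x θ y, ν * ‖y‖^2 ≤ ∑ k, ⟪col (σ θ x) k, y⟫^2) {r d : ℝ} (hr : 0 < r) (hd : 0 < d) :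
    ∃ ρ > 0, ∀ (W : VN N → ℝ) (m t0 : ℝ) (x0 : E N), DI σ C1 (Set.Ioi 0) W → Continuous W → PerX W → 0 < t0 →
      (∀ x t, t0 ≤ t → W (pt x t) ≤ m + ρ) → (∀ x, ‖x - x0‖ ≤ r → W (pt x t0) ≤ m - d) →
      ∀ x, W (pt x (t0 + 1)) ≤ m - ρ := by
  have hΛ := D.nn
  set β : ℝ := N + 1 with hβ
  have hβ0 : 0 < β := by positivity
  set R : ℝ := √(r^2 + 2 * β) with hR
  have hR0 : 0 ≤ R := Real.sqrt_nonneg _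
  have hR2 : R^2 = r^2 + 2 * β := Real.sq_sqrt (by positivity)
  set B := 2 * β + 4 * Λ + 4 * C1 * R + 8 * ν with hB
  have hB0 : 0 < B := by positivity
  set K := B^2 / (16 * ν * r^2) with hK
  have hK0 : 0 < K := by positivity
  have hKB : K * (16 * ν * r^2) = B^2 := by rw [hK]; field_simp
  set a := d / r^4 with ha
  have ha0 : 0 < a := by positivity
  have har : a * (r^2)^2 = d := by rw [ha]; field_simp
  set ρ := a * Real.exp (-K) / 4 with hρ
  have hρ0 : 0 < ρ := by positivity
  refine ⟨ρ, hρ0, ?_⟩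
  intro W m t0 x0 hDI hc hp ht0 hup hlow x
  set l := a * (R^2)^2 / ρ with hl
  have hl0 : 0 ≤ l := by positivity
  have hlρ : a * (R^2)^2 ≤ ρ * Real.exp l := by
    have h1 : l ≤ Real.exp l := by linarith only [Real.add_one_le_exp l]
    have h2 := mul_le_mul_of_nonneg_left h1 hρ0.le
    rwa [hl, mul_div_cancel₀ _ hρ0.ne', ← hl] at h2
  set φ : VN N → ℝ := fun X => m + ρ + -(a * Real.exp (-K * (X.snd - t0))) * (r^2 + β * (X.snd - t0) - ‖X.fst - x0‖^2)^2
    + ρ * Real.exp (l * (X.snd - t0 - 1)) with hφ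
  have hφv : ∀ y t, φ (pt y t) = m + ρ + -(a * Real.exp (-K * (t - t0))) * (r^2 + β * (t - t0) - ‖y - x0‖^2)^2
    + ρ * Real.exp (l * (t - t0 - 1)) := fun _ _ => rfl
  have hφC : ContDiff ℝ 2 φ := by
    exact growth_smooth m ρ a K t0 r β l x0
  -- region
  set S : Set (E N × ℝ) := {q | q.2 ∈ Set.Icc t0 (t0 + 2) ∧ 0 ≤ r^2 + β * (q.2 - t0) - ‖q.1 - x0‖^2} with hS
  have hScl : IsClosed S := by
    have h1 : IsClosed {q : E N × ℝ | 0 ≤ r^2 + β * (q.2 - t0) - ‖q.1 - x0‖^2} :=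
      isClosed_le continuous_const (by fun_prop)
    exact (isClosed_Icc.preimage continuous_snd).inter h1
  have hScpt : IsCompact S := by
    refine ((isCompact_closedBall x0 R).prod (isCompact_Icc (a := t0) (b := t0 + 2))).of_isClosed_subset hScl ?_
    rintro ⟨y, t⟩ ⟨h1, h2⟩
    refine ⟨?_, h1⟩
    rw [mem_closedBall_iff_norm]
    refine Real.le_sqrt_of_sq_le ?_
    have h3 : β * (t - t0) ≤ β * 2 := mul_le_mul_of_nonneg_left (by linarith only [h1.2]) hβ0.le
    simp only at h2 ⊢
    linarith only [h2, h3]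
  have key : ∀ q ∈ S, W (pt q.1 q.2) ≤ φ (pt q.1 q.2) := by
    by_contra! hcon
    obtain ⟨q0, hq0, hq0W⟩ := hcon
    obtain ⟨q, hq, hmax⟩ := hScpt.exists_isMaxOn ⟨q0, hq0⟩
      (f := fun q : E N × ℝ => W (pt q.1 q.2) - φ (pt q.1 q.2)) (((hc.sub hφC.continuous).comp continuous_pt).continuousOn)
    obtain ⟨y, t⟩ := q
    have hpos : 0 < W (pt y t) - φ (pt y t) := by
      have : W (pt q0.1 q0.2) - φ (pt q0.1 q0.2) ≤ W (pt y t) - φ (pt y t) := hmax hq0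
      linarith only [this, hq0W]
    obtain ⟨⟨htl, htr⟩, hh⟩ := hq
    simp only at htl htr hh
    have hWm := hup y t htl
    have hφ2 := hφv y t
    have hE2 : 0 < ρ * Real.exp (l * (t - t0 - 1)) := by positivity
    set z := y - x0 with hz
    set h := r^2 + β * (t - t0) - ‖z‖^2 with hhd
    have hzR : ‖z‖ ≤ R := by
      refine Real.le_sqrt_of_sq_le ?_
      have h3 : β * (t - t0) ≤ β * 2 := mul_le_mul_of_nonneg_left (by linarith only [htr]) hβ0.le
      linarith only [hh, h3, hhd]
    have hh0 : 0 < h := by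
      rcases hh.eq_or_lt with h' | h'
      · exfalso
        rw [← h'] at hφ2
        linarith only [hφ2, hE2, hWm, hpos]
      · exact h'
    have htl' : t0 < t := by
      rcases htl.eq_or_lt with h' | h'
      · exfalso
        have e1 : h = r^2 - ‖z‖^2 := by rw [hhd, ← h']; ring
        have e2 : ‖z‖ ≤ r := by
          refine (pow_le_pow_iff_left₀ (norm_nonneg _) hr.le two_ne_zero).1 ?_
          linarith only [e1, hh0]
        have e3 := hlow y e2
        rw [h'] at e3
        have e4 : h^2 ≤ (r^2)^2 := by
          refine pow_le_pow_left₀ hh0.le ?_ 2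
          rw [e1]; linarith only [sq_nonneg ‖z‖]
        have e5 := mul_le_mul_of_nonneg_left e4 ha0.le
        have e6 : Real.exp (-K * (t - t0)) = 1 := by rw [h']; simp
        rw [e6] at hφ2
        linarith only [hφ2, e5, e3, hpos, hE2, hρ0, har]
      · exact h'
    have htr' : t < t0 + 2 := by
      rcases htr.eq_or_lt with h' | h'
      · exfalso
        have e4 : h^2 ≤ (R^2)^2 := by
          refine pow_le_pow_left₀ hh0.le ?_ 2
          rw [hR2, hhd, h']; linarith only [sq_nonneg ‖z‖]
        have e6 : Real.exp (-K * (t - t0)) ≤ 1 := Real.exp_le_one_iff.2 (by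
          have := mul_pos hK0 (sub_pos.2 htl')
          linarith only [this])
        have e5 : a * Real.exp (-K * (t - t0)) * h^2 ≤ a * 1 * (R^2)^2 := by gcongr
        have e7 : l * (t - t0 - 1) = l := by rw [h']; ring
        rw [e7] at hφ2
        linarith only [hφ2, hWm, e5, hpos, hlρ]
      · exact h'
    have hloc : IsLocalMax (fun Y => W Y - φ Y) (pt y t) := by
      have h1 : ∀ᶠ Y : VN N in 𝓝 (pt y t), Y.snd ∈ Set.Ioo t0 (t0 + 2) :=
        VN_contDiff_snd.continuous.continuousAt.eventually (Ioo_mem_nhds htl' htr')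
      have hco : Continuous (fun Y : VN N => r^2 + β * (Y.snd - t0) - ‖Y.fst - x0‖^2) := by
        have := (VN_contDiff_snd (N := N)).continuous
        have := (VN_contDiff_fst (N := N)).continuous
        fun_prop
      have h2 : ∀ᶠ Y : VN N in 𝓝 (pt y t), 0 < r^2 + β * (Y.snd - t0) - ‖Y.fst - x0‖^2 :=
        hco.continuousAt.eventually (lt_mem_nhds (show 0 < r^2 + β * ((pt y t).snd - t0) - ‖(pt y t).fst - x0‖^2 from hh0))
      filter_upwards [h1, h2] with Y hY1 hY2
      exact hmax (show (Y.fst, Y.snd) ∈ S from ⟨Set.Ioo_subset_Icc_self hY1, hY2.le⟩)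
    set a' : ℝ → ℝ := fun s => (a * K * Real.exp (-K * (t + s - t0))) * (h + β * s)^2
      - 2 * a * β * Real.exp (-K * (t + s - t0)) * (h + β * s) + ρ * l * Real.exp (l * (t + s - t0 - 1)) with ha'
    have hder : ∀ s, HasDerivAt (fun s : ℝ => φ (pt y t + s • pt 0 1)) (a' s) s := by
      intro s
      have e : (fun s : ℝ => φ (pt y t + s • pt 0 1)) = fun s => m + ρ + -(a * Real.exp (-K * (t + s - t0))) * (h + β * s)^2
          + ρ * Real.exp (l * (t + s - t0 - 1)) := by
        funext s
        rw [← pt_smul, ← pt_add, hφv]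
        simp only [smul_zero, add_zero, mul_one]
        have e2 : r^2 + β * (t + s - t0) - ‖y - x0‖^2 = h + β * s := by rw [hhd, hz]; ring
        rw [e2]
      rw [e]
      exact growth_d m ρ a K t0 β l t h s
    have hder2 : HasDerivAt a' (deriv a' 0) 0 := by
      refine DifferentiableAt.hasDerivAt ?_
      rw [ha']; fun_prop
    set Ex := a * Real.exp (-K * (t - t0)) with hEx
    have hEx0 : 0 < Ex := by positivity
    have hsp : ∀ (e : E N) (s : ℝ), HasDerivAt (fun s : ℝ => φ (pt y t + s • pt e 0))
        (2 * Ex * ((r^2 + β * (t - t0) - ‖z + s • e‖^2) * (2 * ⟪z, e⟫ + 2 * s * ‖e‖^2))) s := by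
      intro e s
      have e1 : (fun s : ℝ => φ (pt y t + s • pt e 0)) = fun s => m + ρ + -Ex * (r^2 + β * (t - t0) - ‖z + s • e‖^2)^2
          + ρ * Real.exp (l * (t - t0 - 1)) := by
        funext s
        rw [← pt_smul, ← pt_add, hφv]
        simp only [mul_zero, add_zero]
        have e2 : y + s • e - x0 = z + s • e := by rw [hz]; abel
        rw [e2]
      rw [e1]
      exact ((hb_deriv z e _ Ex s).const_add _).add_const _
    obtain ⟨θ, hθ⟩ := hDI.max hφC hloc (show (pt y t).snd ∈ Set.Ioi 0 from ht0.trans htl') hder hder2 rfl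
      (G := (4 * Ex * h) • z) hsp (fun e => hb_deriv2 z e _ Ex) (fun e => by
        simp only [inner_smul_left, zero_smul, add_zero, hhd]; simp; ring) (ρ := 2 * ν * r^2 * Ex) (by positivity)
    have hell' := hell y θ z
    have hbd := D.bd θ y
    rw [norm_smul, Real.norm_of_nonneg (by positivity), pt_fst, ← Finset.mul_sum, Finset.sum_sub_distrib, ← Finset.mul_sum, ← Finset.mul_sum] at hθ
    have ea : Ex * (K * h^2 - 2 * β * h) ≤ a' 0 := by
      have : 0 ≤ ρ * l * Real.exp (l * (t + 0 - t0 - 1)) := by positivity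
      simp only [ha', mul_zero, add_zero] at this ⊢
      rw [hEx]
      linarith only [this]
    rw [← hhd] at hθ
    have hb1 : h * ∑ k, ‖col (σ θ y) k‖^2 ≤ h * Λ := mul_le_mul_of_nonneg_left hbd hh0.le
    have hb2 : h * (C1 * ‖z‖) ≤ h * (C1 * R) := by gcongr
    have hb3 : ν * (r^2 - h) ≤ ν * ‖z‖^2 := by
      refine mul_le_mul_of_nonneg_left ?_ hν.le
      have := mul_pos hβ0 (sub_pos.2 htl')
      linarith only [this, hhd]
    have fin1 : Ex * (K * h^2 - 2 * β * h) ≤ Ex * (4 * (h * Λ) - 8 * (ν * (r^2 - h)) + 4 * (h * (C1 * R)) + 2 * ν * r^2) := by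
      refine (ea.trans hθ).trans ?_
      have : Ex * (4 * (h * ∑ k, ‖col (σ θ y) k‖^2) - 8 * ∑ k, ⟪col (σ θ y) k, z⟫^2 + 4 * (h * (C1 * ‖z‖)) + 2 * ν * r^2) ≤ Ex * (4 * (h * Λ) - 8 * (ν * (r^2 - h)) + 4 * (h * (C1 * R)) + 2 * ν * r^2) := by
        refine mul_le_mul_of_nonneg_left ?_ hEx0.le
        linarith only [hb1, hb2, hb3, hell']
      refine le_trans (le_of_eq ?_) this
      ring
    have fin2 := le_of_mul_le_mul_left fin1 hEx0
    have fin3 : K * h^2 - B * h + 6 * (ν * r^2) ≤ 0 := by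
      rw [hB]; linarith only [fin2]
    have hvr : 0 < ν * r^2 := by positivity
    have fin4 : (B * h - 8 * (ν * r^2))^2 ≤ - 32 * (ν * r^2)^2 := by
      have e1 : (B * h - 8 * (ν * r^2))^2 + 32 * (ν * r^2)^2 = 16 * (ν * r^2) * (K * h^2 - B * h + 6 * (ν * r^2)) := by
        have : B^2 * h^2 = K * (16 * ν * r^2) * h^2 := by rw [hKB]
        linear_combination this
      have e2 := mul_le_mul_of_nonneg_left fin3 (show 0 ≤ 16 * (ν * r^2) by positivity)
      linarith only [e1, e2]
    have fin5 := sq_nonneg (B * h - 8 * (ν * r^2))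
    have fin6 : 0 < (ν * r^2)^2 := by positivity
    linarith only [fin4, fin5, fin6]
  obtain ⟨y, hy, hy2⟩ := hp.red x x0
  rw [← hy2]
  have hmem : 1 ≤ r^2 + β * (t0 + 1 - t0) - ‖y - x0‖^2 := by
    have : 0 < r^2 := by positivity
    rw [hβ]; linarith only [this, hy]
  have n1 : t0 ≤ t0 + 1 := le_add_of_nonneg_right zero_le_one
  have n2 : t0 + 1 ≤ t0 + 2 := add_le_add_right one_le_two t0
  have n3 := zero_le_one.trans hmem
  have n4 : (y, t0 + 1) ∈ S := ⟨⟨n1, n2⟩, n3⟩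
  have : W (pt y (t0 + 1)) ≤ φ (pt y (t0 + 1)) := key (y, t0 + 1) n4
  refine this.trans ?_
  rw [hφv]
  have e1 : 1 ≤ (r^2 + β * (t0 + 1 - t0) - ‖y - x0‖^2)^2 := one_le_pow₀ hmem
  have e2 : a * Real.exp (-K * (t0 + 1 - t0)) = 4 * ρ := by
    rw [hρ]; ring_nf
  have e3 : l * (t0 + 1 - t0 - 1) = 0 := by ring
  rw [e2, e3, Real.exp_zero]
  have e4 := mul_le_mul_of_nonneg_left e1 hρ0.le
  linarith only [e4, hρ0]
end

section
variable {N : ℕ} {Θ : Type*} {A σ : Θ → E N → Matrix (Fin N) (Fin N) ℝ} {H : Θ → E N → E N → ℝ} {Λ L C1 : ℝ}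

structure Sol (σ : Θ → E N → Matrix (Fin N) (Fin N) ℝ) (H : Θ → E N → E N → ℝ) (L : ℝ) (U : VN N → ℝ) : Prop where
  cont : Continuous U
  lip : ∀ X (d : E N), |U (X + pt d 0) - U X| ≤ L * ‖d‖
  per : PerX U
  sub : SubJ σ H (Set.Ioi 0) U
  sup : SupJ σ H (Set.Ioi 0) U

def tcl (T : ℝ) (U : VN N → ℝ) : VN N → ℝ := fun X => U (pt X.fst (max 0 (min X.snd T)))

lemma tcl_cont (T : ℝ) : Continuous (fun X : VN N => pt X.fst (max 0 (min X.snd T))) := by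
  have h1 := (VN_contDiff_snd (N := N)).continuous
  have h2 := (VN_contDiff_fst (N := N)).continuous
  exact continuous_pt.comp (h2.prodMk (continuous_const.max (h1.min continuous_const)))

lemma tcl_eq {T : ℝ} (U : VN N → ℝ) {X : VN N} (h0 : 0 < X.snd) (hT : X.snd < T) : tcl T U =ᶠ[𝓝 X] U := by
  have h1 : ∀ᶠ Y : VN N in 𝓝 X, Y.snd ∈ Set.Ioo 0 T :=
    VN_contDiff_snd.continuous.continuousAt.eventually (Ioo_mem_nhds h0 hT)
  filter_upwards [h1] with Y hY
  unfold tcl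
  rw [min_eq_left hY.2.le, max_eq_right hY.1.le, pt_eta]

lemma Sol.nice {U : VN N → ℝ} (h : Sol σ H L U) {T : ℝ} (hT : 0 ≤ T) : Nice L (tcl T U) := by
  refine ⟨h.cont.comp (tcl_cont T), ?_, fun X d => ?_⟩
  · obtain ⟨X1, -, h1⟩ := h.per.exists_max h.cont hT
    obtain ⟨X2, -, h2⟩ := PerX.exists_max (W := fun X => - U X) (fun t x k => by
      have := h.per t x k
      simp only at this ⊢
      rw [this]) h.cont.neg hT
    refine ⟨max (U X1) (- U X2), fun X => abs_le.2 ?_⟩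
    have hm : (pt X.fst (max 0 (min X.snd T))).snd ∈ Set.Icc 0 T := ⟨le_max_left _ _, max_le hT (min_le_right _ _)⟩
    have e1 := h1 _ hm
    have e2 := h2 _ hm
    unfold tcl
    constructor
    · linarith only [e2, le_max_right (U X1) (- U X2)]
    · linarith only [e1, le_max_left (U X1) (- U X2)]
  · have := h.lip (pt X.fst (max 0 (min X.snd T))) d
    have e : pt X.fst (max 0 (min X.snd T)) + pt d 0 = pt (X + pt d 0).fst (max 0 (min (X + pt d 0).snd T)) := by
      rw [← pt_add, add_zero]
      simp
    rw [e] at this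
    exact this

lemma Sol.DI (D : Dat σ H Λ) (hL : 0 ≤ L) (hC0 : 0 ≤ C1) (hC1 : ∀ (θ : Θ) (x y p q : E N), ‖p‖ ≤ L → ‖q‖ ≤ L →
    |H θ x p - H θ y q| ≤ C1 * (‖x - y‖ + ‖p - q‖)) {μ : ℝ} (hμ : 1 < μ) {u1 u2 u3 : VN N → ℝ}
    (n1 : Sol σ H L u1) (n2 : Sol σ H L u2) (n3 : Sol σ H L u3) : DI σ C1 (Set.Ioi 0) (fun X => u1 X - μ * u2 X + (μ - 1) * u3 X) := by
  intro X p B hX hj ρ hρ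
  set T := X.snd + 1 with hT
  have hX' : 0 < X.snd := hX
  have hT0 : 0 ≤ T := by linarith
  have hs : ∀ {u}, Sol σ H L u → SubJ σ H (Set.Ioo 0 T) (tcl T u) := fun {u} h Y p B hY hj =>
    h.sub Y p B hY.1 (hj.congr (tcl_eq u hY.1 hY.2))
  have hS : ∀ {u}, Sol σ H L u → SupJ σ H (Set.Ioo 0 T) (tcl T u) := fun {u} h Y p B hY hj =>
    h.sup Y p B hY.1 (hj.congr ((tcl_eq u hY.1 hY.2).neg))
  have hXT : X.snd < T := by linarith
  refine T1b D hL hC0 hC1 hμ isOpen_Ioo (n1.nice hT0) (n2.nice hT0) (n3.nice hT0) (hs n1) (hS n2) (hs n3) ⟨hX', hXT⟩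
    (hj.congr ?_) hρ
  filter_upwards [tcl_eq u1 hX' hXT, tcl_eq u2 hX' hXT, tcl_eq u3 hX' hXT] with Y h1 h2 h3
  rw [h1, h2, h3]

lemma UJet.shift {f : VN N → ℝ} {X p : VN N} {B : VN N →L[ℝ] VN N} {τ : ℝ} (hj : UJet (fun X => f (pt X.fst (X.snd + τ))) X p B) :
    UJet f (X + pt 0 τ) p B := by
  have e : ∀ Y : VN N, Y + pt 0 τ = pt Y.fst (Y.snd + τ) := fun Y => by
    rw [← pt_eta Y, ← pt_add, add_zero]; simp
  refine UJet.transfer (κ := 0) hj (fun Y => ?_) ?_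
  · rw [e, add_zero]
  · rw [e, add_zero]

lemma Sol.shift {U : VN N → ℝ} (h : Sol σ H L U) {τ : ℝ} (hτ : 0 ≤ τ) : Sol σ H L (fun X => U (pt X.fst (X.snd + τ))) := by
  have h1 := (VN_contDiff_snd (N := N)).continuous
  have h2 := (VN_contDiff_fst (N := N)).continuous
  refine ⟨h.cont.comp (continuous_pt.comp (h2.prodMk (h1.add continuous_const))), fun X d => ?_, fun t x k => ?_, ?_, ?_⟩
  · have := h.lip (pt X.fst (X.snd + τ)) d
    have e : pt X.fst (X.snd + τ) + pt d 0 = pt (X + pt d 0).fst ((X + pt d 0).snd + τ) := by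
      rw [← pt_add, add_zero]
      simp
    rw [e] at this
    exact this
  · exact h.per (t + τ) x k
  · intro X p B hX hj
    have hX' : 0 < X.snd := hX
    have e := h.sub (X + pt 0 τ) p B (by rw [Set.mem_Ioi]; simp; linarith) hj.shift
    have e2 : (X + pt 0 τ).fst = X.fst := by simp
    rwa [e2] at e
  · intro X p B hX hj
    have hX' : 0 < X.snd := hX
    have e := h.sup (X + pt 0 τ) p B (by rw [Set.mem_Ioi]; simp; linarith) (UJet.shift (f := fun Y => - U Y) hj)
    have e2 : (X + pt 0 τ).fst = X.fst := by simp
    rwa [e2] at e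

lemma Sol.addc {U : VN N → ℝ} (h : Sol σ H L U) (k : ℝ) : Sol σ H L (fun X => U X + k) := by
  refine ⟨h.cont.add continuous_const, fun X d => ?_, fun t x j => ?_, ?_, ?_⟩
  · have := h.lip X d
    rwa [add_sub_add_right_eq_sub]
  · have := h.per t x j
    simp only at this ⊢
    rw [this]
  · intro X p B hX hj
    have := UJet.transfer (f := U) (s := 0) (κ := k) hj (fun Y => by rw [add_zero]) (by rw [add_zero])
    rw [add_zero] at this
    exact h.sub X p B hX this
  · intro X p B hX hj
    have := UJet.transfer (f := fun Y => - U Y) (s := 0) (κ := -k) hj (fun Y => by rw [add_zero]; linarith) (by rw [add_zero]; linarith)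
    rw [add_zero] at this
    exact h.sup X p B hX this

lemma PerX.comb {u1 u2 u3 : VN N → ℝ} (h1 : PerX u1) (h2 : PerX u2) (h3 : PerX u3) (a b c : ℝ) :
    PerX (fun X => a * u1 X + b * u2 X + c * u3 X) := fun t x k => by
  have e1 := h1 t x k
  have e2 := h2 t x k
  have e3 := h3 t x k
  simp only at e1 e2 e3 ⊢
  rw [e1, e2, e3]

lemma Sol.DI2 (D : Dat σ H Λ) (hL : 0 ≤ L) (hC0 : 0 ≤ C1) (hC1 : ∀ (θ : Θ) (x y p q : E N), ‖p‖ ≤ L → ‖q‖ ≤ L →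
    |H θ x p - H θ y q| ≤ C1 * (‖x - y‖ + ‖p - q‖)) {u1 u2 : VN N → ℝ}
    (n1 : Sol σ H L u1) (n2 : Sol σ H L u2) : LargeTimeBehavior.DI σ C1 (Set.Ioi 0) (fun X => 2 * (u1 X - u2 X)) := by
  have := n1.DI D hL hC0 hC1 (μ := 2) (by norm_num) n2 n1
  have e : (fun X => u1 X - 2 * u2 X + (2 - 1) * u1 X) = fun X => 2 * (u1 X - u2 X) := by funext X; ring
  rwa [e] at this

lemma Sol.per2 {u1 u2 : VN N → ℝ} (n1 : Sol σ H L u1) (n2 : Sol σ H L u2) : PerX (fun X => 2 * (u1 X - u2 X)) := by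
  have := n1.per.comb n2.per n2.per 2 (-2) 0
  have e : (fun X => 2 * u1 X + (-2) * u2 X + 0 * u2 X) = fun X => 2 * (u1 X - u2 X) := by funext X; ring
  rwa [e] at this

/-- comparison -/
lemma Sol.comp (D : Dat σ H Λ) (hL : 0 ≤ L) {u1 u2 : VN N → ℝ} (n1 : Sol σ H L u1) (n2 : Sol σ H L u2) {m t0 : ℝ} (ht0 : 0 ≤ t0)
    (h0 : ∀ x, u1 (pt x t0) - u2 (pt x t0) ≤ m) {t : ℝ} (ht : t0 ≤ t) (x : E N) : u1 (pt x t) - u2 (pt x t) ≤ m := by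
  obtain ⟨C1, hC0, hC1⟩ := D.hlip (L + 1) (by linarith)
  have n1' := n1.shift ht0
  have n2' := n2.shift ht0
  have hD := n1'.DI2 D hL hC0.le (fun θ x y p q h1 h2 => hC1 θ x y p q (by linarith) (by linarith)) n2'
  have hD' : LargeTimeBehavior.DI σ C1 (Set.Ioo 0 (t - t0 + 1)) (fun X => 2 * (u1 (pt X.fst (X.snd + t0)) - u2 (pt X.fst (X.snd + t0)))) :=
    fun X p B hX hj => hD X p B hX.1 hj
  have := hD'.comp ((n1'.cont.sub n2'.cont).const_mul 2) (n1'.per2 n2') (m := 2 * m) (fun x => by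
    simp only [pt_fst, pt_snd, zero_add]
    linarith only [h0 x]) (x := x) (t := t - t0) (by linarith) (by linarith)
  simp only [pt_fst, pt_snd, sub_add_cancel] at this
  linarith only [this]

lemma Sol.bound (D : Dat σ H Λ) (hL : 0 ≤ L) {u1 u2 : VN N → ℝ} (n1 : Sol σ H L u1) (n2 : Sol σ H L u2) :
    ∃ M, ∀ t, 0 ≤ t → ∀ x, u1 (pt x t) - u2 (pt x t) ≤ M := by
  obtain ⟨X, -, h⟩ := (n1.per2 n2).exists_max ((n1.cont.sub n2.cont).const_mul 2) (le_refl (0:ℝ))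
  refine ⟨u1 X - u2 X, fun t ht x => n1.comp D hL n2 le_rfl (fun x => ?_) ht x⟩
  have := h (pt x 0) ⟨le_rfl, le_rfl⟩
  linarith only [this]

/-- eventual upper bound level -/
lemma exists_level {Q : ℝ → Prop} (hmono : ∀ a b, a ≤ b → Q a → Q b) {a b : ℝ} (ha : Q a) (hb : ¬ Q b) :
    ∃ m, (∀ ρ > 0, Q (m + ρ)) ∧ ∀ ρ > 0, ¬ Q (m - ρ) := by
  have hbd : BddBelow {k | Q k} := ⟨b, fun k hk => le_of_not_ge fun hkb => hb (hmono k b hkb hk)⟩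
  refine ⟨sInf {k | Q k}, fun ρ hρ => ?_, fun ρ hρ hq => ?_⟩
  · obtain ⟨k, hk, hk2⟩ := exists_lt_of_csInf_lt ⟨a, ha⟩ (show sInf {k | Q k} < sInf {k | Q k} + ρ by linarith)
    exact hmono _ _ hk2.le hk
  · have := csInf_le hbd hq
    linarith

theorem partC (D : Dat σ H Λ) (hL : 0 ≤ L) {ν : ℝ} (hν : 0 < ν)
    (hell : ∀ x θ y, ν * ‖y‖^2 ≤ ∑ k, ⟪col (σ θ x) k, y⟫^2) {U V : VN N → ℝ} (hU : Sol σ H L U) (hV : Sol σ H L V) :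
    ∃ m : ℝ, ∀ ε > 0, ∃ T, ∀ t ≥ T, ∀ x, |U (pt x t) - (V (pt x t) + m)| ≤ ε := by
  obtain ⟨C1, hC0, hC1⟩ := D.hlip (L + 1) (by linarith)
  have hC1' : ∀ (θ : Θ) (x y p q : E N), ‖p‖ ≤ L → ‖q‖ ≤ L → |H θ x p - H θ y q| ≤ C1 * (‖x - y‖ + ‖p - q‖) :=
    fun θ x y p q h1 h2 => hC1 θ x y p q (by linarith) (by linarith)
  -- generic level
  have hlev : ∀ {u1 u2 : VN N → ℝ}, Sol σ H L u1 → Sol σ H L u2 → ∃ m, (∀ ρ > 0, ∃ T > 0, ∀ t ≥ T, ∀ x, u1 (pt x t) - u2 (pt x t) ≤ m + ρ) ∧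
      ∀ ρ > 0, ∀ t > 0, ∃ x, m - ρ < u1 (pt x t) - u2 (pt x t) := by
    intro u1 u2 n1 n2
    obtain ⟨M, hM⟩ := n1.bound D hL n2
    obtain ⟨M', hM'⟩ := n2.bound D hL n1
    obtain ⟨m, h1, h2⟩ := exists_level (Q := fun k => ∃ T > 0, ∀ x, u1 (pt x T) - u2 (pt x T) ≤ k)
      (fun a b hab ⟨T, hT, h⟩ => ⟨T, hT, fun x => (h x).trans hab⟩) (a := M) ⟨1, one_pos, hM 1 zero_le_one⟩
      (b := -M' - 1) (by
        rintro ⟨T, hT, h⟩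
        have e1 := h 0
        have e2 := hM' T hT.le 0
        linarith)
    refine ⟨m, fun ρ hρ => ?_, fun ρ hρ t ht => ?_⟩
    · obtain ⟨T, hT, h⟩ := h1 ρ hρ
      exact ⟨T, hT, fun t ht x => n1.comp D hL n2 hT.le h ht x⟩
    · by_contra! hcon
      exact h2 ρ hρ ⟨t, ht, hcon⟩
  obtain ⟨m, h1, h2⟩ := hlev hU hV
  obtain ⟨m', h1', h2'⟩ := hlev hV hU
  have hmm : m + m' ≤ 0 := by
    by_contra! hcon
    set d := (m + m') / 4 with hd
    have hd0 : 0 < d := by linarith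
    obtain ⟨ρ, hρ, hg⟩ := growth D hC0.le hν hell (r := d / (2 * L + 1)) (d := 2 * d) (by positivity) (by positivity)
    obtain ⟨T, hT, hTu⟩ := h1 (ρ / 2) (by positivity)
    obtain ⟨x0, hx0⟩ := h2' d hd0 T hT
    have := hg (fun X => 2 * (U X - V X)) (2 * m) T x0 (hU.DI2 D hL hC0.le hC1' hV) ((hU.cont.sub hV.cont).const_mul 2) (hU.per2 hV) hT
      (fun x t ht => by have := hTu t ht x; linarith) (fun x hx => by
        have e1 := hU.lip (pt x0 T) (x - x0)
        have e2 := hV.lip (pt x0 T) (x - x0)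
        rw [← pt_add, add_sub_cancel, add_zero] at e1 e2
        have e3 : (2 * L + 1) * ‖x - x0‖ ≤ d := by
          rwa [le_div_iff₀ (by positivity), mul_comm] at hx
        have := (abs_le.1 e1).2
        have := (abs_le.1 e2).1
        have := norm_nonneg (x - x0)
        linarith)
    obtain ⟨x, hx⟩ := h2 (ρ / 4) (by positivity) (T + 1) (by linarith)
    have := this x
    linarith
  refine ⟨m, fun ε hε => ?_⟩
  obtain ⟨T, hT, h⟩ := h1 ε hε
  obtain ⟨T', hT', h'⟩ := h1' ε hε
  refine ⟨max T T', fun t ht x => abs_le.2 ⟨?_, ?_⟩⟩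
  · have := h' t ((le_max_right _ _).trans ht) x
    linarith
  · have := h t ((le_max_left _ _).trans ht) x
    linarith
end

section
variable {N : ℕ} {Θ : Type*} {A σ : Θ → E N → Matrix (Fin N) (Fin N) ℝ} {H : Θ → E N → E N → ℝ} {Λ L C1 : ℝ}

lemma ujet_of_quad {f : VN N → ℝ} {x p : E N} {t a k : ℝ} (h : ∀ᶠ q : E N × ℝ in 𝓝 (x, t),
    f (pt q.1 q.2) ≤ f (pt x t) + ⟪p, q.1 - x⟫ + a * (q.2 - t) + (k / 2) * (‖q.1 - x‖^2 + (q.2 - t)^2)) :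
    UJet f (pt x t) (pt p a) (k • ContinuousLinearMap.id ℝ (VN N)) := by
  intro α hα
  have hc : Tendsto (fun Y : VN N => (Y.fst, Y.snd)) (𝓝 (pt x t)) (𝓝 (x, t)) :=
    (VN_contDiff_fst.continuous.prodMk VN_contDiff_snd.continuous).tendsto (pt x t)
  filter_upwards [hc.eventually h] with Y hY
  have e : Y - pt x t = pt (Y.fst - x) (Y.snd - t) := by rw [← pt_eta Y, ← pt_sub]; rfl
  rw [pt_eta] at hY
  have e2 : ⟪(k • ContinuousLinearMap.id ℝ (VN N)) (Y - pt x t), Y - pt x t⟫ = k * (‖Y.fst - x‖^2 + (Y.snd - t)^2) := by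
    rw [e, smul_apply, inner_smul_left, ContinuousLinearMap.id_apply, real_inner_self_eq_norm_sq, norm_pt_sq]; simp
  rw [e2, e, inner_pt, norm_pt_sq]
  simp only [pt_fst, pt_snd] at hY ⊢
  have : 0 ≤ α * (‖Y.fst - x‖^2 + (Y.snd - t)^2) := by positivity
  linarith only [hY, this]

lemma Dat.tq_small (D : Dat σ H Λ) {y0 : E N} {θ : Θ} (h : ∀ k, col (σ θ y0) k = 0) (x : E N) {k e : ℝ} (hk : 0 ≤ k)
    (he : k * (Λ * ‖x - y0‖^2) ≤ e) : tq (σ θ x) (k • ContinuousLinearMap.id ℝ (VN N)) ≤ e := by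
  have h1 := D.lip θ x y0
  simp only [h, sub_zero] at h1
  refine le_trans (le_of_eq ?_) ((mul_le_mul_of_nonneg_left h1 hk).trans he)
  unfold tq
  rw [Finset.mul_sum]
  refine Finset.sum_congr rfl fun j _ => ?_
  rw [smul_apply, inner_smul_left, ContinuousLinearMap.id_apply, real_inner_self_eq_norm_sq, norm_pt0]; simp

lemma sq_exp (x x' y : E N) : ‖x' - y‖^2 = ‖x - y‖^2 + 2 * ⟪x - y, x' - x⟫ + ‖x' - x‖^2 := by
  have : x' - y = (x - y) + (x' - x) := by abel
  rw [this, norm_add_sq_real]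

lemma le_of_sq {a b : ℝ} (hb : 0 ≤ b) (h : a^2 ≤ b^2) : a ≤ b := (abs_le_of_sq_le_sq' h hb).2

/-- choice of parameters -/
lemma sig_par {Λ c0 μ M e : ℝ} (hΛ : 0 ≤ Λ) (hc0 : 0 < c0) (hμ : 1 < μ) (hM : 0 < M) (he : 0 < e) :
    ∃ K ≥ (1:ℝ), ∃ β > (0:ℝ), β ≤ 1 ∧ β * c0 < 1 ∧ β * c0 < M ∧ 4 * (β * c0) ≤ e^2 ∧ 4 * K * (β * c0) ≤ e^2 ∧
      (2 / β + 2 * K + 2) * (Λ * (β * c0 / K)) ≤ e ∧ (1 / (β * μ)) * (Λ * (8 * β^2 * c0 + 2 * (β * c0 / K))) ≤ e ∧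
      (1 / (β * (μ - 1))) * (Λ * (8 * β^2 * c0 + 2 * (β * c0 / K))) ≤ e := by
  have hμ1 : 0 < μ - 1 := by linarith
  set G := 10 * Λ * c0 * (1 + 1 / (μ - 1)) with hG
  have hG0 : 0 ≤ G := by positivity
  set K := 1 + 2 * G / e with hK
  have hK1 : 1 ≤ K := by
    have : 0 ≤ 2 * G / e := by positivity
    linarith
  have hK0 : 0 < K := by linarith
  have hGK : G / K ≤ e / 2 := by
    rw [div_le_iff₀ hK0, hK]
    have : e / 2 * (1 + 2 * G / e) = e / 2 + G := by field_simp
    linarith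
  set β := min 1 (min (e / (2 * (G + 1))) (min (e^2 / (4 * K * c0)) (min (1 / (2 * c0)) (M / (2 * c0))))) with hβ
  have hβ0 : 0 < β := by positivity
  have hb1 : β ≤ 1 := min_le_left _ _
  have hb2 : β ≤ e / (2 * (G + 1)) := (min_le_right _ _).trans (min_le_left _ _)
  have hb3 : β ≤ e^2 / (4 * K * c0) := (min_le_right _ _).trans ((min_le_right _ _).trans (min_le_left _ _))
  have hb4 : β ≤ 1 / (2 * c0) := (min_le_right _ _).trans ((min_le_right _ _).trans ((min_le_right _ _).trans (min_le_left _ _)))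
  have hb5 : β ≤ M / (2 * c0) := (min_le_right _ _).trans ((min_le_right _ _).trans ((min_le_right _ _).trans (min_le_right _ _)))
  rw [le_div_iff₀ (by positivity)] at hb2 hb3 hb4 hb5
  have hbc : 0 < β * c0 := by positivity
  have hGβ : G * β ≤ e / 2 := by linarith
  have hsum : G * (β + 1 / K) ≤ e := by
    have : G * (β + 1 / K) = G * β + G / K := by ring
    linarith
  refine ⟨K, hK1, β, hβ0, hb1, by linarith, by linarith, ?_, by linarith, ?_, ?_, ?_⟩
  · have := mul_le_mul_of_nonneg_right hK1 hbc.le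
    linarith
  · refine le_trans ?_ hsum
    have e1 : (2 / β + 2 * K + 2) * (Λ * (β * c0 / K)) = Λ * c0 * (2 * (1 / K) + 2 * β + 2 * (β * (1/K))) := by field_simp
    have h1K : 1 / K ≤ 1 := by rw [div_le_one hK0]; exact hK1
    have e2 : β * (1 / K) ≤ β := by nlinarith
    have e3 : 0 ≤ 1 / K := by positivity
    have e4 : 0 ≤ 1 / (μ - 1) := by positivity
    rw [e1, hG]
    have : Λ * c0 * (2 * (1 / K) + 2 * β + 2 * (β * (1/K))) ≤ Λ * c0 * (10 * (β + 1 / K)) := by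
      refine mul_le_mul_of_nonneg_left ?_ (by positivity)
      linarith
    have h2 : 0 ≤ Λ * c0 * (10 * (β + 1 / K)) * (1 / (μ - 1)) := by positivity
    linarith
  all_goals
    refine le_trans ?_ hsum
    have e4 : 0 ≤ 1 / (μ - 1) := by positivity
    have e5 : 0 ≤ 1 / K := by positivity
  · have e1 : (1 / (β * μ)) * (Λ * (8 * β^2 * c0 + 2 * (β * c0 / K))) = Λ * c0 * (8 * β + 2 * (1/K)) * (1 / μ) := by field_simp
    have h1 : 1 / μ ≤ 1 := by rw [div_le_one (by linarith)]; exact hμ.le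
    rw [e1, hG]
    have e6 : 10 * Λ * c0 * (1 + 1 / (μ - 1)) * (β + 1 / K) = Λ * c0 * (10 * (β + 1/K)) * (1 + 1 / (μ - 1)) := by ring
    rw [e6]
    gcongr
    · linarith
    · linarith
  · have e1 : (1 / (β * (μ - 1))) * (Λ * (8 * β^2 * c0 + 2 * (β * c0 / K))) = Λ * c0 * (8 * β + 2 * (1/K)) * (1 / (μ - 1)) := by field_simp
    rw [e1, hG]
    have e6 : 10 * Λ * c0 * (1 + 1 / (μ - 1)) * (β + 1 / K) = Λ * c0 * (10 * (β + 1/K)) * (1 + 1 / (μ - 1)) := by ring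
    rw [e6]
    gcongr
    · linarith
    · linarith

lemma sigB {C1 L μ η r γ e : ℝ} (hC0 : 0 ≤ C1) (hμ : 1 < μ) (he : 0 < e) (hη : 0 < η) (hr : 0 ≤ r) {F : E N → ℝ}
    (hF : ∀ p q, ‖p‖ ≤ L → ‖q‖ ≤ L → |F p - F q| ≤ C1 * ‖p - q‖)
    (hsc : ∀ p q, ‖p‖ ≤ L → ‖q‖ ≤ L → r ≤ ‖p - q‖ → γ ≤ (1 / μ) * F p + (1 - 1 / μ) * F q - F ((1 / μ) • p + (1 - 1 / μ) • q))
    (hγ : (5 + 6 * C1) * e < γ) (hη2 : (3 + 5 * C1) * e + C1 * r < η) {p1 p2 p3 : E N} (n1 : ‖p1‖ ≤ L) (n2 : ‖p2‖ ≤ L) (n3 : ‖p3‖ ≤ L)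
    (ha : η ≤ F p2 + 2 * e + 2 * (C1 * e)) (hb : F p3 ≤ e + 2 * (C1 * e)) (hc : F p1 ≤ μ * η + 2 * e + C1 * e)
    (hp : ‖p1 - (μ • p2 - (μ - 1) • p3)‖ ≤ e) : False := by
  have hμ0 : 0 < μ := by linarith
  have hi0 : 0 < 1 / μ := by positivity
  have hi1 : 1 / μ < 1 := by rw [div_lt_one hμ0]; exact hμ
  set ph := (1 / μ) • p1 + (1 - 1 / μ) • p3 with hph
  have nph : ‖ph‖ ≤ L := by
    refine (norm_add_le _ _).trans ?_
    rw [norm_smul, norm_smul, Real.norm_of_nonneg hi0.le, Real.norm_of_nonneg (by linarith)]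
    nlinarith
  have hd : ‖p2 - ph‖ ≤ e := by
    have : p2 - ph = -((1 / μ) • (p1 - (μ • p2 - (μ - 1) • p3))) := by
      rw [hph, smul_sub, smul_sub, smul_smul, smul_smul]
      have e1 : 1 / μ * μ = 1 := by field_simp
      have e2 : 1 / μ * (μ - 1) = 1 - 1 / μ := by field_simp
      rw [e1, e2]; module
    rw [this, norm_neg, norm_smul, Real.norm_of_nonneg hi0.le]
    nlinarith [norm_nonneg (p1 - (μ • p2 - (μ - 1) • p3))]
  have hd2 := (abs_le.1 (hF p2 ph n2 nph)).2
  have hd3 : C1 * ‖p2 - ph‖ ≤ C1 * e := by gcongr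
  by_cases hcase : r ≤ ‖p1 - p3‖
  · have := hsc p1 p3 n1 n3 hcase
    rw [← hph] at this
    have h1 : (1 / μ) * F p1 ≤ (1 / μ) * (μ * η + 2 * e + C1 * e) := mul_le_mul_of_nonneg_left hc hi0.le
    have h2 : (1 - 1 / μ) * F p3 ≤ (1 - 1 / μ) * (e + 2 * (C1 * e)) := mul_le_mul_of_nonneg_left hb (by linarith)
    have h3 : (1 / μ) * (μ * η + 2 * e + C1 * e) = η + (1 / μ) * (2 * e + C1 * e) := by field_simp; ring
    have hCe : 0 ≤ C1 * e := by positivity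
    have h4 : (1 / μ) * (2 * e + C1 * e) ≤ 2 * e + C1 * e := by nlinarith
    have h5 : (1 - 1 / μ) * (e + 2 * (C1 * e)) ≤ e + 2 * (C1 * e) := by nlinarith
    linarith
  · push Not at hcase
    have h1 : ph - p3 = (1 / μ) • (p1 - p3) := by rw [hph]; module
    have h2 : ‖ph - p3‖ ≤ r := by
      rw [h1, norm_smul, Real.norm_of_nonneg hi0.le]
      nlinarith [norm_nonneg (p1 - p3)]
    have h3 := (abs_le.1 (hF ph p3 nph n3)).2
    have h4 : C1 * ‖ph - p3‖ ≤ C1 * r := by gcongr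
    linarith
end

section
variable {N : ℕ} {Θ : Type*} {A σ : Θ → E N → Matrix (Fin N) (Fin N) ℝ} {H : Θ → E N → E N → ℝ} {Λ L C1 : ℝ}

def QQ (U : VN N → ℝ) (v : E N → ℝ) (μ η : ℝ) (x : E N) (t τ : ℝ) : ℝ :=
  U (pt x t) - μ * U (pt x (t + τ)) + (μ - 1) * v x - μ * η * τ

/-- the doubled functional -/
def Phi (U : VN N → ℝ) (v : E N → ℝ) (μ η β K t0 : ℝ) (y0 x y z : E N) (t s : ℝ) : ℝ :=
  U (pt x t) - μ * U (pt y s) + (μ - 1) * v z - μ * η * (s - t) - (1 / (2 * β)) * (‖x - y‖^2 + ‖x - z‖^2)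
    - K * ‖x - y0‖^2 - (t - t0)^2

set_option maxHeartbeats 4000000 in
theorem sig_max {U : VN N → ℝ} {v : E N → ℝ} {M0 M η μ β K c0 t0 τ0 : ℝ} {y0 : E N} (hL : 0 ≤ L) (hUc : Continuous U) (hvc : Continuous v)
    (hUl : ∀ x y t, |U (pt x t) - U (pt y t)| ≤ L * ‖x - y‖) (hvl : ∀ x y, |v x - v y| ≤ L * ‖x - y‖)
    (hUv : ∀ x t, 0 ≤ t → v x ≤ U (pt x t)) (hM0 : ∀ x t, 0 ≤ t → |U (pt x t)| ≤ M0) (hvM : ∀ x, |v x| ≤ M0)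
    (hμ : 1 < μ) (hη : 0 < η) (hK : 1 ≤ K) (hβ : 0 < β) (hβ1 : β ≤ 1) (hc0 : c0 = 2 + 2 * μ^2 * L^2)
    (hb1 : β * c0 < 1) (hb2 : β * c0 < M) (ht0 : 1 < t0) (hτ0 : 0 ≤ τ0) (hQ0 : M - β ≤ QQ U v μ η y0 t0 τ0)
    (hQ : ∀ x t τ, t0 - 1 ≤ t → 0 ≤ τ → QQ U v μ η x t τ ≤ M + β) :
    ∃ x y z t s, ‖x - y‖^2 + ‖x - z‖^2 ≤ 4 * β^2 * c0 ∧ K * ‖x - y0‖^2 ≤ β * c0 ∧ (t - t0)^2 ≤ β * c0 ∧ 0 < t ∧ 0 < s ∧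
      (∀ᶠ q : E N × ℝ in 𝓝 (x, t), Phi U v μ η β K t0 y0 q.1 y z q.2 s ≤ Phi U v μ η β K t0 y0 x y z t s) ∧
      (∀ᶠ q : E N × ℝ in 𝓝 (y, s), Phi U v μ η β K t0 y0 x q.1 z t q.2 ≤ Phi U v μ η β K t0 y0 x y z t s) ∧
      (∀ᶠ q : E N in 𝓝 z, Phi U v μ η β K t0 y0 x y q t s ≤ Phi U v μ η β K t0 y0 x y z t s) := by
  have hμ0 : 0 < μ := by linarith
  have hM00 : 0 ≤ M0 := (abs_nonneg _).trans (hvM y0)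
  have hc00 : 2 ≤ c0 := by
    have : 0 ≤ 2 * μ^2 * L^2 := by positivity
    linarith
  set Sm := 2 * M0 / η with hSm
  have hSm0 : 0 ≤ Sm := by positivity
  have hSmη : μ * η * Sm = 2 * μ * M0 := by rw [hSm]; field_simp
  have hQub : ∀ x t τ, 0 ≤ t → 0 ≤ τ → QQ U v μ η x t τ ≤ 2 * μ * M0 - μ * η * τ := by
    intro x t τ ht hτ
    have e1 := (abs_le.1 (hM0 x t ht)).2
    have e2 := mul_le_mul_of_nonneg_left (abs_le.1 (hM0 x (t + τ) (by linarith only [ht, hτ]))).1 hμ0.le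
    have e3 := mul_le_mul_of_nonneg_left (abs_le.1 (hvM x)).2 (show 0 ≤ μ - 1 by linarith)
    unfold QQ
    linarith only [e1, e2, e3]
  have hβM : β < M := by
    have := mul_le_mul_of_nonneg_left hc00 hβ.le
    linarith only [this, hb2, hβ]
  have hτS : τ0 ≤ Sm := by
    have := hQub y0 t0 τ0 (by linarith only [ht0]) hτ0
    by_contra! hcon
    have h2 := mul_lt_mul_of_pos_left hcon (show 0 < μ * η by positivity)
    linarith only [this, hQ0, h2, hSmη, hβM]
  set S : Set (E N × E N × E N × ℝ × ℝ) := (Metric.closedBall y0 1 ×ˢ Metric.closedBall y0 3 ×ˢ Metric.closedBall y0 3 ×ˢ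
    Set.Icc (t0 - 1) (t0 + 1) ×ˢ Set.Icc (t0 - 1) (t0 + 1 + Sm)) ∩ {q | q.2.2.2.1 ≤ q.2.2.2.2} with hS
  have hcpt : IsCompact S := by
    refine IsCompact.inter_right ?_ (isClosed_le (by fun_prop) (by fun_prop))
    exact (isCompact_closedBall _ _).prod ((isCompact_closedBall _ _).prod ((isCompact_closedBall _ _).prod (isCompact_Icc.prod isCompact_Icc)))
  have hcont : Continuous (fun q : E N × E N × E N × ℝ × ℝ => Phi U v μ η β K t0 y0 q.1 q.2.1 q.2.2.1 q.2.2.2.1 q.2.2.2.2) := by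
    unfold Phi
    have c1 : Continuous (fun q : E N × E N × E N × ℝ × ℝ => U (pt q.1 q.2.2.2.1)) :=
      hUc.comp (continuous_pt.comp (Continuous.prodMk (by fun_prop) (by fun_prop)))
    have c2 : Continuous (fun q : E N × E N × E N × ℝ × ℝ => U (pt q.2.1 q.2.2.2.2)) :=
      hUc.comp (continuous_pt.comp (Continuous.prodMk (by fun_prop) (by fun_prop)))
    have c3 : Continuous (fun q : E N × E N × E N × ℝ × ℝ => v q.2.2.1) := hvc.comp (by fun_prop)
    exact (((((c1.sub (c2.const_mul μ)).add (c3.const_mul (μ-1))).sub (by fun_prop)).sub (by fun_prop)).sub (by fun_prop)).sub (by fun_prop)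
  have hmem0 : (y0, y0, y0, t0, t0 + τ0) ∈ S := by
    refine ⟨⟨?_, ?_, ?_, ?_, ?_⟩, ?_⟩
    · exact Metric.mem_closedBall_self zero_le_one
    · exact Metric.mem_closedBall_self (by norm_num)
    · exact Metric.mem_closedBall_self (by norm_num)
    · constructor <;> simp only <;> linarith only []
    · constructor <;> simp only <;> linarith only [hτ0, hτS]
    · simp only [Set.mem_ofPred_eq]; linarith only [hτ0]
  obtain ⟨⟨x, y, z, t, s⟩, hq, hmax⟩ := hcpt.exists_isMaxOn ⟨_, hmem0⟩ hcont.continuousOn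
  have hval : QQ U v μ η y0 t0 τ0 ≤ Phi U v μ η β K t0 y0 x y z t s := by
    have := hmax hmem0
    simp only [Set.mem_ofPred_eq] at this
    refine le_trans (le_of_eq ?_) this
    unfold Phi QQ
    simp
  obtain ⟨⟨hx, hy, hz, ht, hs⟩, hts⟩ := hq
  simp only [Set.mem_ofPred_eq] at hx hy hz ht hs hts
  have hab : ∀ a : ℝ, μ * L * a ≤ (1 / (4 * β)) * a^2 + β * (μ^2 * L^2) := by
    intro a
    have h1 : (1 / (4 * β)) * a^2 + β * (μ^2 * L^2) - μ * L * a = (1 / (4 * β)) * (a - 2 * β * (μ * L))^2 := by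
      field_simp; ring
    have h2 : 0 ≤ (1 / (4 * β)) * (a - 2 * β * (μ * L))^2 := by positivity
    linarith only [h1, h2]
  have hPQ : Phi U v μ η β K t0 y0 x y z t s ≤ QQ U v μ η x t (s - t) + 2 * β * (μ^2 * L^2) - (1 / (4 * β)) * (‖x - y‖^2 + ‖x - z‖^2)
      - K * ‖x - y0‖^2 - (t - t0)^2 := by
    have e1 := mul_le_mul_of_nonneg_left (abs_le.1 (hUl x y s)).2 hμ0.le
    have e2 := mul_le_mul_of_nonneg_left (abs_le.1 (hvl x z)).1 (show 0 ≤ μ - 1 by linarith only [hμ])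
    have e3 := hab ‖x - y‖
    have e4 := hab ‖x - z‖
    have e5 : (μ - 1) * (L * ‖x - z‖) ≤ μ * (L * ‖x - z‖) :=
      mul_le_mul_of_nonneg_right (by linarith only []) (by positivity)
    have e6 : (1 / (2 * β)) * (‖x - y‖^2 + ‖x - z‖^2) = 2 * ((1 / (4 * β)) * (‖x - y‖^2 + ‖x - z‖^2)) := by field_simp; ring
    unfold Phi QQ
    rw [e6, add_sub_cancel]
    linarith only [e1, e2, e3, e4, e5]
  have hQx := hQ x t (s - t) ht.1 (by linarith only [hts])
  have hβc : β * c0 = 2 * β + 2 * β * (μ^2 * L^2) := by rw [hc0]; ring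
  have hp1 : 0 ≤ (1 / (4 * β)) * (‖x - y‖^2 + ‖x - z‖^2) := by positivity
  have hp2 : 0 ≤ K * ‖x - y0‖^2 := by positivity
  have hp3 := sq_nonneg (t - t0)
  have hr1 : (1 / (4 * β)) * (‖x - y‖^2 + ‖x - z‖^2) ≤ β * c0 := by linarith only [hPQ, hval, hQ0, hQx, hβc, hp2, hp3]
  have hr2 : K * ‖x - y0‖^2 ≤ β * c0 := by linarith only [hPQ, hval, hQ0, hQx, hβc, hp1, hp3]
  have hr3 : (t - t0)^2 ≤ β * c0 := by linarith only [hPQ, hval, hQ0, hQx, hβc, hp1, hp2]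
  have hQpos : 0 < QQ U v μ η x t (s - t) := by linarith only [hPQ, hval, hQ0, hβc, hp1, hp2, hp3, hb2, hβ]
  have hr1' : ‖x - y‖^2 + ‖x - z‖^2 ≤ 4 * β^2 * c0 := by
    rw [one_div, inv_mul_le_iff₀ (by positivity)] at hr1
    linarith only [hr1]
  have htpos : 0 < t := by linarith only [ht.1, ht0]
  have hts' : t < s := by
    rcases hts.eq_or_lt with h | h
    · exfalso
      rw [← h, sub_self] at hQpos
      unfold QQ at hQpos
      rw [add_zero] at hQpos
      have := mul_le_mul_of_nonneg_left (hUv x t htpos.le) (show 0 ≤ μ - 1 by linarith only [hμ])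
      linarith only [this, hQpos]
    · exact h
  have htl : t0 - 1 < t ∧ t < t0 + 1 := by
    have := abs_lt_of_sq_lt_sq (show (t - t0)^2 < 1^2 by linarith only [hr3, hb1]) zero_le_one
    rw [abs_lt] at this
    constructor <;> linarith only [this.1, this.2]
  have hsu : s < t0 + 1 + Sm := by
    have h1 := hQub x t (s - t) htpos.le (by linarith only [hts])
    by_contra! hcon
    have h2 := mul_lt_mul_of_pos_left (show Sm < s - t by linarith only [hcon, htl.2]) (show 0 < μ * η by positivity)
    linarith only [h1, hQpos, h2, hSmη]
  have hxb : ‖x - y0‖ < 1 := by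
    have h1 : ‖x - y0‖^2 ≤ K * ‖x - y0‖^2 := le_mul_of_one_le_left (sq_nonneg _) hK
    have := abs_lt_of_sq_lt_sq (show ‖x - y0‖^2 < 1^2 by linarith only [hr2, hb1, h1]) zero_le_one
    rwa [abs_of_nonneg (norm_nonneg _)] at this
  have h4 : 4 * β^2 * c0 < 4 := by
    have : β * (β * c0) ≤ 1 * (β * c0) := mul_le_mul_of_nonneg_right hβ1 (by positivity)
    linarith only [this, hb1]
  have hdist : ∀ w, ‖x - w‖^2 ≤ 4 * β^2 * c0 → ‖w - y0‖ < 3 := by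
    intro w hw
    have := abs_lt_of_sq_lt_sq (show ‖x - w‖^2 < 2^2 by linarith only [hw, h4]) zero_le_two
    rw [abs_of_nonneg (norm_nonneg _)] at this
    have h2 : ‖w - y0‖ ≤ ‖w - x‖ + ‖x - y0‖ := norm_sub_le_norm_sub_add_norm_sub _ _ _
    rw [norm_sub_rev w x] at h2
    linarith only [this, h2, hxb]
  have hyb := hdist y (by linarith only [hr1', sq_nonneg ‖x - z‖])
  have hzb := hdist z (by linarith only [hr1', sq_nonneg ‖x - y‖])
  refine ⟨x, y, z, t, s, hr1', hr2, hr3, htpos, by linarith only [htpos, hts'], ?_, ?_, ?_⟩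
  · have h1 : ∀ᶠ q : E N × ℝ in 𝓝 (x, t), q.1 ∈ Metric.ball y0 1 :=
      continuous_fst.continuousAt.eventually (Metric.isOpen_ball.mem_nhds (mem_ball_iff_norm.2 hxb))
    have h2 : ∀ᶠ q : E N × ℝ in 𝓝 (x, t), q.2 ∈ Set.Ioo (t0 - 1) (t0 + 1) :=
      continuous_snd.continuousAt.eventually (Ioo_mem_nhds htl.1 htl.2)
    have h3 : ∀ᶠ q : E N × ℝ in 𝓝 (x, t), q.2 < s := continuous_snd.continuousAt.eventually (gt_mem_nhds hts')
    filter_upwards [h1, h2, h3] with q h1 h2 h3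
    exact hmax (show (q.1, y, z, q.2, s) ∈ S from ⟨⟨Metric.ball_subset_closedBall h1, hy, hz, Set.Ioo_subset_Icc_self h2, hs⟩, h3.le⟩)
  · have h1 : ∀ᶠ q : E N × ℝ in 𝓝 (y, s), q.1 ∈ Metric.ball y0 3 :=
      continuous_fst.continuousAt.eventually (Metric.isOpen_ball.mem_nhds (mem_ball_iff_norm.2 hyb))
    have h2 : ∀ᶠ q : E N × ℝ in 𝓝 (y, s), q.2 ∈ Set.Ioo t (t0 + 1 + Sm) :=
      continuous_snd.continuousAt.eventually (Ioo_mem_nhds hts' hsu)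
    filter_upwards [h1, h2] with q h1 h2
    exact hmax (show (x, q.1, z, t, q.2) ∈ S from ⟨⟨hx, Metric.ball_subset_closedBall h1, hz, ht, ⟨by linarith only [h2.1, ht.1], h2.2.le⟩⟩, h2.1.le⟩)
  · have h1 : ∀ᶠ q : E N in 𝓝 z, q ∈ Metric.ball y0 3 := Metric.isOpen_ball.mem_nhds (mem_ball_iff_norm.2 hzb)
    filter_upwards [h1] with q h1
    exact hmax (show (x, y, q, t, s) ∈ S from ⟨⟨hx, hy, Metric.ball_subset_closedBall h1, ht, hs⟩, hts⟩)
end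

section
variable {N : ℕ} {Θ : Type*} {A σ : Θ → E N → Matrix (Fin N) (Fin N) ℝ} {H : Θ → E N → E N → ℝ} {Λ L C1 : ℝ}

lemma Sol.lipx {U : VN N → ℝ} (h : Sol σ H L U) (x y : E N) (t : ℝ) : |U (pt x t) - U (pt y t)| ≤ L * ‖x - y‖ := by
  have := h.lip (pt y t) (x - y)
  rwa [← pt_add, add_sub_cancel, add_zero] at this

set_option maxHeartbeats 4000000 in
theorem sigA (D : Dat σ H Λ) (hL : 0 ≤ L) {U : VN N → ℝ} {v : E N → ℝ} (hU : Sol σ H L U) (hV : Sol σ H L (fun X => v X.fst))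
    (hvc : Continuous v) {M0 M η μ e : ℝ}
    (hUv : ∀ x t, 0 ≤ t → v x ≤ U (pt x t)) (hM0 : ∀ x t, 0 ≤ t → |U (pt x t)| ≤ M0) (hvM : ∀ x, |v x| ≤ M0)
    (hμ : 1 < μ) (hη : 0 < η) (hM : 0 < M) (he : 0 < e) :
    ∃ ρ > (0:ℝ), ∀ t0 y0 τ0, 1 < t0 → (∀ θ k, col (σ θ y0) k = 0) → 0 ≤ τ0 → M - ρ ≤ QQ U v μ η y0 t0 τ0 →
      (∀ x t τ, t0 - 1 ≤ t → 0 ≤ τ → QQ U v μ η x t τ ≤ M + ρ) →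
      ∃ θ p1 p2 p3 x y z, ‖p1‖ ≤ L ∧ ‖p2‖ ≤ L ∧ ‖p3‖ ≤ L ∧ ‖x - y0‖ ≤ e ∧ ‖y - y0‖ ≤ 2 * e ∧ ‖z - y0‖ ≤ 2 * e ∧
        η ≤ H θ y p2 + 2 * e ∧ H θ z p3 ≤ e ∧ H θ x p1 ≤ μ * η + 2 * e ∧ ‖p1 - (μ • p2 - (μ - 1) • p3)‖ ≤ e := by
  have hμ0 : 0 < μ := by linarith only [hμ]
  have hμ1 : 0 < μ - 1 := by linarith only [hμ]
  set c0 := 2 + 2 * μ^2 * L^2 with hc0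
  have hc00 : 0 < c0 := by positivity
  obtain ⟨K, hK, β, hβ, hβ1, hb1, hb2, hb3, hb4, hb5, hb6, hb7⟩ := sig_par D.nn hc00 hμ hM he
  have hK0 : 0 < K := by linarith only [hK]
  refine ⟨β, hβ, fun t0 y0 τ0 ht0 hdeg hτ0 hQ0 hQ => ?_⟩
  obtain ⟨x, y, z, t, s, hxyz, hx0, htt, ht, hs, hm1, hm2, hm3⟩ := sig_max hL hU.cont hvc hU.lipx
    (fun a b => by simpa using hV.lipx a b 0) hUv hM0 hvM hμ hη hK hβ hβ1 hc0 hb1 hb2 ht0 hτ0 hQ0 hQ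
  have hxK : ‖x - y0‖^2 ≤ β * c0 / K := by rw [le_div_iff₀ hK0]; linarith only [hx0]
  have hbK : β * c0 / K ≤ β * c0 := div_le_self (by positivity) hK
  have hbb : β^2 * c0 ≤ β * c0 := by
    have := mul_le_mul_of_nonneg_right hβ1 (show 0 ≤ β * c0 by positivity)
    linarith only [this]
  have hw : ∀ w, ‖x - w‖^2 ≤ 4 * β^2 * c0 → ‖w - y0‖^2 ≤ 8 * β^2 * c0 + 2 * (β * c0 / K) := by
    intro w hw
    have h1 : ‖w - y0‖ ≤ ‖w - x‖ + ‖x - y0‖ := norm_sub_le_norm_sub_add_norm_sub _ _ _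
    rw [norm_sub_rev w x] at h1
    have h2 : ‖w - y0‖^2 ≤ (‖x - w‖ + ‖x - y0‖)^2 := pow_le_pow_left₀ (norm_nonneg _) h1 2
    have h3 := sq_nonneg (‖x - w‖ - ‖x - y0‖)
    linarith only [h2, h3, hw, hxK]
  have hwy := hw y (by linarith only [hxyz, sq_nonneg ‖x - z‖])
  have hwz := hw z (by linarith only [hxyz, sq_nonneg ‖x - y‖])
  have hsm : ∀ w, ‖w - y0‖^2 ≤ 8 * β^2 * c0 + 2 * (β * c0 / K) → ‖w - y0‖ ≤ 2 * e := by
    intro w hw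
    refine le_of_sq (by positivity) ?_
    have := sq_nonneg e
    linarith only [hw, hbK, hbb, hb3, this]
  have jx : UJet U (pt x t) (pt ((1/β) • ((x - y) + (x - z)) + (2 * K) • (x - y0)) (-(μ * η) + 2 * (t - t0)))
      ((2 / β + 2 * K + 2) • ContinuousLinearMap.id ℝ (VN N)) := by
    refine ujet_of_quad ?_
    filter_upwards [hm1] with q hq
    unfold Phi at hq
    rw [sq_exp x q.1 y, sq_exp x q.1 z, sq_exp x q.1 y0] at hq
    rw [inner_add_left, inner_smul_left, inner_smul_left, inner_add_left]
    simp only [RCLike.conj_to_real]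
    have e1 : (1 / (2 * β)) = (1/β) / 2 := by field_simp
    have e2 : 2 / β = 2 * (1/β) := by field_simp
    rw [e1] at hq
    rw [e2]
    generalize ⟪x - y, q.1 - x⟫ = i1 at *
    generalize ⟪x - z, q.1 - x⟫ = i2 at *
    generalize ⟪x - y0, q.1 - x⟫ = i3 at *
    have n1 : 0 ≤ (1/β) * (q.2 - t)^2 := by positivity
    have n2 : 0 ≤ K * (q.2 - t)^2 := by positivity
    have n3 : 0 ≤ ‖q.1 - x‖^2 := by positivity
    generalize 1 / β = b at *
    linarith only [hq, n1, n2, n3]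
  have jy : UJet (fun Y => - U Y) (pt y s) (pt ((1/(β * μ)) • (y - x)) η) ((1/(β * μ)) • ContinuousLinearMap.id ℝ (VN N)) := by
    refine ujet_of_quad ?_
    filter_upwards [hm2] with q hq
    unfold Phi at hq
    rw [norm_sub_rev x q.1, norm_sub_rev x y, sq_exp y q.1 x] at hq
    rw [inner_smul_left]
    simp only [RCLike.conj_to_real]
    generalize ⟪y - x, q.1 - y⟫ = i1 at *
    have e1 : (1 / (2 * β)) = μ * ((1/(β * μ)) / 2) := by field_simp
    rw [e1] at hq
    have n1 : 0 ≤ μ * ((1/(β * μ)) * (q.2 - s)^2) := by positivity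
    generalize 1/(β * μ) = b at *
    refine le_of_mul_le_mul_left ?_ hμ0
    linarith only [hq, n1]
  have jz : UJet (fun X => v X.fst) (pt z t) (pt ((1/(β * (μ-1))) • (z - x)) 0) ((1/(β * (μ-1))) • ContinuousLinearMap.id ℝ (VN N)) := by
    refine ujet_of_quad ?_
    have hc : Tendsto (fun q : E N × ℝ => q.1) (𝓝 (z, t)) (𝓝 z) := continuous_fst.tendsto _
    filter_upwards [hc.eventually hm3] with q hq
    unfold Phi at hq
    rw [norm_sub_rev x q.1, norm_sub_rev x z, sq_exp z q.1 x] at hq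
    rw [inner_smul_left]
    simp only [RCLike.conj_to_real, pt_fst]
    generalize ⟪z - x, q.1 - z⟫ = i1 at *
    have e1 : (1 / (2 * β)) = (μ-1) * ((1/(β * (μ-1))) / 2) := by field_simp
    rw [e1] at hq
    have n1 : 0 ≤ (μ-1) * ((1/(β * (μ-1))) * (q.2 - t)^2) := by positivity
    generalize 1/(β * (μ-1)) = b at *
    refine le_of_mul_le_mul_left ?_ hμ1
    linarith only [hq, n1]
  obtain ⟨θ, hθ⟩ := hU.sup _ _ _ (show (pt y s).snd ∈ Set.Ioi 0 from hs) jy e he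
  have hx := hU.sub _ _ _ (show (pt x t).snd ∈ Set.Ioi 0 from ht) jx θ
  have hz := hV.sub _ _ _ (show (pt z t).snd ∈ Set.Ioi 0 from ht) jz θ
  have l1 := jet_fst_le hL hU.lip jx
  have l2 := jet_fst_le (L := L) hL (fun X d => by
    rw [neg_sub_neg, abs_sub_comm]; exact hU.lip X d) jy
  have l3 := jet_fst_le hL hV.lip jz
  simp only [pt_fst, pt_snd] at hθ hx hz l1 l2 l3
  have q1 := D.tq_small (hdeg θ) x (k := 2 / β + 2 * K + 2) (e := e) (by positivity)
    (le_trans (by gcongr; exact D.nn) hb5)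
  have q2 := D.tq_small (hdeg θ) y (k := 1 / (β * μ)) (e := e) (by positivity)
    (le_trans (by gcongr; exact D.nn) hb6)
  have q3 := D.tq_small (hdeg θ) z (k := 1 / (β * (μ-1))) (e := e) (by positivity)
    (le_trans (by gcongr; exact D.nn) hb7)
  have htt' : |2 * (t - t0)| ≤ e := abs_le_of_sq_le_sq (by linarith only [htt, hb3]) he.le
  rw [abs_le] at htt'
  refine ⟨θ, _, -((1/(β * μ)) • (y - x)), _, x, y, z, l1, by rwa [norm_neg], l3, ?_, hsm y hwy, hsm z hwz, ?_, ?_, ?_, ?_⟩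
  · exact le_of_sq he.le (by linarith only [hxK, hbK, hb3, sq_nonneg e])
  · linarith only [hθ, q2]
  · linarith only [hz, q3]
  · linarith only [hx, q1, htt'.1, htt'.2]
  · have : (1/β) • ((x - y) + (x - z)) + (2 * K) • (x - y0) - (μ • (-((1/(β * μ)) • (y - x))) - (μ - 1) • ((1/(β * (μ-1))) • (z - x)))
        = (2 * K) • (x - y0) := by
      rw [smul_neg, smul_smul, smul_smul]
      have e1 : μ * (1 / (β * μ)) = 1/β := by field_simp
      have e2 : (μ-1) * (1 / (β * (μ-1))) = 1/β := by field_simp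
      rw [e1, e2]; module
    rw [this, norm_smul, Real.norm_of_nonneg (by positivity)]
    refine le_of_sq he.le ?_
    have := mul_le_mul_of_nonneg_left hx0 hK0.le
    linarith only [this, hb4]

/-- no near-maximum on the degenerate set. -/
theorem sig_no (D : Dat σ H Λ) (hL : 0 ≤ L) {S : Set (E N)} {U : VN N → ℝ} {v : E N → ℝ} (hU : Sol σ H L U) (hV : Sol σ H L (fun X => v X.fst))
    (hvc : Continuous v) (hS : ∀ y ∈ S, ∀ θ k, col (σ θ y) k = 0)
    (hsc : ∀ R r lam : ℝ, 0 < r → 0 < lam → lam < 1 → ∃ γ > 0, ∀ y ∈ S, ∀ p q, ‖p‖ ≤ R → ‖q‖ ≤ R → r ≤ ‖p - q‖ → ∀ θ,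
      γ ≤ lam * H θ y p + (1 - lam) * H θ y q - H θ y (lam • p + (1 - lam) • q))
    {M0 M η μ : ℝ}
    (hUv : ∀ x t, 0 ≤ t → v x ≤ U (pt x t)) (hM0 : ∀ x t, 0 ≤ t → |U (pt x t)| ≤ M0) (hvM : ∀ x, |v x| ≤ M0)
    (hμ : 1 < μ) (hη : 0 < η) (hM : 0 < M) :
    ∃ ρ > (0:ℝ), ∀ t0 y0 τ0, 1 < t0 → y0 ∈ S → 0 ≤ τ0 → M - ρ ≤ QQ U v μ η y0 t0 τ0 →
      (∀ x t τ, t0 - 1 ≤ t → 0 ≤ τ → QQ U v μ η x t τ ≤ M + ρ) → False := by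
  have hμ0 : 0 < μ := by linarith only [hμ]
  obtain ⟨C1, hC1, hlip⟩ := D.hlip (L + 1) (by linarith only [hL])
  set r := η / (2 * C1) with hr
  have hr0 : 0 < r := by positivity
  have hCr : C1 * r = η / 2 := by rw [hr]; field_simp
  obtain ⟨γ, hγ, hsc⟩ := hsc L r (1/μ) hr0 (by positivity) (by rw [div_lt_one hμ0]; exact hμ)
  set e := min (γ / (2 * (5 + 6 * C1))) (η / (4 * (3 + 5 * C1))) with hedef
  have he : 0 < e := by positivity
  have h1 : e ≤ γ / (2 * (5 + 6 * C1)) := min_le_left _ _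
  have h2 : e ≤ η / (4 * (3 + 5 * C1)) := min_le_right _ _
  rw [le_div_iff₀ (by positivity)] at h1 h2
  obtain ⟨ρ, hρ, hA⟩ := sigA D hL hU hV hvc hUv hM0 hvM hμ hη hM he
  refine ⟨ρ, hρ, fun t0 y0 τ0 ht0 hy0 hτ0 hQ0 hQ => ?_⟩
  obtain ⟨θ, p1, p2, p3, x, y, z, n1, n2, n3, hx, hy, hz, k2, k3, k1, hp⟩ := hA t0 y0 τ0 ht0 (hS y0 hy0) hτ0 hQ0 hQ
  have hl : ∀ w p a, ‖p‖ ≤ L → ‖w - y0‖ ≤ a → |H θ w p - H θ y0 p| ≤ C1 * a := by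
    intro w p a hp hw
    have := hlip θ w y0 p p (by linarith only [hp]) (by linarith only [hp])
    rw [sub_self, norm_zero, add_zero] at this
    exact this.trans (mul_le_mul_of_nonneg_left hw hC1.le)
  have a1 := abs_le.1 (hl x p1 _ n1 hx)
  have a2 := abs_le.1 (hl y p2 _ n2 hy)
  have a3 := abs_le.1 (hl z p3 _ n3 hz)
  refine sigB (F := H θ y0) (γ := γ) hC1.le hμ he hη hr0.le (fun p q hp hq => ?_) (fun p q hp hq hpq => hsc y0 hy0 p q hp hq hpq θ)
    (by linarith only [h1, hγ]) (by linarith only [h2, hη, hCr]) n1 n2 n3 (by linarith only [k2, a2.2]) (by linarith only [k3, a3.1])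
    (by linarith only [k1, a1.1]) hp
  have := hlip θ y0 y0 p q (by linarith only [hp]) (by linarith only [hq])
  rwa [sub_self, norm_zero, zero_add] at this
end

section
variable {N : ℕ} {Θ : Type*} {A σ : Θ → E N → Matrix (Fin N) (Fin N) ℝ} {H : Θ → E N → E N → ℝ} {Λ L C1 : ℝ}

set_option maxHeartbeats 1000000 in
lemma usc (D : Dat σ H Λ) {S : Set (E N)} (hcl : IsClosed S) (hper : ∀ (θ : Θ) (p : E N), ZPeriodic fun x => H θ x p)
    (hSper : ZPeriodic (fun x => x ∈ S))
    (hs : ∀ x ∈ S, ∀ lam : ℝ, 0 < lam → lam < 1 → ∀ p q : E N, p ≠ q → ∃ γ > 0, ∀ θ,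
      γ ≤ lam * H θ x p + (1 - lam) * H θ x q - H θ x (lam • p + (1 - lam) • q))
    (R r lam : ℝ) (hr : 0 < r) (hl0 : 0 < lam) (hl1 : lam < 1) : ∃ γ > 0, ∀ y ∈ S, ∀ p q, ‖p‖ ≤ R → ‖q‖ ≤ R → r ≤ ‖p - q‖ → ∀ θ,
      γ ≤ lam * H θ y p + (1 - lam) * H θ y q - H θ y (lam • p + (1 - lam) • q) := by
  obtain ⟨C1, hC1, hlip⟩ := D.hlip (|R| + 1) (by positivity)
  have hRR := le_abs_self R
  set K : Set (E N × E N × E N) := ((Metric.closedBall 0 (√N) ∩ S) ×ˢ Metric.closedBall 0 R ×ˢ Metric.closedBall 0 R) ∩ {a | r ≤ ‖a.2.1 - a.2.2‖} with hK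
  have hcpt : IsCompact K := by
    refine IsCompact.inter_right ?_ (isClosed_le (by fun_prop) (by fun_prop))
    exact ((isCompact_closedBall _ _).inter_right hcl).prod ((isCompact_closedBall _ _).prod (isCompact_closedBall _ _))
  have main : ∃ γ > 0, ∀ a ∈ K, ∀ θ, γ ≤ lam * H θ a.1 a.2.1 + (1 - lam) * H θ a.1 a.2.2 - H θ a.1 (lam • a.2.1 + (1 - lam) • a.2.2) := by
    refine hcpt.induction_on (p := fun s => ∃ γ > 0, ∀ a ∈ s, ∀ θ, γ ≤ lam * H θ a.1 a.2.1 + (1 - lam) * H θ a.1 a.2.2 - H θ a.1 (lam • a.2.1 + (1 - lam) • a.2.2))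
      ⟨1, one_pos, fun a ha => ha.elim⟩ ?_ ?_ ?_
    · rintro s t hst ⟨γ, hγ, h⟩
      exact ⟨γ, hγ, fun a ha => h a (hst ha)⟩
    · rintro s t ⟨γ, hγ, h⟩ ⟨γ', hγ', h'⟩
      refine ⟨min γ γ', lt_min hγ hγ', fun a ha θ => ?_⟩
      rcases ha with ha | ha
      · exact (min_le_left _ _).trans (h a ha θ)
      · exact (min_le_right _ _).trans (h' a ha θ)
    · rintro ⟨y, p, q⟩ ⟨⟨hy, hp, hq⟩, hpq⟩
      simp only [Set.mem_ofPred_eq, mem_closedBall_zero_iff] at hp hq hpq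
      obtain ⟨γ, hγ, h⟩ := hs y hy.2 lam hl0 hl1 p q (by
        rintro rfl
        rw [sub_self, norm_zero] at hpq
        exact absurd hpq (not_le.2 hr))
      refine ⟨K ∩ Metric.ball (y, p, q) (γ / (12 * C1)), inter_mem_nhdsWithin _ (Metric.ball_mem_nhds _ (by positivity)), γ / 2, by positivity, ?_⟩
      rintro ⟨y', p', q'⟩ ⟨⟨⟨hy', hp', hq'⟩, -⟩, hd⟩ θ
      simp only [mem_closedBall_zero_iff] at hp' hq'
      rw [Metric.mem_ball, Prod.dist_eq, Prod.dist_eq] at hd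
      simp only [max_lt_iff, dist_eq_norm] at hd
      obtain ⟨d1, d2, d3⟩ := hd
      rw [lt_div_iff₀ (by positivity)] at d1 d2 d3
      have hlo : 0 ≤ 1 - lam := by linarith
      have hcomb : ∀ a b : E N, ‖a‖ ≤ R → ‖b‖ ≤ R → ‖lam • a + (1 - lam) • b‖ ≤ R := by
        intro a b ha hb
        refine (norm_add_le _ _).trans ?_
        rw [norm_smul, norm_smul, Real.norm_of_nonneg hl0.le, Real.norm_of_nonneg hlo]
        have e1 := mul_le_mul_of_nonneg_left ha hl0.le
        have e2 := mul_le_mul_of_nonneg_left hb hlo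
        linarith only [e1, e2]
      have a1 := mul_le_mul_of_nonneg_left (abs_le.1 (hlip θ y' y p' p (by linarith only [hp', hRR]) (by linarith only [hp, hRR]))).1 hl0.le
      have a2 := mul_le_mul_of_nonneg_left (abs_le.1 (hlip θ y' y q' q (by linarith only [hq', hRR]) (by linarith only [hq, hRR]))).1 hlo
      have a3 := (abs_le.1 (hlip θ y' y (lam • p' + (1 - lam) • q') (lam • p + (1 - lam) • q) (by linarith only [hcomb p' q' hp' hq', hRR]) (by linarith only [hcomb p q hp hq, hRR]))).2
      have a4 : ‖lam • p' + (1 - lam) • q' - (lam • p + (1 - lam) • q)‖ ≤ lam * ‖p' - p‖ + (1 - lam) * ‖q' - q‖ := by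
        have : lam • p' + (1 - lam) • q' - (lam • p + (1 - lam) • q) = lam • (p' - p) + (1 - lam) • (q' - q) := by module
        rw [this]
        refine (norm_add_le _ _).trans ?_
        rw [norm_smul, norm_smul, Real.norm_of_nonneg hl0.le, Real.norm_of_nonneg hlo]
      have a5 := mul_le_mul_of_nonneg_left a4 hC1.le
      have a6 := h θ
      have b1 : 0 ≤ ‖p' - p‖ * C1 * (1 - lam) := by positivity
      have b2 : 0 ≤ ‖q' - q‖ * C1 * lam := by positivity
      simp only
      linarith only [a1, a2, a3, a5, a6, d1, d2, d3, b1, b2]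
  obtain ⟨γ, hγ, h⟩ := main
  refine ⟨γ, hγ, fun y hy p q hp hq hpq θ => ?_⟩
  obtain ⟨k, y', hy', hb⟩ := per_red y 0
  have hb2 := box_norm hb
  have hyS : y' ∈ S := by
    have := hSper y k
    rw [hy']; exact (iff_of_eq this).2 hy
  have hH : ∀ p, H θ y' p = H θ y p := fun p => by rw [hy']; exact hper θ p y k
  have := h (y', p, q) ⟨⟨⟨?_, hyS⟩, by simpa using hp, by simpa using hq⟩, hpq⟩ θ
  · simp only [hH] at this
    exact this
  · rw [mem_closedBall_zero_iff]
    rw [sub_zero] at hb2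
    exact Real.le_sqrt_of_sq_le hb2

lemma net {ι : Type*} {l : Filter ι} [NeBot l] {F : ι → E N → ℝ} {w : E N → ℝ} (hL : 0 ≤ L) (hl : ∀ i x y, |F i x - F i y| ≤ L * ‖x - y‖)
    (hper : ∀ i, ZPeriodic (F i)) (hlim : ∀ x, Tendsto (fun i => F i x) l (𝓝 (w x))) :
    (∀ x y, |w x - w y| ≤ L * ‖x - y‖) ∧ ZPeriodic w ∧ ∀ ε > 0, ∀ᶠ i in l, ∀ x, |F i x - w x| ≤ ε := by
  have hw : ∀ x y, |w x - w y| ≤ L * ‖x - y‖ := fun x y =>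
    le_of_tendsto ((hlim x).sub (hlim y)).abs (Eventually.of_forall fun i => hl i x y)
  have hwp : ZPeriodic w := fun x k => tendsto_nhds_unique (hlim _) ((hlim x).congr fun i => (hper i x k).symm)
  refine ⟨hw, hwp, fun ε hε => ?_⟩
  have main : ∀ᶠ i in l, ∀ x ∈ Metric.closedBall (0 : E N) (√N), |F i x - w x| ≤ ε := by
    refine (isCompact_closedBall (0 : E N) (√N)).induction_on (p := fun s => ∀ᶠ i in l, ∀ x ∈ s, |F i x - w x| ≤ ε) (by simp) ?_ ?_ ?_
    · intro s t hst h
      filter_upwards [h] with i h x hx using h x (hst hx)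
    · intro s t h h'
      filter_upwards [h, h'] with i h h' x hx
      exact hx.elim (h x) (h' x)
    · intro x hx
      refine ⟨Metric.ball x (ε / (4 * (L + 1))), mem_nhdsWithin_of_mem_nhds (Metric.ball_mem_nhds _ (by positivity)), ?_⟩
      have h1 : ∀ᶠ i in l, |F i x - w x| < ε / 2 := by
        have := (hlim x).sub_const (w x)
        rw [sub_self] at this
        have := this.abs
        rw [abs_zero] at this
        exact this.eventually (gt_mem_nhds (by positivity))
      filter_upwards [h1] with i h1 y hy
      rw [mem_ball_iff_norm, lt_div_iff₀ (by positivity)] at hy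
      have e1 := abs_le.1 (hl i y x)
      have e2 := abs_le.1 (hw y x)
      have e3 := abs_lt.1 h1
      have e4 : 0 ≤ ‖y - x‖ := norm_nonneg _
      rw [abs_le]
      constructor <;> linarith only [e1.1, e1.2, e2.1, e2.2, e3.1, e3.2, e4, hy]
  filter_upwards [main] with i h x
  obtain ⟨k, y, hy, hb⟩ := per_red x 0
  have hb2 := box_norm hb
  rw [sub_zero] at hb2
  have := h y (by rw [mem_closedBall_zero_iff]; exact Real.le_sqrt_of_sq_le hb2)
  rw [hy, hper i x k, hwp x k] at this
  exact this

set_option maxHeartbeats 1000000 in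
theorem partD1 (D : Dat σ H Λ) (hL : 0 ≤ L) {S : Set (E N)} {x0 : E N} (hx0 : x0 ∈ S) {U : VN N → ℝ} {v : E N → ℝ} (hU : Sol σ H L U) (hV : Sol σ H L (fun X => v X.fst))
    (hvc : Continuous v) (hS : ∀ y ∈ S, ∀ θ k, col (σ θ y) k = 0)
    (hell : ∀ δ > 0, ∃ ν > (0:ℝ), ∀ x, (∀ y ∈ S, δ < dist x y) → ∀ θ y, ν * ‖y‖^2 ≤ ∑ k, ⟪col (σ θ x) k, y⟫^2)
    (hsc : ∀ R r lam : ℝ, 0 < r → 0 < lam → lam < 1 → ∃ γ > 0, ∀ y ∈ S, ∀ p q, ‖p‖ ≤ R → ‖q‖ ≤ R → r ≤ ‖p - q‖ → ∀ θ,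
      γ ≤ lam * H θ y p + (1 - lam) * H θ y q - H θ y (lam • p + (1 - lam) • q))
    {M0 η μ : ℝ}
    (hUv : ∀ x t, 0 ≤ t → v x ≤ U (pt x t)) (hM0 : ∀ x t, 0 ≤ t → |U (pt x t)| ≤ M0) (hvM : ∀ x, |v x| ≤ M0)
    (hμ : 1 < μ) (hη : 0 < η) {ρ0 : ℝ} (hρ0 : 0 < ρ0) : ∃ T, ∀ x t τ, T ≤ t → 0 ≤ τ → QQ U v μ η x t τ ≤ ρ0 := by
  by_contra hcon
  have hμ0 : 0 < μ := by linarith only [hμ]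
  have hμ1 : 0 ≤ μ - 1 := by linarith only [hμ]
  have hM00 : 0 ≤ M0 := (abs_nonneg _).trans (hvM x0)
  obtain ⟨C1, hC0, hC1⟩ := D.hlip (L + 1) (by linarith only [hL])
  have hC1' : ∀ (θ : Θ) (x y p q : E N), ‖p‖ ≤ L → ‖q‖ ≤ L → |H θ x p - H θ y q| ≤ C1 * (‖x - y‖ + ‖p - q‖) :=
    fun θ x y p q hp hq => hC1 θ x y p q (by linarith only [hp]) (by linarith only [hq])
  have hmono : ∀ a b : ℝ, a ≤ b → (∃ T, ∀ x t τ, T ≤ t → 0 ≤ τ → QQ U v μ η x t τ ≤ a) → (∃ T, ∀ x t τ, T ≤ t → 0 ≤ τ → QQ U v μ η x t τ ≤ b) :=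
    fun a b hab ⟨T, h⟩ => ⟨T, fun x t τ h1 h2 => (h x t τ h1 h2).trans hab⟩
  obtain ⟨m, h1, h2⟩ := exists_level (Q := fun k => ∃ T, ∀ x t τ, T ≤ t → 0 ≤ τ → QQ U v μ η x t τ ≤ k) hmono (a := 2 * μ * M0)
    ⟨0, fun x t τ ht hτ => by
      have e1 := (abs_le.1 (hM0 x t ht)).2
      have e2 := mul_le_mul_of_nonneg_left (abs_le.1 (hM0 x (t + τ) (by linarith only [ht, hτ]))).1 hμ0.le
      have e3 := mul_le_mul_of_nonneg_left (abs_le.1 (hvM x)).2 hμ1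
      have e4 : 0 ≤ μ * η * τ := by positivity
      unfold QQ
      linarith only [e1, e2, e3, e4]⟩ hcon
  have hm : 0 < m := by
    by_contra! hm
    exact hcon (hmono _ _ (by linarith only [hm]) (h1 ρ0 hρ0))
  obtain ⟨ρs, hρs, hno⟩ := sig_no D hL hU hV hvc hS hsc hUv hM0 hvM hμ hη hm
  set δ := ρs / (2 * (2 * μ * L + 1)) with hδd
  have hδ : 0 < δ := by positivity
  have hδ2 : 2 * μ * L * δ ≤ ρs / 2 := by
    have : δ * (2 * (2 * μ * L + 1)) = ρs := by rw [hδd]; field_simp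
    linarith only [this, hδ]
  obtain ⟨ν, hν, hellν⟩ := hell δ hδ
  obtain ⟨ρ', hρ', T1, hT1, hst⟩ := strip D hC0.le hx0 hδ hν hellν (show 0 < ρs / 2 by positivity)
  obtain ⟨T, hT⟩ := h1 (min ρ' ρs) (lt_min hρ' hρs)
  have h3 := h2 ρ' hρ'
  push Not at h3
  obtain ⟨x, t, τ, ht, hτ, hq⟩ := h3 (max T 1 + T1 + 2)
  have hTm := le_max_left T 1
  have hTm1 := le_max_right T 1
  have hW : ∀ x t, QQ U v μ η x t τ = U (pt x t) - μ * U (pt x (t + τ)) + (μ - 1) * v x - μ * η * τ := fun x t => rfl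
  have hsh := hU.shift hτ
  obtain ⟨x', t', htt, ⟨y, hyS, hyd⟩, hval⟩ := hst (fun X => U X - μ * U (pt X.fst (X.snd + τ)) + (μ - 1) * v X.fst) (m + μ * η * τ) t
    (hU.DI D hL hC0.le hC1' hμ hsh hV)
    ((hU.cont.sub (hsh.cont.const_mul μ)).add (hV.cont.const_mul (μ - 1)))
    (fun t x k => by
      have e1 := hU.per t x k
      have e2 := hsh.per t x k
      have e3 := hV.per t x k
      simp only [pt_fst, pt_snd] at e1 e2 e3 ⊢
      rw [e1, e2, e3]) (by linarith only [ht, hTm1])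
    (fun x s hs => by
      have := hT x s τ (by have := (abs_le.1 hs).1; linarith only [this, ht, hTm]) hτ
      rw [hW] at this
      simp only [pt_fst, pt_snd]
      have hmin := min_le_left ρ' ρs
      linarith only [this, hmin])
    ⟨x, by
      rw [hW] at hq
      simp only [pt_fst, pt_snd]
      linarith only [hq]⟩
  simp only [pt_fst, pt_snd] at hval
  have ht' := (abs_le.1 htt).1
  refine hno t' y τ (by linarith only [ht', ht, hTm1]) hyS hτ ?_ (fun x s r hs hr => ?_)
  · rw [hW]
    have e1 := (abs_le.1 (hU.lipx x' y t')).2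
    have e2 := mul_le_mul_of_nonneg_left (abs_le.1 (hU.lipx x' y (t' + τ))).1 hμ0.le
    have e3 := hV.lipx x' y 0
    simp only [pt_fst] at e3
    have e3 := mul_le_mul_of_nonneg_left (abs_le.1 e3).2 hμ1
    rw [dist_eq_norm] at hyd
    have e4 := mul_le_mul_of_nonneg_left hyd (show 0 ≤ 2 * μ * L by positivity)
    linarith only [e1, e2, e3, e4, hval, hδ2]
  · refine (hT x s r (by linarith only [ht', ht, hTm, hs]) hr).trans ?_
    have hmin := min_le_right ρ' ρs
    linarith only [hmin]

theorem partD2 (D : Dat σ H Λ) (hL : 0 ≤ L) {S : Set (E N)} {x0 : E N} (hx0 : x0 ∈ S) {U : VN N → ℝ} {v : E N → ℝ} (hU : Sol σ H L U) (hV : Sol σ H L (fun X => v X.fst))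
    (hvc : Continuous v) (hS : ∀ y ∈ S, ∀ θ k, col (σ θ y) k = 0)
    (hell : ∀ δ > 0, ∃ ν > (0:ℝ), ∀ x, (∀ y ∈ S, δ < dist x y) → ∀ θ y, ν * ‖y‖^2 ≤ ∑ k, ⟪col (σ θ x) k, y⟫^2)
    (hsc : ∀ R r lam : ℝ, 0 < r → 0 < lam → lam < 1 → ∃ γ > 0, ∀ y ∈ S, ∀ p q, ‖p‖ ≤ R → ‖q‖ ≤ R → r ≤ ‖p - q‖ → ∀ θ,
      γ ≤ lam * H θ y p + (1 - lam) * H θ y q - H θ y (lam • p + (1 - lam) • q))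
    {M0 : ℝ}
    (hUv : ∀ x t, 0 ≤ t → v x ≤ U (pt x t)) (hM0 : ∀ x t, 0 ≤ t → |U (pt x t)| ≤ M0) (hvM : ∀ x, |v x| ≤ M0)
    {ρ τ : ℝ} (hρ : 0 < ρ) (hτ : 0 ≤ τ) : ∃ T, ∀ x t, T ≤ t → U (pt x t) - U (pt x (t + τ)) ≤ ρ := by
  have hM00 : 0 ≤ M0 := (abs_nonneg _).trans (hvM x0)
  set κ := ρ / (6 * (M0 + 1) + ρ) with hκ
  have hκ0 : 0 < κ := by positivity
  have hκe : κ * (6 * (M0 + 1) + ρ) = ρ := by rw [hκ]; field_simp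
  have hκ1 : κ ≤ 1 := by rw [hκ, div_le_one (by positivity)]; linarith only [hM00]
  set η := ρ / (6 * (τ + 1)) with hη
  have hη0 : 0 < η := by positivity
  have hηe : η * (6 * (τ + 1)) = ρ := by rw [hη]; field_simp
  obtain ⟨T, hT⟩ := partD1 D hL hx0 hU hV hvc hS hell hsc hUv hM0 hvM (μ := 1 + κ) (by linarith only [hκ0]) hη0 (show 0 < ρ / 3 by positivity)
  refine ⟨max T 0, fun x t ht => ?_⟩
  have ht0 := (le_max_right T 0).trans ht
  have h := hT x t τ ((le_max_left T 0).trans ht) hτ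
  unfold QQ at h
  have e1 := mul_le_mul_of_nonneg_left (abs_le.1 (hM0 x (t + τ) (by linarith only [ht0, hτ]))).2 hκ0.le
  have e2 := mul_le_mul_of_nonneg_left (abs_le.1 (hvM x)).1 hκ0.le
  have e3 : κ * (η * τ) ≤ 1 * (η * τ) := mul_le_mul_of_nonneg_right hκ1 (by positivity)
  have e4 : 0 ≤ κ * ρ := by positivity
  linarith only [h, e1, e2, e3, hκe, hηe, hκ0, hη0, e4]

theorem partD3 (D : Dat σ H Λ) (hL : 0 ≤ L) {U : VN N → ℝ} (hU : Sol σ H L U) {M0 : ℝ} (hM0 : ∀ x t, 0 ≤ t → |U (pt x t)| ≤ M0)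
    (hmon : ∀ ρ > 0, ∀ τ ≥ 0, ∃ T, ∀ x t, T ≤ t → U (pt x t) - U (pt x (t + τ)) ≤ ρ) :
    ∃ w : E N → ℝ, ∀ ε > 0, ∃ T, ∀ t ≥ T, ∀ x, |U (pt x t) - w x| ≤ ε := by
  set 𝒰 : Ultrafilter ℝ := Ultrafilter.of atTop with h𝒰
  have hle : (𝒰 : Filter ℝ) ≤ atTop := Ultrafilter.of_le _
  have hex : ∀ x t, ∃ z, Tendsto (fun s => U (pt x (s + max t 0))) 𝒰 (𝓝 z) := by
    intro x t
    have h1 : ∀ᶠ s in (𝒰 : Filter ℝ), U (pt x (s + max t 0)) ∈ Set.Icc (-M0) M0 := by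
      refine hle ?_
      filter_upwards [eventually_ge_atTop 0] with s hs
      exact abs_le.1 (hM0 x _ (add_nonneg hs (le_max_right _ _)))
    obtain ⟨z, -, hz⟩ := (isCompact_Icc (a := -M0) (b := M0)).ultrafilter_le_nhds (𝒰.map fun s => U (pt x (s + max t 0)))
      (le_principal_iff.2 h1)
    exact ⟨z, hz⟩
  choose z hz using hex
  have hz' : ∀ x t, 0 ≤ t → Tendsto (fun s => U (pt x (s + t))) 𝒰 (𝓝 (z x t)) := by
    intro x t ht
    have := hz x t
    rwa [max_eq_left ht] at this
  have hzM : ∀ x t, 0 ≤ t → z x t ≤ M0 := fun x t ht => by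
    refine le_of_tendsto (hz' x t ht) (hle ?_)
    filter_upwards [eventually_ge_atTop 0] with s hs
    exact (abs_le.1 (hM0 x _ (add_nonneg hs ht))).2
  have hmono : ∀ x t t', 0 ≤ t → t ≤ t' → z x t ≤ z x t' := by
    intro x t t' ht htt
    refine le_of_forall_pos_le_add fun ρ hρ => ?_
    obtain ⟨T, hT⟩ := hmon ρ hρ (t' - t) (by linarith)
    have := (hz' x t ht).sub (hz' x t' (ht.trans htt))
    have h2 : z x t - z x t' ≤ ρ := le_of_tendsto this (hle (by
      filter_upwards [eventually_ge_atTop T] with s hs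
      have := hT x (s + t) (by linarith)
      rwa [show s + t + (t' - t) = s + t' by ring] at this))
    linarith
  have hmono' : ∀ x, Monotone (fun t => z x (max t 0)) := fun x a b hab =>
    hmono x _ _ (le_max_right _ _) (max_le_max_right _ hab)
  have hlim : ∀ x, Tendsto (fun t => z x (max t 0)) atTop (𝓝 (⨆ t, z x (max t 0))) := fun x =>
    tendsto_atTop_ciSup (hmono' x) ⟨M0, by rintro _ ⟨t, rfl⟩; exact hzM x _ (le_max_right _ _)⟩
  have net1 : ∀ t : ℝ, 0 ≤ t → _ := fun t ht => net (l := (𝒰 : Filter ℝ)) (F := fun s x => U (pt x (s + t))) (w := fun x => z x t) hL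
    (fun s x y => hU.lipx x y _) (fun s => hU.per _) (fun x => hz' x t ht)
  obtain ⟨-, -, net2⟩ := net (l := (atTop : Filter ℝ)) (F := fun t x => z x (max t 0)) (w := fun x => ⨆ t, z x (max t 0)) hL
    (fun t x y => (net1 _ (le_max_right t 0)).1 x y) (fun t => (net1 _ (le_max_right t 0)).2.1) hlim
  refine ⟨fun x => ⨆ t, z x (max t 0), fun ε hε => ?_⟩
  have hA := (net1 0 le_rfl).2.2 (ε / 4) (by positivity)
  have hAp : ∀ᶠ s in (𝒰 : Filter ℝ), 0 ≤ s := hle (eventually_ge_atTop 0)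
  obtain ⟨s, hs, hs0⟩ := (hA.and hAp).exists
  simp only [add_zero] at hs hA
  have hcontr : ∀ x t, 0 ≤ t → |U (pt x (s + t)) - z x t| ≤ ε / 2 := by
    intro x t ht
    have h1 : Tendsto (fun s' => |U (pt x (s + t)) - U (pt x (s' + t))|) 𝒰 (𝓝 |U (pt x (s + t)) - z x t|) :=
      (tendsto_const_nhds.sub (hz' x t ht)).abs
    refine le_of_tendsto h1 ?_
    filter_upwards [hA, hAp] with s' hs' hs0'
    have key : ∀ x, |U (pt x s) - U (pt x s')| ≤ ε / 2 := fun x => by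
      have e1 := abs_le.1 (hs x)
      have e2 := abs_le.1 (hs' x)
      rw [abs_le]; constructor <;> linarith only [e1.1, e1.2, e2.1, e2.2]
    have c1 := (hU.shift hs0).comp D hL (hU.shift hs0') (m := ε / 2) le_rfl (fun x => by
      simp only [pt_fst, pt_snd, zero_add]; exact (abs_le.1 (key x)).2) ht x
    have c2 := (hU.shift hs0').comp D hL (hU.shift hs0) (m := ε / 2) le_rfl (fun x => by
      simp only [pt_fst, pt_snd, zero_add]; linarith only [(abs_le.1 (key x)).1]) ht x
    simp only [pt_fst, pt_snd] at c1 c2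
    rw [add_comm t s, add_comm t s'] at c1 c2
    rw [abs_le]; constructor <;> linarith only [c1, c2]
  obtain ⟨T, hT⟩ := eventually_atTop.1 (net2 (ε / 2) (by positivity))
  refine ⟨s + max T 0, fun t ht x => ?_⟩
  have ht0 : 0 ≤ t - s := by have := le_max_right T 0; linarith only [this, ht]
  have e1 := abs_le.1 (hcontr x (t - s) ht0)
  have e2 := abs_le.1 (hT (t - s) (by have := le_max_left T 0; linarith only [this, ht]) x)
  rw [add_sub_cancel] at e1
  rw [max_eq_left ht0] at e2
  rw [abs_le]; constructor <;> linarith only [e1.1, e1.2, e2.1, e2.2]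
end

section
variable {N : ℕ} {Θ : Type*} {A σ : Θ → E N → Matrix (Fin N) (Fin N) ℝ} {H : Θ → E N → E N → ℝ} {Λ L C1 : ℝ}

lemma io_adj (Y : VN N) : (io N).adjoint Y = Y.fst := by
  refine ext_inner_right ℝ fun d => ?_
  rw [ContinuousLinearMap.adjoint_inner_left]
  have : io N d = pt d 0 := rfl
  rw [this, ← pt_eta Y, inner_pt]; simp

set_option maxHeartbeats 1000000 in
lemma stab_jet {f : VN N → ℝ} (hf : Continuous f) {w : E N → ℝ} (hu : ∀ ε > 0, ∃ T, ∀ t ≥ T, ∀ x, |f (pt x t) - w x| ≤ ε)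
    {x0 g : E N} {M0 : E N →L[ℝ] E N} (hj : UJet w x0 g M0) {α : ℝ} (hα : 0 < α) :
    ∃ B : VN N →L[ℝ] VN N, (∀ S : Matrix (Fin N) (Fin N) ℝ, tq S B = ∑ k, ⟪M0 (col S k), col S k⟫ + 4 * α * ∑ k, ‖col S k‖^2) ∧
      ∀ κ > 0, ∃ X p, X.snd ∈ Set.Ioi 0 ∧ UJet f X p B ∧ ‖X.fst - x0‖ ≤ κ ∧ ‖p.fst - g‖ ≤ κ ∧ |p.snd| ≤ κ := by
  obtain ⟨M, hsym, hMq⟩ : ∃ M : E N →L[ℝ] E N, (∀ a b, ⟪M a, b⟫ = ⟪M b, a⟫) ∧ ∀ d, ⟪M d, d⟫ = ⟪M0 d, d⟫ := by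
    refine ⟨(1/2 : ℝ) • (M0 + M0.adjoint), fun a b => ?_, fun d => ?_⟩
    · simp only [smul_apply, add_apply, inner_smul_left, inner_add_left, ContinuousLinearMap.adjoint_inner_left, RCLike.conj_to_real]
      rw [real_inner_comm (M0 b) a, real_inner_comm (M0 a) b]; ring
    · simp only [smul_apply, add_apply, inner_smul_left, inner_add_left, ContinuousLinearMap.adjoint_inner_left, RCLike.conj_to_real]
      rw [real_inner_comm (M0 d) d]; ring
  set B : VN N →L[ℝ] VN N := io N ∘L (M + (2 * α) • ContinuousLinearMap.id ℝ (E N)) ∘L (io N).adjoint + (2 * α) • ContinuousLinearMap.id ℝ (VN N) with hB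
  have hBq : ∀ d s, ⟪B (pt d s), pt d s⟫ = ⟪M0 d, d⟫ + 4 * α * ‖d‖^2 + 2 * α * s^2 := by
    intro d s
    have e1 : ∀ a : E N, ⟪io N a, pt d s⟫ = ⟪a, d⟫ := fun a => by
      have : io N a = pt a 0 := rfl
      rw [this, inner_pt]; simp
    rw [hB]
    simp only [smul_apply, add_apply, inner_smul_left, inner_add_left, ContinuousLinearMap.comp_apply, RCLike.conj_to_real, io_adj, pt_fst, e1,
      ContinuousLinearMap.id_apply, real_inner_self_eq_norm_sq, norm_pt_sq, hMq]
    ring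
  refine ⟨B, fun S => ?_, fun κ hκ => ?_⟩
  · unfold tq
    simp only [hBq]
    rw [Finset.mul_sum, ← Finset.sum_add_distrib]
    simp
  obtain ⟨r, hr, hball⟩ := Metric.eventually_nhds_iff_ball.1 (hj α hα)
  set r' := min (r / 2) 1 with hr'
  have hr'0 : 0 < r' := by positivity
  set κ' := min (r' / 2) (min (1/2) (min κ (κ / (‖M‖ + 4 * α + 1)))) with hκ'
  have hκ'0 : 0 < κ' := by positivity
  have k1 : κ' ≤ r' / 2 := min_le_left _ _
  have k2 : κ' ≤ 1/2 := (min_le_right _ _).trans (min_le_left _ _)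
  have k3 : κ' ≤ κ := (min_le_right _ _).trans ((min_le_right _ _).trans (min_le_left _ _))
  have k4 : κ' ≤ κ / (‖M‖ + 4 * α + 1) := (min_le_right _ _).trans ((min_le_right _ _).trans (min_le_right _ _))
  rw [le_div_iff₀ (by positivity)] at k4
  set ε := α * κ'^2 / 2 with hε
  have hε0 : 0 < ε := by positivity
  obtain ⟨T0, hT0⟩ := hu ε hε0
  set T := max T0 0 + 2 with hT
  have hTa := le_max_left T0 0
  have hTb := le_max_right T0 0
  set Ψ : E N × ℝ → ℝ := fun q => f (pt q.1 q.2) - ⟪g, q.1 - x0⟫ - (1/2) * ⟪M (q.1 - x0), q.1 - x0⟫ - 2 * α * ‖q.1 - x0‖^2 - α * (q.2 - T)^2 with hΨ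
  have hcont : Continuous Ψ := by
    have c1 : Continuous (fun q : E N × ℝ => f (pt q.1 q.2)) := hf.comp continuous_pt
    have c2 : Continuous (fun q : E N × ℝ => q.1 - x0) := by fun_prop
    exact (((c1.sub (continuous_const.inner c2)).sub (((M.continuous.comp c2).inner c2).const_mul _)).sub (by fun_prop)).sub (by fun_prop)
  obtain ⟨⟨x, t⟩, ⟨hx, ht⟩, hmax⟩ := ((isCompact_closedBall x0 r').prod (isCompact_Icc (a := T - 1) (b := T + 1))).exists_isMaxOn
    ⟨(x0, T), ⟨Metric.mem_closedBall_self hr'0.le, by simp⟩⟩ hcont.continuousOn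
  simp only at hx ht
  have h0 : Ψ (x0, T) ≤ Ψ (x, t) := hmax ⟨Metric.mem_closedBall_self hr'0.le, by simp⟩
  have hΨ0 : Ψ (x0, T) = f (pt x0 T) := by rw [hΨ]; simp
  rw [hΨ0] at h0
  have hb := hball x (by
    rw [Metric.mem_closedBall] at hx
    rw [Metric.mem_ball]
    have : r' ≤ r / 2 := min_le_left _ _
    linarith only [hx, this, hr])
  rw [← hMq] at hb
  have u1 := (abs_le.1 (hT0 T (by linarith only [hT, hTa]) x0)).1
  have u2 := (abs_le.1 (hT0 t (by linarith only [hT, hTa, ht.1]) x)).2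
  have hsum : α * ‖x - x0‖^2 + α * (t - T)^2 ≤ 2 * ε := by
    simp only [hΨ] at h0
    linarith only [h0, hb, u1, u2]
  have hsum2 : ‖x - x0‖^2 + (t - T)^2 ≤ κ'^2 := by
    refine le_of_mul_le_mul_left ?_ hα
    linarith only [hsum, hε]
  have hxk : ‖x - x0‖ ≤ κ' := le_of_sq hκ'0.le (by linarith only [hsum2, sq_nonneg (t - T)])
  have htk : |t - T| ≤ κ' := abs_le_of_sq_le_sq (by linarith only [hsum2, sq_nonneg ‖x - x0‖]) hκ'0.le
  have htk' := abs_le.1 htk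
  refine ⟨pt x t, pt (g + M (x - x0) + (4 * α) • (x - x0)) (2 * α * (t - T)), ?_, ?_, hxk.trans k3, ?_, ?_⟩
  · show 0 < t
    linarith only [htk'.1, k2, hT, hTb]
  · intro α' hα'
    have hc : Tendsto (fun Y : VN N => (Y.fst, Y.snd)) (𝓝 (pt x t)) (𝓝 (x, t)) :=
      (VN_contDiff_fst.continuous.prodMk VN_contDiff_snd.continuous).tendsto (pt x t)
    have hnb : ∀ᶠ q : E N × ℝ in 𝓝 (x, t), q ∈ Metric.closedBall x0 r' ×ˢ Set.Icc (T - 1) (T + 1) := by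
      refine prod_mem_nhds ?_ ?_
      · refine mem_of_superset (Metric.isOpen_ball.mem_nhds ?_) (Metric.ball_subset_closedBall (x := x0) (ε := r'))
        rw [mem_ball_iff_norm]
        linarith only [hxk, k1, hr'0]
      · exact Icc_mem_nhds (by linarith only [htk'.1, k2]) (by linarith only [htk'.2, k2])
    filter_upwards [hc.eventually hnb] with Y hY
    have hm : Ψ (Y.fst, Y.snd) ≤ Ψ (x, t) := hmax hY
    have e : Y - pt x t = pt (Y.fst - x) (Y.snd - t) := by rw [← pt_eta Y, ← pt_sub]; rfl
    have e2 : f (pt Y.fst Y.snd) = f Y := by rw [pt_eta]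
    have e3 : 0 ≤ α' * ‖Y - pt x t‖^2 := by positivity
    simp only [hΨ, e2] at hm
    rw [e] at e3 ⊢
    rw [hBq, inner_pt, ← hMq]
    rw [sq_exp x Y.fst x0] at hm
    have e4 : Y.fst - x0 = (x - x0) + (Y.fst - x) := by abel
    rw [e4, map_add, inner_add_right, inner_add_left, inner_add_right, inner_add_right, hsym (Y.fst - x) (x - x0)] at hm
    simp only [pt_fst, pt_snd, inner_add_left, inner_smul_left, RCLike.conj_to_real]
    linarith only [hm, e3]
  · have : (pt (g + M (x - x0) + (4 * α) • (x - x0)) (2 * α * (t - T))).fst - g = M (x - x0) + (4 * α) • (x - x0) := by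
      simp only [pt_fst]; abel
    rw [this]
    refine (norm_add_le _ _).trans ?_
    rw [norm_smul, Real.norm_of_nonneg (by positivity)]
    have h1 := M.le_opNorm (x - x0)
    have h2 := mul_le_mul_of_nonneg_left hxk (show 0 ≤ ‖M‖ + 4 * α by positivity)
    linarith only [h1, h2, k4, hκ'0]
  · simp only [pt_snd]
    rw [abs_mul, abs_of_nonneg (by positivity)]
    have h1 := mul_le_mul_of_nonneg_left htk (show 0 ≤ 2 * α by positivity)
    have h2 : 0 ≤ κ' * ‖M‖ := by positivity
    have h3 : 0 ≤ κ' * α := by positivity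
    linarith only [h1, k4, h2, h3, hκ'0]

lemma stab_err (D : Dat σ H Λ) (B : VN N →L[ℝ] VN N) (x0 g : E N) : ∃ K, 0 ≤ K ∧ ∀ κ > 0, κ ≤ 1 → ∀ x p : E N, ‖x - x0‖ ≤ κ → ‖p - g‖ ≤ κ → ∀ θ,
    |(- tq (σ θ x) B + H θ x p) - (- tq (σ θ x0) B + H θ x0 g)| ≤ K * κ := by
  obtain ⟨C1, hC1, hl⟩ := D.hlip (‖g‖ + 1) (by positivity)
  have hΛ := D.nn
  refine ⟨N * (‖B‖ * (2 * Λ)) + 2 * C1, by positivity, fun κ hκ hκ1 x p hx hp θ => ?_⟩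
  have h1 := abs_le.1 (D.tq_diff θ x x0 B)
  have hpn : ‖p‖ ≤ ‖g‖ + 1 := by
    have := norm_le_norm_add_norm_sub' p g
    linarith only [this, hp, hκ1]
  have h2 := abs_le.1 (hl θ x x0 p g hpn (by linarith only []))
  have h3 := mul_le_mul_of_nonneg_left hx (show 0 ≤ N * (‖B‖ * (2 * Λ)) by positivity)
  have h4 := mul_le_mul_of_nonneg_left (add_le_add hx hp) hC1.le
  rw [abs_le]
  constructor <;> linarith only [h1.1, h1.2, h2.1, h2.2, h3, h4]

lemma stab_sub (D : Dat σ H Λ) {U : VN N → ℝ} (hU : Continuous U) (hs : SubJ σ H (Set.Ioi 0) U) {w : E N → ℝ} (hu : ∀ ε > 0, ∃ T, ∀ t ≥ T, ∀ x, |U (pt x t) - w x| ≤ ε)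
    {x0 g : E N} {M0 : E N →L[ℝ] E N} (hj : UJet w x0 g M0) (θ : Θ) :
    - ∑ k, ⟪M0 (col (σ θ x0) k), col (σ θ x0) k⟫ + H θ x0 g ≤ 0 := by
  refine le_of_forall_alpha (K := 4 * Λ) fun α hα => ?_
  obtain ⟨B, hB, h⟩ := stab_jet hU hu hj hα
  obtain ⟨K, hK, he⟩ := stab_err D B x0 g
  have h1 : - tq (σ θ x0) B + H θ x0 g ≤ 0 := by
    refine le_of_forall_alpha (K := K + 1) fun κ hκ => ?_
    obtain ⟨X, p, hX, hj, hx, hp, hp2⟩ := h (min κ 1) (lt_min hκ one_pos)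
    have := hs X p B hX hj θ
    have h2 := (abs_le.1 (he _ (lt_min hκ one_pos) (min_le_right _ _) _ _ hx hp θ)).1
    have h3 := (abs_le.1 hp2).1
    have h4 := mul_le_mul_of_nonneg_left (min_le_left κ 1) hK
    have h5 := min_le_left κ 1
    linarith only [this, h2, h3, h4, h5]
  rw [hB] at h1
  have h2 := mul_le_mul_of_nonneg_left (D.bd θ x0) (show 0 ≤ 4 * α by positivity)
  linarith only [h1, h2]

lemma stab_sup (D : Dat σ H Λ) {U : VN N → ℝ} (hU : Continuous U) (hs : SupJ σ H (Set.Ioi 0) U) {w : E N → ℝ} (hu : ∀ ε > 0, ∃ T, ∀ t ≥ T, ∀ x, |U (pt x t) - w x| ≤ ε)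
    {x0 g : E N} {M0 : E N →L[ℝ] E N} (hj : UJet (fun x => - w x) x0 g M0) {ρ : ℝ} (hρ : 0 < ρ) : ∃ θ,
    0 ≤ ∑ k, ⟪M0 (col (σ θ x0) k), col (σ θ x0) k⟫ + H θ x0 (-g) + ρ := by
  have hΛ := D.nn
  set α := ρ / (8 * (Λ + 1)) with hα
  have hα0 : 0 < α := by positivity
  have hαe : α * (8 * (Λ + 1)) = ρ := by rw [hα]; field_simp
  obtain ⟨B, hB, h⟩ := stab_jet (f := fun X => - U X) hU.neg (w := fun x => - w x) (fun ε hε => by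
    obtain ⟨T, hT⟩ := hu ε hε
    exact ⟨T, fun t ht x => by rw [neg_sub_neg, abs_sub_comm]; exact hT t ht x⟩) hj hα0
  obtain ⟨K, hK, he⟩ := stab_err D (-B) x0 (-g)
  set κ := min 1 (ρ / (4 * (K + 1))) with hκ
  have hκ0 : 0 < κ := by positivity
  have hκe : κ ≤ ρ / (4 * (K + 1)) := min_le_right _ _
  rw [le_div_iff₀ (by positivity)] at hκe
  obtain ⟨X, p, hX, hj, hx, hp, hp2⟩ := h κ hκ0
  obtain ⟨θ, hθ⟩ := hs X p B hX hj (ρ / 4) (by positivity)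
  refine ⟨θ, ?_⟩
  have h2 := (abs_le.1 (he _ hκ0 (min_le_left _ _) _ (-p.fst) hx (by rw [neg_sub_neg, norm_sub_rev]; exact hp) θ)).2
  have h3 := (abs_le.1 hp2).1
  have hn : ∀ S : Matrix (Fin N) (Fin N) ℝ, tq S (-B) = - tq S B := fun S => by
    simp only [tq, neg_apply, inner_neg_left, Finset.sum_neg_distrib]
  rw [hn, hn, hB (σ θ x0)] at h2
  have h4 := mul_le_mul_of_nonneg_left (D.bd θ x0) (show 0 ≤ 4 * α by positivity)
  linarith only [h2, h3, hθ, h4, hκe, hαe, hα0, hκ0]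

lemma grad_C2 {φ : E N → ℝ} (hφ : ContDiff ℝ 2 φ) (x0 : E N) : ∃ (g : E N → E N) (M : E N →L[ℝ] E N),
    (∀ y, HasFDerivAt φ (innerSL ℝ (g y)) y) ∧ HasFDerivAt g M x0 := by
  set J : (E N →L[ℝ] ℝ) ≃L[ℝ] E N := (InnerProductSpace.toDual ℝ (E N)).symm.toContinuousLinearEquiv with hJ
  have h1 : ContDiff ℝ 1 (fderiv ℝ φ) := hφ.fderiv_right (by norm_num)
  have h2 : Differentiable ℝ (fun y => J (fderiv ℝ φ y)) := J.differentiable.comp (h1.differentiable (by norm_num))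
  refine ⟨fun y => J (fderiv ℝ φ y), _, fun y => ?_, (h2 x0).hasFDerivAt⟩
  have h3 := (hφ.differentiable (by norm_num) y).hasFDerivAt
  refine h3.congr_fderiv ?_
  ext d
  exact (InnerProductSpace.toDual_symm_apply (x := d) (y := fderiv ℝ φ y)).symm

theorem partE [Nonempty Θ] {c : ℝ} (hA : ∀ θ x, A θ x = σ θ x * (σ θ x)ᵀ) (D : Dat σ (fun θ x p => H θ x p - c) Λ) {U : VN N → ℝ} (hU : Continuous U)
    (hs : SubJ σ (fun θ x p => H θ x p - c) (Set.Ioi 0) U) (hs' : SupJ σ (fun θ x p => H θ x p - c) (Set.Ioi 0) U)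
    {w : E N → ℝ} (hu : ∀ ε > 0, ∃ T, ∀ t ≥ T, ∀ x, |U (pt x t) - w x| ≤ ε) : IsSolErg A H c w := by
  constructor
  · intro φ hφ x0 hmax
    obtain ⟨g, M, h1, h2⟩ := grad_C2 hφ x0
    have hj : UJet w x0 (g x0) M := by
      intro α hα
      filter_upwards [expand2 (Eventually.of_forall h1) h2 α hα, hmax] with y hy hm
      have := (abs_le.1 hy).2
      linarith only [this, hm]
    refine ciSup_le fun θ => ?_
    rw [opVal_of hA θ h1 h2]
    have := stab_sub D hU hs hu hj θ
    linarith only [this]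
  · intro φ hφ x0 hmin
    obtain ⟨g, M, h1, h2⟩ := grad_C2 hφ x0
    have hj : UJet (fun x => - w x) x0 (-g x0) (-M) := by
      intro α hα
      filter_upwards [expand2 (Eventually.of_forall h1) h2 α hα, hmin] with y hy hm
      have := (abs_le.1 hy).1
      rw [inner_neg_left, neg_apply, inner_neg_left]
      linarith only [this, hm]
    refine le_of_forall_pos_le_add fun ρ hρ => ?_
    obtain ⟨θ, hθ⟩ := stab_sup D hU hs' hu hj hρ
    rw [neg_neg] at hθ
    simp only [neg_apply, inner_neg_left, Finset.sum_neg_distrib] at hθ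
    have hbdd : BddAbove (Set.range fun θ => opVal A H θ x0 φ) := by
      obtain ⟨K, hK⟩ := D.H_le (g x0)
      refine ⟨‖M‖ * Λ + K + c, ?_⟩
      rintro _ ⟨θ, rfl⟩
      simp only
      rw [opVal_of hA θ h1 h2]
      have e1 := (abs_le.1 (hK θ x0)).2
      have e2 : -(∑ k, ⟪M (col (σ θ x0) k), col (σ θ x0) k⟫) ≤ ‖M‖ * ∑ k, ‖col (σ θ x0) k‖^2 := by
        rw [Finset.mul_sum, ← Finset.sum_neg_distrib]
        refine Finset.sum_le_sum fun k _ => ?_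
        have a1 := abs_le.1 (abs_real_inner_le_norm (M (col (σ θ x0) k)) (col (σ θ x0) k))
        have a2 := mul_le_mul_of_nonneg_right (M.le_opNorm (col (σ θ x0) k)) (norm_nonneg (col (σ θ x0) k))
        linarith only [a1.1, a2]
      have e3 := mul_le_mul_of_nonneg_left (D.bd θ x0) (norm_nonneg M)
      linarith only [e1, e2, e3]
    have := le_ciSup hbdd θ
    rw [opVal_of hA θ h1 h2] at this
    linarith only [this, hθ]
end

section
variable {N : ℕ} {Θ : Type*} {A σ : Θ → E N → Matrix (Fin N) (Fin N) ℝ} {H : Θ → E N → E N → ℝ} {Λ L C1 : ℝ}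

lemma mk_Dat {C : ℝ} (hC : 0 < C) (hσbd : ∀ (θ : Θ) (x : E N) (i j : Fin N), |σ θ x i j| ≤ C)
    (hσlip : ∀ (θ : Θ) (i j : Fin N), LipschitzWith C.toNNReal fun x : E N => σ θ x i j)
    (hH0 : ∀ (θ : Θ) (x : E N), |H θ x 0| ≤ C)
    (hHlip : ∀ R > (0:ℝ), ∃ CR > (0:ℝ), ∀ (θ : Θ) (x y p q : E N),
      ‖p‖ ≤ R → ‖q‖ ≤ R → |H θ x p - H θ y q| ≤ CR * (‖x - y‖ + ‖p - q‖))
    (hconv : ∀ (θ : Θ) (x : E N), ConvexOn ℝ Set.univ (H θ x)) (c : ℝ) :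
    Dat σ (fun θ x p => H θ x p - c) ((N:ℝ) * (N * C^2) + C + |c|) := by
  have hc := abs_nonneg c
  have hNN : 0 ≤ (N:ℝ) * (N * C^2) := by positivity
  refine ⟨by positivity, fun θ x => ?_, fun θ x y => ?_, fun θ x => ?_, fun R hR => ?_, fun θ x => ?_⟩
  · have : ∑ k, ‖col (σ θ x) k‖^2 ≤ ∑ k : Fin N, ((N:ℝ) * C^2) := by
      refine Finset.sum_le_sum fun k _ => ?_
      rw [EuclideanSpace.norm_sq_eq]
      calc _ ≤ ∑ i : Fin N, C^2 := Finset.sum_le_sum fun i _ => by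
            have := hσbd θ x i k
            exact pow_le_pow_left₀ (norm_nonneg _) this 2
        _ = N * C^2 := by simp
    simp only [Finset.sum_const, Finset.card_univ, Fintype.card_fin, nsmul_eq_mul] at this
    linarith only [this, hc, hC]
  · have : ∑ k, ‖col (σ θ x) k - col (σ θ y) k‖^2 ≤ ∑ k : Fin N, ((N:ℝ) * (C * ‖x - y‖)^2) := by
      refine Finset.sum_le_sum fun k _ => ?_
      rw [EuclideanSpace.norm_sq_eq]
      calc _ ≤ ∑ i : Fin N, (C * ‖x - y‖)^2 := Finset.sum_le_sum fun i _ => by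
            have := (hσlip θ i k).dist_le_mul x y
            rw [Real.coe_toNNReal _ hC.le, dist_eq_norm, dist_eq_norm] at this
            exact pow_le_pow_left₀ (norm_nonneg _) this 2
        _ = N * (C * ‖x - y‖)^2 := by simp
    simp only [Finset.sum_const, Finset.card_univ, Fintype.card_fin, nsmul_eq_mul] at this
    have h2 : 0 ≤ (C + |c|) * ‖x - y‖^2 := by positivity
    calc _ ≤ _ := this
      _ ≤ (N:ℝ) * (N * C^2) * ‖x - y‖^2 + (C + |c|) * ‖x - y‖^2 := by rw [mul_pow]; linarith only [h2]
      _ = _ := by ring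
  · have := abs_sub (H θ x 0) c
    have := hH0 θ x
    show |H θ x 0 - c| ≤ _
    linarith only [this, hNN, abs_sub (H θ x 0) c]
  · obtain ⟨CR, h, h'⟩ := hHlip R hR
    refine ⟨CR, h, fun θ x y p q h1 h2 => ?_⟩
    rw [sub_sub_sub_cancel_right]
    exact h' θ x y p q h1 h2
  · have := (hconv θ x).add_const (-c)
    have e : (fun p => H θ x p - c) = H θ x + fun _ => -c := by
      funext p; exact sub_eq_add_neg _ _
    rw [e]; exact this

lemma A_quad (S : Matrix (Fin N) (Fin N) ℝ) (y : E N) : (⇑y) ⬝ᵥ ((S * Sᵀ) *ᵥ (⇑y)) = ∑ k, ⟪col S k, y⟫^2 := by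
  rw [← Matrix.mulVec_mulVec, Matrix.dotProduct_mulVec, ← Matrix.mulVec_transpose, dotProduct]
  refine Finset.sum_congr rfl fun k _ => ?_
  have : (Sᵀ *ᵥ (⇑y)) k = ⟪col S k, y⟫ := by
    simp [Matrix.mulVec, dotProduct, col, PiLp.inner_apply, mul_comm]
  rw [this, sq]

lemma A_zero (hA : ∀ θ x, A θ x = σ θ x * (σ θ x)ᵀ) (θ : Θ) (x : E N) : A θ x = 0 ↔ σ θ x = 0 := by
  rw [hA, ← Matrix.conjTranspose_eq_transpose_of_trivial]
  exact Matrix.self_mul_conjTranspose_eq_zero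

lemma ell_of (hA : ∀ θ x, A θ x = σ θ x * (σ θ x)ᵀ) (hell : InverDege A) :
    ∀ δ > 0, ∃ ν > (0:ℝ), ∀ x, (∀ y ∈ degenSet A, δ < dist x y) → ∀ θ y, ν * ‖y‖^2 ≤ ∑ k, ⟪col (σ θ x) k, y⟫^2 := by
  intro δ hδ
  obtain ⟨ν, hν, h⟩ := hell δ hδ
  refine ⟨ν, hν, fun x hx θ y => ?_⟩
  have := (h θ x hx).dotProduct_mulVec_nonneg (⇑y)
  rw [hA, Matrix.sub_mulVec, dotProduct_sub, star_trivial, A_quad, Matrix.smul_mulVec, Matrix.one_mulVec, dotProduct_smul] at this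
  have e : (⇑y) ⬝ᵥ (⇑y) = ‖y‖^2 := by
    rw [EuclideanSpace.norm_sq_eq, dotProduct]
    exact Finset.sum_congr rfl fun i _ => by rw [Real.norm_eq_abs, sq_abs, sq]
  rw [e, smul_eq_mul] at this
  linarith only [this]

lemma degen_closed {C : ℝ} (hA : ∀ θ x, A θ x = σ θ x * (σ θ x)ᵀ)
    (hσlip : ∀ (θ : Θ) (i j : Fin N), LipschitzWith C.toNNReal fun x : E N => σ θ x i j) : IsClosed (degenSet A) := by
  have : degenSet A = ⋂ θ, ⋂ i, ⋂ j, {x | σ θ x i j = 0} := by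
    ext x
    simp only [degenSet, Set.mem_ofPred_eq, A_zero hA, Set.mem_iInter]
    exact forall_congr' fun θ => ⟨fun h i j => by rw [h]; rfl, fun h => by ext i j; exact h i j⟩
  rw [this]
  exact isClosed_iInter fun θ => isClosed_iInter fun i => isClosed_iInter fun j =>
    isClosed_eq (hσlip θ i j).continuous continuous_const

lemma degen_per (hA : ∀ θ x, A θ x = σ θ x * (σ θ x)ᵀ) (hσper : ∀ θ : Θ, ZPeriodic (σ θ)) :
    ZPeriodic (fun x => x ∈ degenSet A) := by
  intro x k
  simp only [degenSet, Set.mem_ofPred_eq, A_zero hA]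
  simp only [hσper _ x k]

lemma mk_Sol_u [Nonempty Θ] (D : Dat σ H Λ) (hA : ∀ θ x, A θ x = σ θ x * (σ θ x)ᵀ) {u : E N → ℝ → ℝ} {C : ℝ}
    (hC : 0 < C) (hCL : C ≤ L)
    (huper : ∀ t : ℝ, ZPeriodic fun x => u x t)
    (hucont : ContinuousOn (fun q : E N × ℝ => u q.1 q.2) (Set.univ ×ˢ Set.Ici 0))
    (husol : IsSolCP A H u)
    (hulip : ∀ t : ℝ, 0 ≤ t → LipschitzWith C.toNNReal fun x => u x t) (c : ℝ) :
    Sol σ (fun θ x p => H θ x p - c) L (fun X => u X.fst (max X.snd 0) + c * max X.snd 0) := by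
  have hs := (VN_contDiff_snd (N := N)).continuous
  have hf := (VN_contDiff_fst (N := N)).continuous
  have hm : Continuous fun X : VN N => max X.snd 0 := hs.max continuous_const
  have hee : ∀ X : VN N, X.snd ∈ Set.Ioi (0:ℝ) →
      (fun X : VN N => u X.fst (max X.snd 0) + c * max X.snd 0) =ᶠ[𝓝 X] (fun X => u X.fst X.snd + c * X.snd) := by
    intro X hX
    filter_upwards [(isOpen_Ioi.preimage hs).mem_nhds hX] with Y hY
    have : max Y.snd 0 = Y.snd := max_eq_left (le_of_lt hY)
    rw [this]
  refine ⟨?_, fun X d => ?_, fun t x k => ?_, ?_, ?_⟩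
  · refine Continuous.add ?_ (continuous_const.mul hm)
    exact hucont.comp_continuous (f := fun X : VN N => (X.fst, max X.snd 0)) (hf.prodMk hm) fun X => ⟨trivial, Set.mem_Ici.2 (le_max_right _ _)⟩
  · have e1 : (X + pt d 0).fst = X.fst + d := rfl
    have e2 : (X + pt d 0).snd = X.snd := by
      show X.snd + 0 = X.snd
      exact add_zero _
    simp only [e1, e2]
    rw [add_sub_add_right_eq_sub]
    have := (hulip (max X.snd 0) (le_max_right _ _)).dist_le_mul (X.fst + d) X.fst
    rw [Real.coe_toNNReal _ hC.le, Real.dist_eq, dist_eq_norm, add_sub_cancel_left] at this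
    exact this.trans (mul_le_mul_of_nonneg_right hCL (norm_nonneg _))
  · have := huper (max t 0) x k
    simp only [pt_fst, pt_snd] at this ⊢
    rw [this]
  · intro X p B hX hj
    exact sub_jet D hA husol.1 c X p B hX (hj.congr (hee X hX))
  · intro X p B hX hj
    refine sup_jet D hA husol.2 c X p B hX (hj.congr ?_)
    filter_upwards [hee X hX] with Y hY
    rw [hY]

lemma mk_Sol_v [Nonempty Θ] (D : Dat σ H Λ) (hA : ∀ θ x, A θ x = σ θ x * (σ θ x)ᵀ) {v : E N → ℝ} {K : NNReal}
    (hK : (K:ℝ) ≤ L) (hvper : ZPeriodic v) (hvl : LipschitzWith K v) {c : ℝ} (h : IsSolErg A H c v) :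
    Sol σ (fun θ x p => H θ x p - c) L (fun X => v X.fst) := by
  have hf := (VN_contDiff_fst (N := N)).continuous
  refine ⟨hvl.continuous.comp hf, fun X d => ?_, fun t x k => hvper x k, v_sub D hA h.1, v_sup D hA h.2⟩
  have := hvl.dist_le_mul (X.fst + d) X.fst
  rw [Real.dist_eq, dist_eq_norm, add_sub_cancel_left] at this
  exact this.trans (mul_le_mul_of_nonneg_right hK (norm_nonneg _))
end

set_option maxHeartbeats 1000000 in
theorem statement0
    {N : ℕ} {Θ : Type*} [MetricSpace Θ] [Nonempty Θ]
    (C : ℝ) (hC : 0 < C)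
    (σm : Θ → E N → Matrix (Fin N) (Fin N) ℝ)
    (A : Θ → E N → Matrix (Fin N) (Fin N) ℝ)
    -- (H1)
    (hA : ∀ (θ : Θ) (x : E N), A θ x = σm θ x * (σm θ x)ᵀ)
    (hσper : ∀ θ : Θ, ZPeriodic (σm θ))
    (hσbd : ∀ (θ : Θ) (x : E N) (i j : Fin N), |σm θ x i j| ≤ C)
    (hσlip : ∀ (θ : Θ) (i j : Fin N), LipschitzWith C.toNNReal fun x : E N => σm θ x i j)
    (H : Θ → E N → E N → ℝ)
    -- (H2)
    (hHper : ∀ (θ : Θ) (p : E N), ZPeriodic fun x => H θ x p)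
    (hH0 : ∀ (θ : Θ) (x : E N), |H θ x 0| ≤ C)
    (hHlip : ∀ R > (0:ℝ), ∃ CR > (0:ℝ), ∀ (θ : Θ) (x y p q : E N),
      ‖p‖ ≤ R → ‖q‖ ≤ R → |H θ x p - H θ y q| ≤ CR * (‖x - y‖ + ‖p - q‖))
    -- (H3): Lipschitz solutions of the Cauchy problem and the discounted problems,
    -- and a solution (c,v) of the ergodic problem
    (u : E N → ℝ → ℝ) (u₀ : E N → ℝ)
    (huper : ∀ t : ℝ, ZPeriodic fun x => u x t)
    (hucont : ContinuousOn (fun q : E N × ℝ => u q.1 q.2) (Set.univ ×ˢ Set.Ici 0))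
    (huinit : ∀ x : E N, u x 0 = u₀ x)
    (husol : IsSolCP A H u)
    (hulip : ∀ t : ℝ, 0 ≤ t → LipschitzWith C.toNNReal fun x => u x t)
    (hdisc : ∀ lam > (0:ℝ), ∃ w : E N → ℝ, ZPeriodic w ∧ Continuous w ∧
      IsSolDisc A H lam w ∧ LipschitzWith C.toNNReal w)
    (c : ℝ) (v : E N → ℝ) (hvper : ZPeriodic v)
    (hvlip : ∃ L : NNReal, LipschitzWith L v)
    (hverg : IsSolErg A H c v)
    -- (inver_dege)
    (hell : InverDege A)
    -- convexity of H_θ(x,·)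
    (hconv : ∀ (θ : Θ) (x : E N), ConvexOn ℝ Set.univ (H θ x))
    -- (cvx_neuf): uniform strict convexity on Σ
    (hscvx : ∀ x ∈ degenSet A, ∀ lam : ℝ, 0 < lam → lam < 1 →
      ∀ p q : E N, p ≠ q →
        0 < ⨅ θ, (lam * H θ x p + (1 - lam) * H θ x q
          - H θ x (lam • p + (1 - lam) • q)))
    :
    ∃ uInf : E N → ℝ, ZPeriodic uInf ∧ (∃ L : NNReal, LipschitzWith L uInf) ∧
      IsSolErg A H c uInf ∧
      TendstoUniformly (fun (t : ℝ) (x : E N) => u x t + c * t) uInf atTop := by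
  obtain ⟨K, hK⟩ := hvlip
  have D0 := mk_Dat hC hσbd hσlip hH0 hHlip hconv 0
  simp only [sub_zero] at D0
  have D := mk_Dat hC hσbd hσlip hH0 hHlip hconv c
  set L : ℝ := max C K with hLdef
  have hL : 0 ≤ L := hC.le.trans (le_max_left _ _)
  have SU := mk_Sol_u (L := L) D0 hA hC (le_max_left _ _) huper hucont husol hulip c
  have SV := mk_Sol_v (L := L) D0 hA (le_max_right _ _) hvper hK hverg
  have hell' := ell_of hA hell
  set U : VN N → ℝ := fun X => u X.fst (max X.snd 0) + c * max X.snd 0 with hU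
  have main : ∃ w : E N → ℝ, ∀ ε > 0, ∃ T, ∀ t ≥ T, ∀ x, |U (pt x t) - w x| ≤ ε := by
    rcases (degenSet A).eq_empty_or_nonempty with hS | ⟨x0, hx0⟩
    · obtain ⟨ν, hν, hν'⟩ := hell' 1 one_pos
      obtain ⟨m, hm⟩ := partC D hL hν (fun x => hν' x (by simp [hS])) SU SV
      exact ⟨fun x => v x + m, hm⟩
    · obtain ⟨M1, hM1⟩ := SV.bound D hL SU
      obtain ⟨M2, hM2⟩ := SU.bound D hL SV
      simp only [pt_fst] at hM1 hM2
      have hvb : ∀ x, |v x| ≤ |v 0| + L * √N := by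
        intro x
        obtain ⟨y, hy, hy2⟩ := SV.per.red x 0
        have h1 := hy2 0
        simp only [pt_fst] at h1
        rw [sub_zero] at hy
        have h2 := hK.dist_le_mul y 0
        rw [Real.dist_eq, dist_eq_norm, sub_zero] at h2
        have h3 : ‖y‖ ≤ √N := Real.le_sqrt_of_sq_le hy
        have h4 : (K:ℝ) * ‖y‖ ≤ L * √N := mul_le_mul (le_max_right _ _) h3 (norm_nonneg _) hL
        have h5 := abs_sub_abs_le_abs_sub (v y) (v 0)
        rw [← h1]
        linarith only [h2, h4, h5]
      have SV' : Sol σm (fun θ x p => H θ x p - c) L (fun X => (fun x => v x + (-M1)) X.fst) := SV.addc (-M1)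
      set B := |v 0| + L * √N with hB
      have hB0 : 0 ≤ B := by positivity
      have hsc := usc D (degen_closed hA hσlip) (fun θ p x k => by
          have := hHper θ p x k
          simp only at this ⊢
          rw [this]) (degen_per hA hσper) (fun x hx lam h0 h1 p q hpq => by
          refine ⟨_, hscvx x hx lam h0 h1 p q hpq, fun θ => ?_⟩
          have hb : BddBelow (Set.range fun θ => (lam * H θ x p + (1 - lam) * H θ x q
              - H θ x (lam • p + (1 - lam) • q))) := by
            refine ⟨0, ?_⟩
            rintro _ ⟨θ, rfl⟩
            have := (hconv θ x).2 (Set.mem_univ p) (Set.mem_univ q) h0.le (sub_nonneg.2 h1.le) (by ring)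
            simp only [smul_eq_mul] at this
            linarith only [this]
          have := ciInf_le hb θ
          refine this.trans (le_of_eq ?_)
          ring)
      have hUb : ∀ x t, 0 ≤ t → |U (pt x t)| ≤ B + |M1| + |M2| := by
        intro x t ht
        have h1 := hM1 t ht x
        have h2 := hM2 t ht x
        have h3 := abs_le.1 (hvb x)
        have h4 := le_abs_self M1
        have h5 := le_abs_self M2
        have h6 := abs_nonneg M1
        have h7 := abs_nonneg M2
        rw [abs_le]
        constructor
        · linarith only [h1, h3.1, h4, h7]
        · linarith only [h2, h3.2, h5, h6]
      refine partD3 D hL SU hUb fun ρ hρ τ hτ => ?_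
      refine partD2 D hL hx0 SU SV' (hK.continuous.add continuous_const) (fun y hy θ k => ?_) hell' hsc
        (M0 := B + |M1| + |M2|) (fun x t ht => ?_) hUb (fun x => ?_) hρ hτ
      · have := (A_zero hA θ y).1 (hy θ)
        rw [this]; rfl
      · have := hM1 t ht x
        show v x + -M1 ≤ U (pt x t)
        linarith only [this]
      · show |v x + -M1| ≤ _
        have h1 := abs_add_le (v x) (-M1)
        rw [abs_neg] at h1
        linarith only [h1, hvb x, abs_nonneg M2]
  obtain ⟨w, hw⟩ := main
  have hlim : ∀ x, Tendsto (fun t => U (pt x t)) atTop (𝓝 (w x)) := by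
    intro x
    rw [Metric.tendsto_atTop]
    intro ε hε
    obtain ⟨T, hT⟩ := hw (ε/2) (by positivity)
    refine ⟨T, fun t ht => ?_⟩
    rw [Real.dist_eq]
    exact (hT t ht x).trans_lt (by linarith)
  obtain ⟨h1, h2, -⟩ := net (F := fun t x => U (pt x t)) hL (fun t x y => SU.lipx x y t) (fun t => SU.per t) hlim
  refine ⟨w, h2, ⟨L.toNNReal, LipschitzWith.of_dist_le_mul fun x y => ?_⟩, partE hA D SU.cont SU.sub SU.sup hw, ?_⟩
  · rw [Real.coe_toNNReal _ hL, Real.dist_eq, dist_eq_norm]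
    exact h1 x y
  · rw [Metric.tendstoUniformly_iff]
    intro ε hε
    obtain ⟨T, hT⟩ := hw (ε/2) (by positivity)
    filter_upwards [eventually_ge_atTop T, eventually_ge_atTop 0] with t ht ht0 x
    have := hT t ht x
    simp only [hU, pt_fst, pt_snd, max_eq_left ht0] at this
    rw [dist_comm, Real.dist_eq]
    exact this.trans_lt (by linarith)

end LargeTimeBehavior
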